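/- Let S be a nonempty set of prime numbers such that A = ℤ_S contains a unit λ with λ² − 1 also a unit in A, and let T be any set of prime numbers containing S. Then the cokernel of the homomorphism H₂(SL₂(ℤ_S), ℤ) → H₂(SL₂(ℤ_T), ℤ) induced by the ring inclusion ℤ_S ⊆ ℤ_T is isomorphic to the direct sum ⊕_{q ∈ T∖S} (ℤ/qℤ)^× of the multiplicative groups of the residue fields at the primes of T not in S. -/

import Mathlib

open Finsupp DirectSum

set_option maxHeartbeats 1000000
set_option synthInstance.maxHeartbeats 400000

/-- `ℤ_S`: the subring of `ℚ` obtained by localizing `ℤ` at the primes in `S`, i.e. the smallest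
subring of `ℚ` containing the inverses of the elements of `S`. -/
def ZS (S : Set ℕ) : Subring ℚ :=
  Subring.closure ((fun p : ℕ => (p : ℚ)⁻¹) '' S)





noncomputable section

/-- Degree-2 differential of the bar complex of `G` with trivial `ℤ` coefficients:
`d₂([g|h]) = [h] - [gh] + [g]`. -/
def barD2 (G : Type*) [Group G] : ((G × G) →₀ ℤ) →ₗ[ℤ] (G →₀ ℤ) :=
  Finsupp.lsum ℤ fun p => LinearMap.toSpanSingleton ℤ _
    (Finsupp.single p.2 1 - Finsupp.single (p.1 * p.2) 1 + Finsupp.single p.1 1)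

/-- Degree-3 differential of the bar complex of `G` with trivial `ℤ` coefficients:
`d₃([g|h|k]) = [h|k] - [gh|k] + [g|hk] - [g|h]`. -/
def barD3 (G : Type*) [Group G] : ((G × G × G) →₀ ℤ) →ₗ[ℤ] ((G × G) →₀ ℤ) :=
  Finsupp.lsum ℤ fun t => LinearMap.toSpanSingleton ℤ _
    (Finsupp.single (t.2.1, t.2.2) 1 - Finsupp.single (t.1 * t.2.1, t.2.2) 1 +
      Finsupp.single (t.1, t.2.1 * t.2.2) 1 - Finsupp.single (t.1, t.2.1) 1)

/-- The second homology group `H₂(G, ℤ)` of a group `G` with trivial integer coefficients,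
computed via the bar complex: 2-cycles modulo 2-boundaries. -/
abbrev H2 (G : Type*) [Group G] :=
  ↥(LinearMap.ker (barD2 G)) ⧸
    (LinearMap.range (barD3 G)).comap (LinearMap.ker (barD2 G)).subtype

variable {G G' : Type*} [Group G] [Group G']

/-- The map on degree-1 bar chains induced by a group homomorphism. -/
def mapC1 (f : G →* G') : (G →₀ ℤ) →ₗ[ℤ] (G' →₀ ℤ) :=
  Finsupp.lmapDomain ℤ ℤ f

/-- The map on degree-2 bar chains induced by a group homomorphism. -/
def mapC2 (f : G →* G') : ((G × G) →₀ ℤ) →ₗ[ℤ] ((G' × G') →₀ ℤ) :=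
  Finsupp.lmapDomain ℤ ℤ (Prod.map f f)

/-- The map on degree-3 bar chains induced by a group homomorphism. -/
def mapC3 (f : G →* G') : ((G × G × G) →₀ ℤ) →ₗ[ℤ] ((G' × G' × G') →₀ ℤ) :=
  Finsupp.lmapDomain ℤ ℤ (fun t => (f t.1, f t.2.1, f t.2.2))

lemma mapC1_single (f : G →* G') (a : G) (b : ℤ) :
    mapC1 f (Finsupp.single a b) = Finsupp.single (f a) b := by
  simp [mapC1, Finsupp.lmapDomain_apply, Finsupp.mapDomain_single]

lemma mapC2_single (f : G →* G') (a : G × G) (b : ℤ) :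
    mapC2 f (Finsupp.single a b) = Finsupp.single (f a.1, f a.2) b := by
  simp [mapC2, Finsupp.lmapDomain_apply, Finsupp.mapDomain_single, Prod.map]

lemma mapC3_single (f : G →* G') (a : G × G × G) (b : ℤ) :
    mapC3 f (Finsupp.single a b) = Finsupp.single (f a.1, f a.2.1, f a.2.2) b := by
  simp [mapC3, Finsupp.lmapDomain_apply, Finsupp.mapDomain_single]

lemma barD2_comm (f : G →* G') :
    (barD2 G').comp (mapC2 f) = (mapC1 f).comp (barD2 G) := by
  apply Finsupp.lhom_ext
  intro p b
  simp only [LinearMap.comp_apply, mapC2_single, barD2, Finsupp.lsum_single,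
    LinearMap.toSpanSingleton_apply, map_smul, map_add, map_sub, mapC1_single, map_mul]

lemma barD3_comm (f : G →* G') :
    (barD3 G').comp (mapC3 f) = (mapC2 f).comp (barD3 G) := by
  apply Finsupp.lhom_ext
  intro t b
  simp only [LinearMap.comp_apply, mapC3_single, barD3, Finsupp.lsum_single,
    LinearMap.toSpanSingleton_apply, map_smul, map_add, map_sub, mapC2_single, map_mul]

/-- The map `H₂(G, ℤ) → H₂(G′, ℤ)` induced by a group homomorphism `f : G → G′`. -/
def mapH2 (f : G →* G') : H2 G →ₗ[ℤ] H2 G' :=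
  Submodule.mapQ _ _
    ((mapC2 f).restrict (p := LinearMap.ker (barD2 G)) (q := LinearMap.ker (barD2 G'))
      (fun x hx => by
        have := LinearMap.congr_fun (barD2_comm f) x
        simp only [LinearMap.comp_apply] at this
        simp only [LinearMap.mem_ker] at hx ⊢
        rw [this, hx, map_zero]))
    (by
      rintro ⟨x, hx⟩ hmem
      simp only [Submodule.mem_comap, LinearMap.mem_range, Submodule.coe_subtype] at hmem ⊢
      obtain ⟨z, hz⟩ := hmem
      refine ⟨mapC3 f z, ?_⟩
      have := LinearMap.congr_fun (barD3_comm f) z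
      simp only [LinearMap.comp_apply] at this
      rw [this, hz]
      rfl)


section HomologyAPI

variable {Γ Γ' M M' : Type*} [Group Γ] [Group Γ'] [AddCommGroup M] [AddCommGroup M']

/-- Inhomogeneous 2-cocycles of `Γ` with values in the trivial module `M`. -/
def IsTwoCocycle (f : Γ → Γ → M) : Prop :=
  ∀ g h k, f h k - f (g * h) k + f g (h * k) - f g h = 0

/-- A function on pairs, extended linearly to the bar chains of degree 2. -/
def evalChain (f : Γ → Γ → M) : ((Γ × Γ) →₀ ℤ) →ₗ[ℤ] M :=
  Finsupp.lsum ℤ fun p => LinearMap.toSpanSingleton ℤ M (f p.1 p.2)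

lemma evalChain_single (f : Γ → Γ → M) (p : Γ × Γ) (n : ℤ) :
    evalChain f (Finsupp.single p n) = n • f p.1 p.2 := by
  simp [evalChain]

lemma barD2_single (p : Γ × Γ) (n : ℤ) : barD2 Γ (Finsupp.single p n) =
    n • (Finsupp.single p.2 1 - Finsupp.single (p.1 * p.2) 1 + Finsupp.single p.1 1) := by
  simp only [barD2, Finsupp.lsum_single, LinearMap.toSpanSingleton_apply]

lemma barD3_single (t : Γ × Γ × Γ) (n : ℤ) : barD3 Γ (Finsupp.single t n) =
    n • (Finsupp.single (t.2.1, t.2.2) 1 - Finsupp.single (t.1 * t.2.1, t.2.2) 1 +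
      Finsupp.single (t.1, t.2.1 * t.2.2) 1 - Finsupp.single (t.1, t.2.1) 1) := by
  simp only [barD3, Finsupp.lsum_single, LinearMap.toSpanSingleton_apply]

lemma evalChain_comp_barD3 {f : Γ → Γ → M} (hf : IsTwoCocycle f) :
    (evalChain f).comp (barD3 Γ) = 0 := by
  apply Finsupp.lhom_ext
  intro t n
  simp only [LinearMap.comp_apply, barD3_single, map_smul, map_add, map_sub, evalChain_single,
    one_smul, LinearMap.zero_apply]
  rw [hf, smul_zero]

/-- Evaluation of a 2-cocycle on second homology. -/
def evalH2 (f : Γ → Γ → M) (hf : IsTwoCocycle f) : H2 Γ →ₗ[ℤ] M :=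
  Submodule.liftQ _ ((evalChain f).comp (LinearMap.ker (barD2 Γ)).subtype) (by
    rintro ⟨x, hx⟩ hmem
    simp only [Submodule.mem_comap, LinearMap.mem_range, Submodule.coe_subtype] at hmem
    obtain ⟨z, hz⟩ := hmem
    simp only [LinearMap.mem_ker, LinearMap.comp_apply, Submodule.coe_subtype]
    rw [← hz]
    exact LinearMap.congr_fun (evalChain_comp_barD3 hf) z)

/-- The homology class of a 2-cycle. -/
def classH2 (z : LinearMap.ker (barD2 Γ)) : H2 Γ := Submodule.Quotient.mk z

lemma classH2_surjective (x : H2 Γ) : ∃ z : LinearMap.ker (barD2 Γ), classH2 z = x :=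
  Submodule.Quotient.mk_surjective _ x

lemma evalH2_class (f : Γ → Γ → M) (hf : IsTwoCocycle f) (z : LinearMap.ker (barD2 Γ)) :
    evalH2 f hf (classH2 z) = evalChain f z.1 := rfl

lemma mapC2_mem_ker (j : Γ →* Γ') (z : LinearMap.ker (barD2 Γ)) :
    mapC2 j z.1 ∈ LinearMap.ker (barD2 Γ') := by
  have := LinearMap.congr_fun (barD2_comm j) z.1
  simp only [LinearMap.comp_apply] at this
  rw [LinearMap.mem_ker, this, LinearMap.mem_ker.1 z.2, map_zero]

lemma mapH2_class (j : Γ →* Γ') (z : LinearMap.ker (barD2 Γ)) :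
    mapH2 j (classH2 z) = classH2 ⟨mapC2 j z.1, mapC2_mem_ker j z⟩ := rfl

lemma evalChain_mapC2 (f : Γ' → Γ' → M) (j : Γ →* Γ') (z : (Γ × Γ) →₀ ℤ) :
    evalChain f (mapC2 j z) = evalChain (fun g h => f (j g) (j h)) z := by
  have : (evalChain f).comp (mapC2 j) = evalChain (fun g h => f (j g) (j h)) := by
    apply Finsupp.lhom_ext
    intro p n
    simp only [LinearMap.comp_apply, mapC2_single, evalChain_single]
  exact LinearMap.congr_fun this z

lemma IsTwoCocycle.comp {f : Γ' → Γ' → M} (hf : IsTwoCocycle f) (j : Γ →* Γ') :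
    IsTwoCocycle (fun g h => f (j g) (j h)) := by
  intro g h k
  simp only [map_mul]
  exact hf _ _ _

lemma IsTwoCocycle.map {f : Γ → Γ → M} (hf : IsTwoCocycle f) (p : M →+ M') :
    IsTwoCocycle (fun g h => p (f g h)) := by
  intro g h k
  have := congrArg p (hf g h k)
  simpa only [map_sub, map_add, map_zero] using this

lemma evalH2_mapH2 {f : Γ' → Γ' → M} (hf : IsTwoCocycle f) (j : Γ →* Γ') (x : H2 Γ) :
    evalH2 f hf (mapH2 j x) = evalH2 _ (hf.comp j) x := by
  obtain ⟨z, rfl⟩ := classH2_surjective x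
  rw [mapH2_class, evalH2_class, evalH2_class, evalChain_mapC2]

lemma evalChain_map (f : Γ → Γ → M) (p : M →+ M') (z : (Γ × Γ) →₀ ℤ) :
    evalChain (fun g h => p (f g h)) z = p (evalChain f z) := by
  have : evalChain (fun g h => p (f g h)) = p.toIntLinearMap.comp (evalChain f) := by
    apply Finsupp.lhom_ext
    intro q n
    simp only [LinearMap.comp_apply, evalChain_single, AddMonoidHom.coe_toIntLinearMap, map_zsmul]
  exact LinearMap.congr_fun this z

lemma evalH2_map {f : Γ → Γ → M} (hf : IsTwoCocycle f) (p : M →+ M') (x : H2 Γ) :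
    evalH2 _ (hf.map p) x = p (evalH2 f hf x) := by
  obtain ⟨z, rfl⟩ := classH2_surjective x
  rw [evalH2_class, evalH2_class, evalChain_map]

lemma evalH2_coboundary {f : Γ → Γ → M} (hf : IsTwoCocycle f) (φ : Γ → M)
    (h : ∀ g h, f g h = φ h - φ (g * h) + φ g) (x : H2 Γ) : evalH2 f hf x = 0 := by
  obtain ⟨z, rfl⟩ := classH2_surjective x
  rw [evalH2_class]
  have : evalChain f = (Finsupp.lsum ℤ fun g => LinearMap.toSpanSingleton ℤ M (φ g)).comp
      (barD2 Γ) := by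
    apply Finsupp.lhom_ext
    intro q n
    simp only [LinearMap.comp_apply, evalChain_single, barD2_single, map_smul, map_add, map_sub,
      Finsupp.lsum_single, LinearMap.toSpanSingleton_apply, one_smul, h]
  rw [this, LinearMap.comp_apply, LinearMap.mem_ker.1 z.2, map_zero]

lemma mapH2_comp {Γ'' : Type*} [Group Γ''] (j : Γ →* Γ') (k : Γ' →* Γ'') (x : H2 Γ) :
    mapH2 k (mapH2 j x) = mapH2 (k.comp j) x := by
  obtain ⟨z, rfl⟩ := classH2_surjective x
  rw [mapH2_class, mapH2_class, mapH2_class]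
  congr 1
  apply Subtype.ext
  have : (mapC2 k).comp (mapC2 j) = mapC2 (k.comp j) := by
    apply Finsupp.lhom_ext
    intro q n
    simp only [LinearMap.comp_apply, mapC2_single, MonoidHom.comp_apply]
  exact LinearMap.congr_fun this z.1

lemma mapH2_id (x : H2 Γ) : mapH2 (MonoidHom.id Γ) x = x := by
  obtain ⟨z, rfl⟩ := classH2_surjective x
  rw [mapH2_class]
  congr 1
  apply Subtype.ext
  have : mapC2 (MonoidHom.id Γ) = LinearMap.id := by
    apply Finsupp.lhom_ext
    intro q n
    simp only [mapC2_single, LinearMap.id_apply, MonoidHom.id_apply]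
  exact LinearMap.congr_fun this z.1

/-- A homomorphism from a perfect group to an abelian group is trivial. -/
lemma eq_zero_of_perfect (hΓ : commutator Γ = ⊤) (φ : Γ → M)
    (h : ∀ g h, φ (g * h) = φ g + φ h) (g : Γ) : φ g = 0 := by
  let ψ : Γ →* Multiplicative M := MonoidHom.mk' (fun g => Multiplicative.ofAdd (φ g))
    (fun a b => by rw [h, ofAdd_add])
  have h1 : commutator Γ ≤ ψ.ker := Abelianization.commutator_subset_ker ψ
  have h2 : g ∈ ψ.ker := h1 (hΓ ▸ Subgroup.mem_top g)
  exact h2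

lemma barD2_surjective (hΓ : commutator Γ = ⊤) : Function.Surjective (barD2 Γ) := by
  rw [← LinearMap.range_eq_top]
  have key : ∀ g : Γ, (LinearMap.range (barD2 Γ)).mkQ (Finsupp.single g 1) = 0 := by
    apply eq_zero_of_perfect hΓ
    intro g h
    have : (LinearMap.range (barD2 Γ)).mkQ (barD2 Γ (Finsupp.single (g, h) 1)) = 0 := by
      rw [Submodule.mkQ_apply, Submodule.Quotient.mk_eq_zero]
      exact ⟨_, rfl⟩
    rw [barD2_single, one_smul, map_add, map_sub] at this
    simp only at this
    rw [sub_add_eq_add_sub, sub_eq_zero] at this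
    rw [← this, add_comm]
  rw [eq_top_iff]
  rintro x -
  induction x using Finsupp.induction_linear with
  | zero => exact zero_mem _
  | add x y hx hy => exact add_mem hx hy
  | single g n =>
    have h := key g
    rw [Submodule.mkQ_apply, Submodule.Quotient.mk_eq_zero] at h
    have := Submodule.smul_mem _ n h
    rwa [Finsupp.smul_single, smul_eq_mul, mul_one] at this

lemma exists_barD2_section (hΓ : commutator Γ = ⊤) :
    ∃ e : (Γ →₀ ℤ) →ₗ[ℤ] ((Γ × Γ) →₀ ℤ), ∀ x, barD2 Γ (e x) = x := by
  obtain ⟨e, he⟩ := Module.projective_lifting_property (barD2 Γ) LinearMap.id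
    (barD2_surjective hΓ)
  exact ⟨e, fun x => LinearMap.congr_fun he x⟩

/-- A 2-cocycle of a perfect group which vanishes on homology is a coboundary. -/
lemma exists_primitive (hΓ : commutator Γ = ⊤) {f : Γ → Γ → M} (hf : IsTwoCocycle f)
    (h0 : ∀ x, evalH2 f hf x = 0) :
    ∃ φ : Γ → M, ∀ g h, f g h = φ h - φ (g * h) + φ g := by
  obtain ⟨e, he⟩ := exists_barD2_section hΓ
  refine ⟨fun g => evalChain f (e (Finsupp.single g 1)), fun g h => ?_⟩
  have := h0 (classH2 ⟨Finsupp.single (g, h) 1 - e (barD2 Γ (Finsupp.single (g, h) 1)), by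
    rw [LinearMap.mem_ker, map_sub, he, sub_self]⟩)
  rw [evalH2_class, map_sub, evalChain_single, barD2_single, one_smul, one_smul, map_add, map_sub,
    map_add, map_sub, sub_eq_zero] at this
  exact this

/-- The universal 2-cocycle of a perfect group. -/
lemma exists_universal_cocycle (hΓ : commutator Γ = ⊤) :
    ∃ (f : Γ → Γ → H2 Γ) (hf : IsTwoCocycle f), ∀ x, evalH2 f hf x = x := by
  obtain ⟨e, he⟩ := exists_barD2_section hΓ
  let P : ((Γ × Γ) →₀ ℤ) →ₗ[ℤ] LinearMap.ker (barD2 Γ) :=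
    (LinearMap.id - e.comp (barD2 Γ)).codRestrict _ (fun x => by
      simp only [LinearMap.mem_ker, LinearMap.sub_apply, LinearMap.id_apply, LinearMap.comp_apply,
        map_sub, he, sub_self])
  let Q : ((Γ × Γ) →₀ ℤ) →ₗ[ℤ] H2 Γ := (Submodule.mkQ _).comp P
  have hQ : ∀ z : LinearMap.ker (barD2 Γ), Q z.1 = classH2 z := by
    intro z
    change Submodule.Quotient.mk (P z.1) = Submodule.Quotient.mk z
    congr 1
    apply Subtype.ext
    change z.1 - e (barD2 Γ z.1) = z.1
    rw [LinearMap.mem_ker.1 z.2, map_zero, sub_zero]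
  have hd : (barD2 Γ).comp (barD3 Γ) = 0 := by
    apply Finsupp.lhom_ext
    intro t n
    simp only [LinearMap.comp_apply, barD3_single, map_smul, map_add, map_sub, barD2_single,
      one_smul, LinearMap.zero_apply, mul_assoc]
    convert smul_zero n using 2
    abel
  have hQ3 : ∀ z, Q (barD3 Γ z) = 0 := by
    intro z
    have hz : barD3 Γ z ∈ LinearMap.ker (barD2 Γ) := LinearMap.congr_fun hd z
    rw [hQ ⟨_, hz⟩]
    change Submodule.Quotient.mk _ = _
    rw [Submodule.Quotient.mk_eq_zero]
    exact ⟨z, rfl⟩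
  have hf : IsTwoCocycle (fun g h : Γ => Q (Finsupp.single (g, h) 1)) := by
    intro g h k
    have := hQ3 (Finsupp.single (g, h, k) 1)
    rw [barD3_single, one_smul] at this
    simpa only [map_add, map_sub] using this
  refine ⟨_, hf, fun x => ?_⟩
  obtain ⟨z, rfl⟩ := classH2_surjective x
  rw [evalH2_class, ← hQ]
  have : evalChain (fun g h : Γ => Q (Finsupp.single (g, h) 1)) = Q := by
    apply Finsupp.lhom_ext
    intro q n
    rw [evalChain_single, ← map_smul, Finsupp.smul_single, smul_eq_mul, mul_one]
  rw [this]

end HomologyAPI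

/-- The group `SL₂(R)`. -/
abbrev SLtwo (R : Type*) [CommRing R] := Matrix.SpecialLinearGroup (Fin 2) R

section MatrixAPI

variable {R R' : Type*} [CommRing R] [CommRing R']

lemma SLtwo.ext4 {g h : SLtwo R} (h00 : g.1 0 0 = h.1 0 0) (h01 : g.1 0 1 = h.1 0 1)
    (h10 : g.1 1 0 = h.1 1 0) (h11 : g.1 1 1 = h.1 1 1) : g = h := by
  ext i j
  fin_cases i <;> fin_cases j <;> assumption

lemma SLtwo.det_eq (g : SLtwo R) : g.1 0 0 * g.1 1 1 - g.1 0 1 * g.1 1 0 = 1 := by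
  rw [← Matrix.det_fin_two, g.2]

/-- The matrix of determinant one with prescribed entries. -/
def mk4 (a b c d : R) (h : a * d - b * c = 1) : SLtwo R :=
  ⟨!![a, b; c, d], by rw [Matrix.det_fin_two_of, h]⟩

/-- Upper unipotent matrices. -/
def x12 (t : R) : SLtwo R := mk4 1 t 0 1 (by ring)

/-- Lower unipotent matrices. -/
def x21 (t : R) : SLtwo R := mk4 1 0 t 1 (by ring)

/-- Diagonal matrices. -/
def hd (u : Rˣ) : SLtwo R := mk4 (u : R) 0 0 ((u⁻¹ : Rˣ) : R) (by simp)

/-- The Weyl element. -/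
def ww : SLtwo R := mk4 0 1 (-1) 0 (by ring)

variable (a b c d t : R) (h : a * d - b * c = 1) (u : Rˣ) (g k : SLtwo R)

@[simp] lemma mk4_00 : (mk4 a b c d h).1 0 0 = a := rfl
@[simp] lemma mk4_01 : (mk4 a b c d h).1 0 1 = b := rfl
@[simp] lemma mk4_10 : (mk4 a b c d h).1 1 0 = c := rfl
@[simp] lemma mk4_11 : (mk4 a b c d h).1 1 1 = d := rfl
@[simp] lemma x12_00 : (x12 t).1 0 0 = 1 := rfl
@[simp] lemma x12_01 : (x12 t).1 0 1 = t := rfl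
@[simp] lemma x12_10 : (x12 t).1 1 0 = 0 := rfl
@[simp] lemma x12_11 : (x12 t).1 1 1 = 1 := rfl
@[simp] lemma x21_00 : (x21 t).1 0 0 = 1 := rfl
@[simp] lemma x21_01 : (x21 t).1 0 1 = 0 := rfl
@[simp] lemma x21_10 : (x21 t).1 1 0 = t := rfl
@[simp] lemma x21_11 : (x21 t).1 1 1 = 1 := rfl
@[simp] lemma hd_00 : (hd u).1 0 0 = u := rfl
@[simp] lemma hd_01 : (hd u).1 0 1 = 0 := rfl
@[simp] lemma hd_10 : (hd u).1 1 0 = 0 := rfl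
@[simp] lemma hd_11 : (hd u).1 1 1 = ((u⁻¹ : Rˣ) : R) := rfl
@[simp] lemma ww_00 : (ww : SLtwo R).1 0 0 = 0 := rfl
@[simp] lemma ww_01 : (ww : SLtwo R).1 0 1 = 1 := rfl
@[simp] lemma ww_10 : (ww : SLtwo R).1 1 0 = -1 := rfl
@[simp] lemma ww_11 : (ww : SLtwo R).1 1 1 = 0 := rfl

@[simp] lemma SLtwo.mul_00 : (g * k).1 0 0 = g.1 0 0 * k.1 0 0 + g.1 0 1 * k.1 1 0 := by
  change (g.1 * k.1) 0 0 = _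
  rw [Matrix.mul_apply, Fin.sum_univ_two]
@[simp] lemma SLtwo.mul_01 : (g * k).1 0 1 = g.1 0 0 * k.1 0 1 + g.1 0 1 * k.1 1 1 := by
  change (g.1 * k.1) 0 1 = _
  rw [Matrix.mul_apply, Fin.sum_univ_two]
@[simp] lemma SLtwo.mul_10 : (g * k).1 1 0 = g.1 1 0 * k.1 0 0 + g.1 1 1 * k.1 1 0 := by
  change (g.1 * k.1) 1 0 = _
  rw [Matrix.mul_apply, Fin.sum_univ_two]
@[simp] lemma SLtwo.mul_11 : (g * k).1 1 1 = g.1 1 0 * k.1 0 1 + g.1 1 1 * k.1 1 1 := by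
  change (g.1 * k.1) 1 1 = _
  rw [Matrix.mul_apply, Fin.sum_univ_two]
@[simp] lemma SLtwo.one_00 : (1 : SLtwo R).1 0 0 = 1 := rfl
@[simp] lemma SLtwo.one_01 : (1 : SLtwo R).1 0 1 = 0 := rfl
@[simp] lemma SLtwo.one_10 : (1 : SLtwo R).1 1 0 = 0 := rfl
@[simp] lemma SLtwo.one_11 : (1 : SLtwo R).1 1 1 = 1 := rfl

lemma SLtwo.inv_eq : g⁻¹ = mk4 (g.1 1 1) (-g.1 0 1) (-g.1 1 0) (g.1 0 0) (by
    have := g.det_eq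
    linear_combination this) := by
  rw [inv_eq_iff_mul_eq_one]
  have := g.det_eq
  apply SLtwo.ext4 <;> simp <;> first | ring1 | linear_combination this

@[simp] lemma SLtwo.inv_00 : (g⁻¹).1 0 0 = g.1 1 1 := by rw [SLtwo.inv_eq]; rfl
@[simp] lemma SLtwo.inv_01 : (g⁻¹).1 0 1 = -g.1 0 1 := by rw [SLtwo.inv_eq]; rfl
@[simp] lemma SLtwo.inv_10 : (g⁻¹).1 1 0 = -g.1 1 0 := by rw [SLtwo.inv_eq]; rfl
@[simp] lemma SLtwo.inv_11 : (g⁻¹).1 1 1 = g.1 0 0 := by rw [SLtwo.inv_eq]; rfl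

/-- The homomorphism on `SL₂` induced by a ring homomorphism. -/
abbrev slMap (j : R →+* R') : SLtwo R →* SLtwo R' := Matrix.SpecialLinearGroup.map j

variable (j : R →+* R')

@[simp] lemma slMap_apply (x y : Fin 2) : (slMap j g).1 x y = j (g.1 x y) := rfl

lemma slMap_x12 : slMap j (x12 t) = x12 (j t) := by apply SLtwo.ext4 <;> simp
lemma slMap_x21 : slMap j (x21 t) = x21 (j t) := by apply SLtwo.ext4 <;> simp
lemma slMap_hd : slMap j (hd u) = hd (Units.map j u) := by
  apply SLtwo.ext4 <;> simp
lemma slMap_ww : slMap j (ww : SLtwo R) = ww := by apply SLtwo.ext4 <;> simp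

lemma slMap_injective (hj : Function.Injective j) : Function.Injective (slMap j) := by
  intro g k hgk
  have h (x y) : j (g.1 x y) = j (k.1 x y) := by
    rw [← slMap_apply, ← slMap_apply, hgk]
  exact SLtwo.ext4 (hj (h _ _)) (hj (h _ _)) (hj (h _ _)) (hj (h _ _))

lemma x12_add (s t : R) : x12 (s + t) = x12 s * x12 t := by
  apply SLtwo.ext4 <;> simp [add_comm]
lemma x21_add (s t : R) : x21 (s + t) = x21 s * x21 t := by
  apply SLtwo.ext4 <;> simp
lemma x12_zero : x12 (0 : R) = 1 := by apply SLtwo.ext4 <;> simp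
lemma x21_zero : x21 (0 : R) = 1 := by apply SLtwo.ext4 <;> simp
lemma x12_inv : (x12 t)⁻¹ = x12 (-t) := by apply SLtwo.ext4 <;> simp
lemma x21_inv : (x21 t)⁻¹ = x21 (-t) := by apply SLtwo.ext4 <;> simp
lemma hd_mul (u v : Rˣ) : hd (u * v) = hd u * hd v := by
  apply SLtwo.ext4 <;> simp [mul_comm]
lemma hd_one : hd (1 : Rˣ) = 1 := by apply SLtwo.ext4 <;> simp
lemma hd_inv : (hd u)⁻¹ = hd u⁻¹ := by apply SLtwo.ext4 <;> simp
lemma hd_conj_x12 : hd u * x12 t * (hd u)⁻¹ = x12 ((u : R) ^ 2 * t) := by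
  apply SLtwo.ext4 <;> simp <;> ring
lemma hd_conj_x21 : hd u * x21 t * (hd u)⁻¹ = x21 (((u⁻¹ : Rˣ) : R) ^ 2 * t) := by
  apply SLtwo.ext4 <;> simp <;> ring
lemma ww_conj_x12 : ww * x12 t * ww⁻¹ = x21 (-t) := by
  apply SLtwo.ext4 <;> simp
lemma ww_conj_x21 : ww * x21 t * ww⁻¹ = x12 (-t) := by
  apply SLtwo.ext4 <;> simp
lemma ww_eq : (ww : SLtwo R) = x12 1 * x21 (-1) * x12 1 := by
  apply SLtwo.ext4 <;> simp

/-- The subgroup generated by `x12 t` and `x21 (N * t)` for all `t`. -/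
def elemN (N : R) : Subgroup (SLtwo R) :=
  Subgroup.closure (Set.range x12 ∪ Set.range fun t => x21 (N * t))

variable (N : R)

lemma x12_mem_elemN : x12 t ∈ elemN N := Subgroup.subset_closure (Or.inl ⟨t, rfl⟩)
lemma x21_mem_elemN : x21 (N * t) ∈ elemN N := Subgroup.subset_closure (Or.inr ⟨t, rfl⟩)

/-- The congruence subgroup property in the form: the group of matrices with lower row congruent
to `(0, 1)` modulo `N` is generated by elementary matrices. -/
def HasElemGen : Prop :=
  ∀ g : SLtwo R, N ∣ g.1 1 0 → N ∣ g.1 1 1 - 1 → g ∈ elemN N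

end MatrixAPI

section ZSAPI

variable {S : Set ℕ}

lemma inv_mem_ZS {p : ℕ} (hp : p ∈ S) : (p : ℚ)⁻¹ ∈ ZS S :=
  Subring.subset_closure ⟨p, hp, rfl⟩

lemma ZS_mono {S T : Set ℕ} (h : S ⊆ T) : ZS S ≤ ZS T :=
  Subring.closure_mono (Set.image_mono h)

lemma inv_natCast_mem_ZS (n : ℕ) (hn : n ≠ 0) (h : ∀ p, p.Prime → p ∣ n → p ∈ S) :
    (n : ℚ)⁻¹ ∈ ZS S := by
  induction n using induction_on_primes with
  | zero => exact absurd rfl hn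
  | one => simp
  | prime_mul p a hp ih =>
    have ha : a ≠ 0 := by rintro rfl; simp at hn
    have h1 := ih ha (fun r hr hra => h r hr (hra.mul_left _))
    have h2 := inv_mem_ZS (h p hp (dvd_mul_right _ _))
    rw [Nat.cast_mul, mul_inv]
    exact mul_mem h2 h1

lemma mem_ZS_of_den {x : ℚ} (h : ∀ p, p.Prime → p ∣ x.den → p ∈ S) : x ∈ ZS S := by
  rw [← Rat.num_div_den x, div_eq_mul_inv]
  exact mul_mem (intCast_mem _ _) (inv_natCast_mem_ZS _ x.den_nz h)

lemma mem_of_dvd_den (hS : ∀ p ∈ S, p.Prime) {x : ℚ} (hx : x ∈ ZS S) :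
    ∀ p, p.Prime → p ∣ x.den → p ∈ S := by
  refine Subring.closure_induction (p := fun x _ => ∀ p, p.Prime → p ∣ x.den → p ∈ S)
    ?_ ?_ ?_ ?_ ?_ ?_ hx
  · rintro _ ⟨r, hr, rfl⟩ p hp hd
    rw [Rat.inv_natCast_den_of_pos (hS r hr).pos] at hd
    rwa [(Nat.prime_dvd_prime_iff_eq hp (hS r hr)).1 hd]
  · intro p hp hd
    exact absurd hd (by simpa using hp.one_lt.ne')
  · intro p hp hd
    exact absurd hd (by simpa using hp.one_lt.ne')
  · intro x y _ _ hx hy p hp hd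
    rcases (hp.dvd_mul).1 (hd.trans (Rat.add_den_dvd x y)) with h | h
    exacts [hx p hp h, hy p hp h]
  · intro x _ hx p hp hd
    exact hx p hp (by simpa using hd)
  · intro x y _ _ hx hy p hp hd
    rcases (hp.dvd_mul).1 (hd.trans (Rat.mul_den_dvd x y)) with h | h
    exacts [hx p hp h, hy p hp h]

lemma den_ne_zero_of_mem (hS : ∀ p ∈ S, p.Prime) {q : ℕ} [hq : Fact q.Prime] (hqS : q ∉ S)
    {x : ℚ} (hx : x ∈ ZS S) : (x.den : ZMod q) ≠ 0 := by
  rw [Ne, ZMod.natCast_eq_zero_iff]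
  exact fun h => hqS (mem_of_dvd_den hS hx q hq.out h)

/-- Reduction of `ℤ_S` modulo a prime outside `S`. -/
def redZS (hS : ∀ p ∈ S, p.Prime) (q : ℕ) [Fact q.Prime] (hqS : q ∉ S) : ZS S →+* ZMod q where
  toFun x := ((x : ℚ) : ZMod q)
  map_one' := by simp
  map_zero' := by simp
  map_add' x y := by
    rw [Subring.coe_add, Rat.cast_add_of_ne_zero (den_ne_zero_of_mem hS hqS x.2)
      (den_ne_zero_of_mem hS hqS y.2)]
  map_mul' x y := by
    rw [Subring.coe_mul, Rat.cast_mul_of_ne_zero (den_ne_zero_of_mem hS hqS x.2)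
      (den_ne_zero_of_mem hS hqS y.2)]

lemma redZS_surjective (hS : ∀ p ∈ S, p.Prime) (q : ℕ) [Fact q.Prime] (hqS : q ∉ S) :
    Function.Surjective (redZS hS q hqS) := by
  intro y
  obtain ⟨n, rfl⟩ := ZMod.intCast_surjective y
  exact ⟨n, map_intCast _ n⟩

lemma redZS_eq_zero_iff (hS : ∀ p ∈ S, p.Prime) (q : ℕ) [hq : Fact q.Prime] (hqS : q ∉ S)
    (x : ZS S) : redZS hS q hqS x = 0 ↔ (q : ZS S) ∣ x := by
  constructor
  · intro h
    have h1 : ((x : ℚ) : ZMod q) = 0 := h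
    rw [Rat.cast_def, div_eq_zero_iff, or_iff_left (den_ne_zero_of_mem hS hqS x.2),
      ZMod.intCast_zmod_eq_zero_iff_dvd] at h1
    obtain ⟨m, hm⟩ := h1
    have hx : (x : ℚ) = q * (m * ((x : ℚ).den : ℚ)⁻¹) := by
      conv_lhs => rw [← Rat.num_div_den (x : ℚ), hm]
      push_cast
      ring
    refine ⟨⟨m * ((x : ℚ).den : ℚ)⁻¹, mul_mem (intCast_mem _ _)
      (inv_natCast_mem_ZS _ (x : ℚ).den_nz (mem_of_dvd_den hS x.2))⟩, ?_⟩
    apply Subtype.ext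
    rw [Subring.coe_mul]
    simpa using hx
  · rintro ⟨y, rfl⟩
    rw [map_mul, map_natCast]
    simp

lemma isUnit_natCast_ZS {p : ℕ} (hp : p ∈ S) (hp0 : p ≠ 0) : IsUnit (p : ZS S) := by
  refine IsUnit.of_mul_eq_one ⟨(p : ℚ)⁻¹, inv_mem_ZS hp⟩ ?_
  apply Subtype.ext
  rw [Subring.coe_mul]
  simp [hp0]

lemma two_three_mem (hS : ∀ p ∈ S, p.Prime)
    (hlam : ∃ lam : (ZS S)ˣ, IsUnit ((lam : ZS S) ^ 2 - 1)) : 2 ∈ S ∧ 3 ∈ S := by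
  obtain ⟨lam, hl⟩ := hlam
  constructor
  · by_contra h
    have key : ∀ y : ZMod 2, y ≠ 0 → y ^ 2 - 1 ≠ 0 → False := by decide
    have : Fact (Nat.Prime 2) := ⟨Nat.prime_two⟩
    have h1 := lam.isUnit.map (redZS hS 2 h)
    have h2 := hl.map (redZS hS 2 h)
    rw [map_sub, map_pow, map_one] at h2
    generalize redZS hS 2 h lam = y at h1 h2
    rw [isUnit_iff_ne_zero] at h1 h2
    exact key y h1 h2
  · by_contra h
    have key : ∀ y : ZMod 3, y ≠ 0 → y ^ 2 - 1 ≠ 0 → False := by decide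
    have : Fact (Nat.Prime 3) := ⟨Nat.prime_three⟩
    have h1 := lam.isUnit.map (redZS hS 3 h)
    have h2 := hl.map (redZS hS 3 h)
    rw [map_sub, map_pow, map_one] at h2
    generalize redZS hS 3 h lam = y at h1 h2
    rw [isUnit_iff_ne_zero] at h1 h2
    exact key y h1 h2

end ZSAPI

section NumberTheory

lemma mem_zpowers_of_orderOf_dvd {C : Type*} [CommGroup C] [Finite C] [IsCyclic C] {x y : C}
    (h : orderOf x ∣ orderOf y) : x ∈ Subgroup.zpowers y := by
  classical
  have : Fintype C := Fintype.ofFinite C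
  have h1 : (Finset.univ.filter fun a : C => a ^ orderOf y = 1).card ≤ orderOf y :=
    IsCyclic.card_pow_eq_one_le (orderOf_pos y)
  have h2 : (Finset.univ.filter fun a : C => a ∈ Subgroup.zpowers y).card = orderOf y := by
    rw [← Fintype.card_zpowers, Fintype.card_subtype]
  have h3 : (Finset.univ.filter fun a : C => a ∈ Subgroup.zpowers y) ⊆
      Finset.univ.filter fun a : C => a ^ orderOf y = 1 := by
    intro a ha
    simp only [Finset.mem_filter, Finset.mem_univ, true_and] at ha ⊢
    exact orderOf_dvd_iff_pow_eq_one.1 (orderOf_dvd_of_mem_zpowers ha)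
  have h4 := Finset.eq_of_subset_of_card_le h3 (by rw [h2]; exact h1)
  have h5 : x ∈ Finset.univ.filter fun a : C => a ^ orderOf y = 1 := by
    simp only [Finset.mem_filter, Finset.mem_univ, true_and]
    exact orderOf_dvd_iff_pow_eq_one.1 h
  rw [← h4] at h5
  simpa using h5

lemma pow_dvd_of_pow_modEq_one {p : ℕ} (hp : p.Prime) (hp2 : Odd p) {x : ℕ} (hx : 1 < x)
    (hpx : ¬ p ∣ x) {m n : ℕ} (hm : m ≠ 0) (h : p ^ n ∣ x ^ m - 1) :
    p ^ (n - padicValNat p (x ^ (p - 1) - 1)) ∣ m := by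
  have : Fact p.Prime := ⟨hp⟩
  have hp1 : p - 1 ≠ 0 := by have := hp.one_lt; omega
  have hx1 : 1 < x ^ (p - 1) := Nat.one_lt_pow hp1 hx
  have h1 : p ∣ x ^ (p - 1) - 1 := by
    rw [← Nat.modEq_iff_dvd' hx1.le]
    exact (Nat.ModEq.pow_card_sub_one_eq_one hp ((hp.coprime_iff_not_dvd.2 hpx).symm)).symm
  have h2 : ¬ p ∣ x ^ (p - 1) := fun h => hpx (hp.dvd_of_dvd_pow h)
  have h3 := padicValNat.pow_sub_pow hp2 hx1 h1 h2 hm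
  rw [one_pow] at h3
  have h4 : p ^ n ∣ (x ^ (p - 1)) ^ m - 1 := by
    rw [← pow_mul, mul_comm, pow_mul]
    refine h.trans ?_
    simpa using Nat.sub_dvd_pow_sub_pow (x ^ m) 1 (p - 1)
  have h5 : (x ^ (p - 1)) ^ m - 1 ≠ 0 := by
    have := Nat.one_lt_pow hm hx1
    omega
  rw [padicValNat_dvd_iff_le h5, h3] at h4
  rw [padicValNat_dvd_iff_le hm]
  omega

/-- Dirichlet's theorem with two coprime moduli. -/
lemma exists_prime_modEq_two (m₁ m₂ : ℕ) (r₁ r₂ : ℤ) (hm₁ : m₁ ≠ 0) (hm₂ : m₂ ≠ 0)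
    (hm : m₁.Coprime m₂) (h₁ : IsCoprime r₁ m₁) (h₂ : IsCoprime r₂ m₂) (B : ℕ) :
    ∃ p > B, p.Prime ∧ (m₁ : ℤ) ∣ p - r₁ ∧ (m₂ : ℤ) ∣ p - r₂ := by
  obtain ⟨u, v, huv⟩ := (Nat.isCoprime_iff_coprime.2 hm : IsCoprime (m₁ : ℤ) m₂)
  have e1 : (m₁ : ℤ) ∣ (r₁ * (v * m₂) + r₂ * (u * m₁)) - r₁ :=
    ⟨u * (r₂ - r₁), by linear_combination r₁ * huv⟩
  have e2 : (m₂ : ℤ) ∣ (r₁ * (v * m₂) + r₂ * (u * m₁)) - r₂ :=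
    ⟨v * (r₁ - r₂), by linear_combination r₂ * huv⟩
  generalize r₁ * (v * m₂) + r₂ * (u * m₁) = r at e1 e2
  have c1 : IsCoprime r m₁ := by
    obtain ⟨k, hk⟩ := e1
    rw [show r = r₁ + m₁ * k by linear_combination hk]
    exact h₁.add_mul_left_left k
  have c2 : IsCoprime r m₂ := by
    obtain ⟨k, hk⟩ := e2
    rw [show r = r₂ + m₂ * k by linear_combination hk]
    exact h₂.add_mul_left_left k
  have hc : IsCoprime r ((m₁ * m₂ : ℕ) : ℤ) := by
    push_cast
    exact c1.mul_right c2
  obtain ⟨p, hpB, hp, hmod⟩ := Nat.forall_exists_prime_gt_and_zmodEq B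
    (mul_ne_zero hm₁ hm₂) hc
  have hd := hmod.symm.dvd
  push_cast at hd
  refine ⟨p, hpB, hp, ?_, ?_⟩
  · have := dvd_add ((dvd_mul_right (m₁ : ℤ) m₂).trans hd) e1
    rwa [sub_add_sub_cancel] at this
  · have := dvd_add ((dvd_mul_left (m₂ : ℤ) m₁).trans hd) e2
    rwa [sub_add_sub_cancel] at this

/-- A prime which is a primitive root modulo `γ²` generates the units modulo every power. -/
lemma exists_pow_modEq {γ p : ℕ} (hγ : γ.Prime) (hγ2 : Odd γ) (hp : 1 < p)
    (hpγ : p.Coprime γ)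
    (hord : orderOf (ZMod.unitOfCoprime p (hpγ.pow_right 2)) = γ * (γ - 1)) (k : ℕ) (hk : 2 ≤ k)
    (y : ℕ) (hy : y.Coprime γ) : ∃ n : ℕ, y ≡ p ^ n [MOD γ ^ k] := by
  have hγ1 : 1 < γ := hγ.one_lt
  have hkz : NeZero (γ ^ k) := ⟨pow_ne_zero _ hγ.ne_zero⟩
  set P := ZMod.unitOfCoprime p (hpγ.pow_right k) with hP
  have hcyc : IsCyclic (ZMod (γ ^ k))ˣ :=
    ZMod.isCyclic_units_of_prime_pow γ hγ (by rintro rfl; revert hγ2; decide) k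
  have hcard : Fintype.card (ZMod (γ ^ k))ˣ = γ ^ (k - 1) * (γ - 1) := by
    rw [ZMod.card_units_eq_totient, Nat.totient_prime_pow hγ (by omega)]
  have pow_iff : ∀ (j m : ℕ), ZMod.unitOfCoprime p (hpγ.pow_right j) ^ m = 1 ↔
      γ ^ j ∣ p ^ m - 1 := by
    intro j m
    rw [← Nat.modEq_iff_dvd' (Nat.one_le_pow _ _ (by omega)), Units.ext_iff]
    simp only [Units.val_pow_eq_pow_val, ZMod.coe_unitOfCoprime, Units.val_one]
    rw [Nat.ModEq.comm, ← ZMod.natCast_eq_natCast_iff]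
    push_cast
    rfl
  have hm0 : orderOf P ≠ 0 := (orderOf_pos P).ne'
  have hm1 : γ ^ k ∣ p ^ orderOf P - 1 := (pow_iff k _).1 (pow_orderOf_eq_one P)
  have hnd : ¬ γ ∣ p := fun h => by
    have := Nat.Coprime.eq_one_of_dvd hpγ.symm h
    omega
  have hv : padicValNat γ (p ^ (γ - 1) - 1) ≤ 1 := by
    by_contra hv
    have : Fact γ.Prime := ⟨hγ⟩
    have h1 : γ ^ 2 ∣ p ^ (γ - 1) - 1 := by
      rw [padicValNat_dvd_iff_le]
      · omega
      · have : 1 < p ^ (γ - 1) := Nat.one_lt_pow (by omega) hp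
        omega
    have h2 := orderOf_dvd_of_pow_eq_one ((pow_iff 2 _).2 h1)
    rw [hord] at h2
    have h3 := Nat.le_of_dvd (by omega) h2
    have h4 : 2 * (γ - 1) ≤ γ * (γ - 1) := Nat.mul_le_mul_right _ (by omega)
    omega
  have d1 : γ ^ (k - 1) ∣ orderOf P :=
    (pow_dvd_pow γ (by omega)).trans (pow_dvd_of_pow_modEq_one hγ hγ2 hp hnd hm0 hm1)
  have d2 : γ - 1 ∣ orderOf P := by
    have h1 : γ ^ 2 ∣ p ^ orderOf P - 1 := (pow_dvd_pow γ hk).trans hm1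
    have h2 := orderOf_dvd_of_pow_eq_one ((pow_iff 2 _).2 h1)
    rw [hord] at h2
    exact (dvd_mul_left _ _).trans h2
  have hcop : Nat.Coprime (γ ^ (k - 1)) (γ - 1) := by
    apply Nat.Coprime.pow_left
    rw [Nat.coprime_self_sub_right hγ1.le]
    exact Nat.coprime_one_right γ
  have d3 := hcop.mul_dvd_of_dvd_of_dvd d1 d2
  rw [← hcard] at d3
  have hY := mem_zpowers_of_orderOf_dvd (x := ZMod.unitOfCoprime y (hy.pow_right k))
    ((orderOf_dvd_card).trans d3)
  rw [mem_zpowers_iff_mem_range_orderOf] at hY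
  simp only [Finset.mem_image, Finset.mem_range] at hY
  obtain ⟨n, -, hn⟩ := hY
  refine ⟨n, ?_⟩
  rw [Units.ext_iff] at hn
  simp only [Units.val_pow_eq_pow_val, ZMod.coe_unitOfCoprime, hP] at hn
  rw [← ZMod.natCast_eq_natCast_iff]
  push_cast
  exact hn.symm

end NumberTheory

section Descent

lemma exists_prime_isSquare {α : ℕ} (hα : α.Prime) (hα4 : α % 4 = 3) (b : ℤ)
    (hb : IsCoprime b α) (B : ℕ) :
    ∃ p > B, p.Prime ∧ (α : ℤ) ∣ p - b ∧ IsSquare (α : ZMod p) := by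
  have hα' : Fact α.Prime := ⟨hα⟩
  have hα2 : α ≠ 2 := by rintro rfl; norm_num at hα4
  have hcop : α.Coprime 4 :=
    Nat.Coprime.pow_right 2 ((Nat.coprime_primes hα Nat.prime_two).2 hα2)
  have cast_eq : ∀ p : ℕ, (α : ℤ) ∣ p - b → ((p : ℕ) : ZMod α) = (b : ZMod α) := by
    intro p h
    have := (ZMod.intCast_eq_intCast_iff_dvd_sub b p α).2 h
    rw [this]
    simp
  by_cases hsq : IsSquare (b : ZMod α)
  · obtain ⟨p, hpB, hp, h1, h2⟩ := exists_prime_modEq_two α 4 b 1 hα.ne_zero (by norm_num) hcop hb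
      isCoprime_one_left B
    have hp' : Fact p.Prime := ⟨hp⟩
    refine ⟨p, hpB, hp, h1, ?_⟩
    rw [ZMod.exists_sq_eq_prime_iff_of_mod_four_eq_one (by push_cast at h2; omega) hα2, cast_eq p h1]
    exact hsq
  · obtain ⟨p, hpB, hp, h1, h2⟩ := exists_prime_modEq_two α 4 b 3 hα.ne_zero (by norm_num) hcop hb
      (by norm_num) (max B α)
    have hp' : Fact p.Prime := ⟨hp⟩
    refine ⟨p, (le_max_left _ _).trans_lt hpB, hp, h1, ?_⟩
    rw [ZMod.exists_sq_eq_prime_iff_of_mod_four_eq_three (by push_cast at h2; omega) hα4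
      ((le_max_right B α).trans_lt hpB).ne', cast_eq p h1]
    exact hsq

lemma mul_dvd_of_coprime_int {m n : ℕ} (h : m.Coprime n) {z : ℤ} (h1 : (m : ℤ) ∣ z)
    (h2 : (n : ℤ) ∣ z) : (m : ℤ) * n ∣ z :=
  (Nat.isCoprime_iff_coprime.2 h).mul_dvd h1 h2

/-- The last step of the descent: `γ ^ E` is a power of `U` modulo `p ^ n`. -/
lemma exists_pow_modEq_pow {p γ U : ℕ} (hp : p.Prime) (hp2 : Odd p) (hU : 1 < U) (hUp : ¬ p ∣ U)
    (hγp : ¬ p ∣ γ) (n : ℕ) :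
    ∃ k : ℕ, (p : ℤ) ^ n ∣
      (γ : ℤ) ^ (p ^ (2 * padicValNat p (U ^ (p - 1) - 1) + 1) * (p - 1)) - (U : ℤ) ^ k := by
  set s := padicValNat p (U ^ (p - 1) - 1) with hs
  have hkz : NeZero (p ^ n) := ⟨pow_ne_zero _ hp.ne_zero⟩
  have hcyc : IsCyclic (ZMod (p ^ n))ˣ :=
    ZMod.isCyclic_units_of_prime_pow p hp (by rintro rfl; revert hp2; decide) n
  have cU : U.Coprime (p ^ n) := ((hp.coprime_iff_not_dvd.2 hUp).symm).pow_right n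
  have cγ : γ.Coprime (p ^ n) := ((hp.coprime_iff_not_dvd.2 hγp).symm).pow_right n
  set V := ZMod.unitOfCoprime U cU with hV
  set G := ZMod.unitOfCoprime γ cγ with hG
  have hm : p ^ n ∣ U ^ orderOf V - 1 := by
    rw [← Nat.modEq_iff_dvd' (Nat.one_le_pow _ _ (by omega)), Nat.ModEq.comm,
      ← ZMod.natCast_eq_natCast_iff]
    have := pow_orderOf_eq_one V
    rw [Units.ext_iff] at this
    simp only [Units.val_pow_eq_pow_val, hV, ZMod.coe_unitOfCoprime, Units.val_one] at this
    push_cast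
    exact this
  have h1 := pow_dvd_of_pow_modEq_one hp hp2 hU hUp (orderOf_pos V).ne' hm
  rw [← hs] at h1
  have h2 : (G ^ (p ^ (2 * s + 1) * (p - 1))) ^ (p ^ (n - s)) = 1 := by
    have : Nat.totient (p ^ n) ∣ p ^ (2 * s + 1) * (p - 1) * p ^ (n - s) := by
      rcases Nat.eq_zero_or_pos n with rfl | hn
      · simp
      · rw [Nat.totient_prime_pow hp hn, mul_right_comm, ← pow_add]
        exact mul_dvd_mul_right (pow_dvd_pow p (by omega)) _
    rw [← pow_mul]
    apply orderOf_dvd_iff_pow_eq_one.1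
    refine orderOf_dvd_card.trans ?_
    rw [ZMod.card_units_eq_totient]
    exact this
  have h3 := mem_zpowers_of_orderOf_dvd ((orderOf_dvd_of_pow_eq_one h2).trans h1)
  rw [mem_zpowers_iff_mem_range_orderOf] at h3
  simp only [Finset.mem_image, Finset.mem_range] at h3
  obtain ⟨k, -, hk⟩ := h3
  refine ⟨k, ?_⟩
  rw [Units.ext_iff] at hk
  simp only [Units.val_pow_eq_pow_val, ZMod.coe_unitOfCoprime, hV, hG] at hk
  have : ((U ^ k : ℕ) : ZMod (p ^ n)) =
      ((γ ^ (p ^ (2 * s + 1) * (p - 1)) : ℕ) : ZMod (p ^ n)) := by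
    rw [Nat.cast_pow, Nat.cast_pow]
    exact hk
  rw [ZMod.natCast_eq_natCast_iff, Nat.modEq_iff_dvd] at this
  rw [Nat.cast_pow, Nat.cast_pow, Nat.cast_pow] at this
  exact this

lemma dvd_pow_sub_one_int {N x : ℤ} (h : N ∣ x - 1) (k : ℕ) : N ∣ x ^ k - 1 := by
  refine h.trans ?_
  simpa using sub_dvd_pow_sub_pow x 1 k

/-- Every coprime pair `(b, a)` with `a ≡ 1 mod N` can be reduced to a pair whose second entry is
a power of four by changing `a` modulo `N b` and `b` modulo `a`. -/
lemma int_descent {N : ℕ} (hN : Odd N) (Q : ℤ → ℤ → Prop)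
    (hcol : ∀ b a a' : ℤ, N * b ∣ a' - a → Q b a' → Q b a)
    (hrow : ∀ b b' a, a ∣ b' - b → Q b' a → Q b a)
    (hunit : ∀ b : ℤ, ∀ k : ℕ, Q b ((((4 : ℕ) ^ Nat.totient N : ℕ) : ℤ) ^ k))
    (b a : ℤ) (hba : IsCoprime a b) (hb : Odd b) (ha : (N : ℤ) ∣ a - 1) : Q b a := by
  have hN0 : N ≠ 0 := by rintro rfl; revert hN; decide
  have hb0 : b ≠ 0 := by rintro rfl; revert hb; decide
  have haN : IsCoprime a N := by
    obtain ⟨k, hk⟩ := ha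
    exact ⟨1, -k, by linear_combination hk⟩
  -- replace `a` by a prime congruent to `3` modulo `4`
  obtain ⟨α, -, hα, h1, h2⟩ := exists_prime_modEq_two (N * b.natAbs) 4 a 3
    (mul_ne_zero hN0 (by simpa using hb0)) (by norm_num)
    (Nat.Coprime.pow_right 2 (Nat.coprime_two_right.2 (hN.mul (Int.natAbs_odd.2 hb))))
    (by
      push_cast
      refine haN.mul_right ?_
      exact hba.abs_right) (by norm_num) 0
  push_cast at h1 h2
  have h1' : N * b ∣ (α : ℤ) - a := (mul_dvd_mul_left _ ((dvd_abs _ _).2 dvd_rfl)).trans h1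
  refine hcol b a α h1' ?_
  have hαN : (N : ℤ) ∣ α - 1 := by
    have := dvd_add ((dvd_mul_right _ _).trans h1') ha
    rwa [sub_add_sub_cancel] at this
  have hαb : IsCoprime b α := by
    obtain ⟨k, hk⟩ := h1'
    rw [show (α : ℤ) = a + b * (N * k) by linear_combination hk]
    exact hba.symm.add_mul_left_right _
  -- replace `b` by a prime modulo which `α` is a square
  obtain ⟨b₁, hb₁B, hb₁, h3, h4⟩ := exists_prime_isSquare hα (by omega) b hαb (max N α)
  refine hrow b b₁ α h3 ?_
  have hb₁N : N < b₁ := (le_max_left _ _).trans_lt hb₁B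
  have hb₁α : α < b₁ := (le_max_right _ _).trans_lt hb₁B
  have hb₁' : Fact b₁.Prime := ⟨hb₁⟩
  have cNb₁ : N.Coprime b₁ := (Nat.coprime_of_lt_prime hN0 hb₁N hb₁).symm
  obtain ⟨β, hβ⟩ := h4
  have hβ0 : β ≠ 0 := by
    rintro rfl
    rw [mul_zero, ZMod.natCast_eq_zero_iff] at hβ
    exact absurd (Nat.le_of_dvd hα.pos hβ) (by omega)
  -- replace the square root by a prime
  obtain ⟨γ, hγB, hγ, h5, h6⟩ := exists_prime_modEq_two b₁ N β.val 1 hb₁.ne_zero hN0 cNb₁.symm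
    (by
      rw [Nat.isCoprime_iff_coprime, Nat.coprime_comm, hb₁.coprime_iff_not_dvd]
      intro h
      rw [← ZMod.natCast_eq_zero_iff, ZMod.natCast_zmod_val] at h
      exact hβ0 h)
    isCoprime_one_left b₁
  have hγ2 : Odd γ := hγ.odd_of_ne_two (by have := hb₁.two_le; omega)
  have hγβ : (γ : ZMod b₁) = β := by
    have := (ZMod.intCast_eq_intCast_iff_dvd_sub _ _ b₁).2 h5
    simp only [Int.cast_natCast, ZMod.natCast_zmod_val] at this
    exact this.symm
  -- a prime which is a primitive root modulo all powers of `γ`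
  have hkz : NeZero (γ ^ 2) := ⟨pow_ne_zero _ hγ.ne_zero⟩
  have hcyc : IsCyclic (ZMod (γ ^ 2))ˣ :=
    ZMod.isCyclic_units_of_prime_pow γ hγ (by rintro rfl; revert hγ2; decide) 2
  obtain ⟨g, hg⟩ := hcyc.exists_generator
  have hgord : orderOf g = γ * (γ - 1) := by
    rw [orderOf_eq_card_of_forall_mem_zpowers hg, Nat.card_eq_fintype_card,
      ZMod.card_units_eq_totient, Nat.totient_prime_pow hγ (by norm_num)]
    simp
  set U : ℕ := 4 ^ Nat.totient N with hUdef
  obtain ⟨p, hpB, hp, h7, h8⟩ := exists_prime_modEq_two (γ ^ 2) (b₁ - 1) (g : ZMod (γ ^ 2)).val (-1)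
    (pow_ne_zero _ hγ.ne_zero) (by have := hb₁.two_le; omega)
    (Nat.Coprime.pow_left 2 (Nat.coprime_of_lt_prime (by have := hb₁.two_le; omega)
      (by omega) hγ))
    (by
      rw [Nat.isCoprime_iff_coprime]
      exact ZMod.val_coe_unit_coprime g)
    (by
      rw [IsCoprime.neg_left_iff]
      exact isCoprime_one_left) (max U γ)
  have hpU : U < p := (le_max_left _ _).trans_lt hpB
  have hpγ : γ < p := (le_max_right _ _).trans_lt hpB
  have hU1 : 1 < U := Nat.one_lt_pow (Nat.totient_pos.2 (Nat.pos_of_ne_zero hN0)).ne' (by norm_num)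
  have hp2 : Odd p := hp.odd_of_ne_two (by omega)
  have hpγc : p.Coprime γ := (Nat.coprime_primes hp hγ).2 hpγ.ne'
  have hpN : N.Coprime p := (Nat.coprime_of_lt_prime hN0 (by omega) hp).symm
  set s := padicValNat p (U ^ (p - 1) - 1) with hs
  set E := p ^ (2 * s + 1) * (p - 1) with hE
  have hE2 : 2 ≤ E := by
    have e1 : 1 ≤ p ^ (2 * s + 1) := Nat.one_le_pow _ _ hp.pos
    have e2 : 2 ≤ p - 1 := by omega
    calc 2 = 1 * 2 := rfl
      _ ≤ _ := Nat.mul_le_mul e1 e2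
  have hEmod : E ≡ 2 [MOD b₁ - 1] := by
    rw [← ZMod.natCast_eq_natCast_iff, hE]
    have : (p : ZMod (b₁ - 1)) = -1 := by
      have := (ZMod.intCast_eq_intCast_iff_dvd_sub _ _ (b₁ - 1)).2 h8
      simp only [Int.cast_natCast, Int.cast_neg, Int.cast_one] at this
      exact this.symm
    rw [Nat.cast_mul, Nat.cast_pow, Nat.cast_sub hp.one_lt.le, this, Odd.neg_one_pow ⟨s, rfl⟩]
    push_cast
    ring
  have h9 : (N : ℤ) * b₁ ∣ (γ : ℤ) ^ E - α := by
    apply mul_dvd_of_coprime_int cNb₁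
    · have := dvd_sub (dvd_pow_sub_one_int h6 E) hαN
      rwa [sub_sub_sub_cancel_right] at this
    · rw [← ZMod.intCast_eq_intCast_iff_dvd_sub]
      push_cast
      rw [hγβ, hβ, pow_eq_pow_of_modEq hEmod (ZMod.pow_card_sub_one_eq_one hβ0), sq]
  refine hcol b₁ α (γ ^ E) h9 ?_
  obtain ⟨n, hn⟩ := exists_pow_modEq hγ hγ2 hp.one_lt hpγc (by
    rw [← hgord]
    congr 1
    apply Units.ext
    rw [ZMod.coe_unitOfCoprime]
    have := (ZMod.intCast_eq_intCast_iff_dvd_sub _ _ (γ ^ 2)).2 h7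
    simp only [Int.cast_natCast, ZMod.natCast_zmod_val] at this
    exact this.symm) E hE2 b₁ ((Nat.coprime_primes hb₁ hγ).2 hγB.ne)
  refine hrow b₁ (p ^ n) (γ ^ E) (by exact_mod_cast Nat.modEq_iff_dvd.1 hn) ?_
  obtain ⟨k, hk⟩ := exists_pow_modEq_pow hp hp2 hU1
    (fun h => absurd (Nat.le_of_dvd (by omega) h) (by omega))
    (fun h => absurd (Nat.le_of_dvd hγ.pos h) (by omega)) (γ := γ) n
  rw [← hs, ← hE] at hk
  refine hcol (p ^ n) (γ ^ E) (U ^ k) ?_ (hunit _ k)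
  have hUN : (N : ℤ) ∣ (U : ℤ) - 1 := by
    have := (Nat.ModEq.pow_totient (n := N) (x := 4)
      (Nat.Coprime.pow_left 2 (Nat.coprime_two_left.2 hN)))
    have := Nat.modEq_iff_dvd.1 this.symm
    exact_mod_cast this
  have := mul_dvd_of_coprime_int (m := N) (n := p ^ n) (z := (γ : ℤ) ^ E - (U : ℤ) ^ k)
    (hpN.pow_right n) (by
      have := dvd_sub (dvd_pow_sub_one_int h6 E) (dvd_pow_sub_one_int hUN k)
      rwa [sub_sub_sub_cancel_right] at this) (by push_cast; exact hk)
  rw [← neg_sub, dvd_neg]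
  exact_mod_cast this

end Descent

section RowProp

variable {R : Type*} [CommRing R]

/-- All matrices with lower row `(N b, d)` lie in `elemN N`. -/
def RowProp (N b d : R) : Prop :=
  ∀ g : SLtwo R, g.1 1 0 = N * b → g.1 1 1 = d → g ∈ elemN N

variable {N b d : R}

lemma RowProp.col (t : R) (h : RowProp N b (d + N * b * t)) : RowProp N b d := by
  intro g h0 h1
  have := h (g * x12 t) (by simp [h0]) (by simp [h0, h1]; ring)
  exact (Subgroup.mul_mem_cancel_right _ (x12_mem_elemN t N)).1 this

lemma RowProp.row (t : R) (h : RowProp N (b + t * d) d) : RowProp N b d := by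
  intro g h0 h1
  have := h (g * x21 (N * t)) (by simp [h0, h1]; ring) (by simp [h1])
  exact (Subgroup.mul_mem_cancel_right _ (x21_mem_elemN t N)).1 this

lemma hd_conj_mem_elemN (u : Rˣ) {g : SLtwo R} (hg : g ∈ elemN N) :
    hd u * g * (hd u)⁻¹ ∈ elemN N := by
  refine Subgroup.closure_induction (p := fun g _ => hd u * g * (hd u)⁻¹ ∈ elemN N)
    ?_ ?_ ?_ ?_ hg
  · rintro _ (⟨t, rfl⟩ | ⟨t, rfl⟩)
    · rw [hd_conj_x12]
      exact x12_mem_elemN _ _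
    · simp only [hd_conj_x21]
      rw [mul_left_comm]
      exact x21_mem_elemN _ _
  · simp
  · intro x y _ _ hx hy
    have := mul_mem hx hy
    simpa [mul_assoc] using this
  · intro x _ hx
    have := inv_mem hx
    simpa [mul_assoc] using this

lemma RowProp.unit_mul (u : Rˣ) (h : RowProp N ((u : R) ^ 2 * b) d) : RowProp N b d := by
  intro g h0 h1
  have h2 := h (hd u⁻¹ * g * hd u) (by simp [h0]; ring) (by simp [h1, mul_comm])
  have h3 := hd_conj_mem_elemN u h2
  rw [← hd_inv] at h3
  simpa [mul_assoc] using h3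

lemma RowProp.one (b : R) : RowProp N b 1 := by
  intro g h0 h1
  have hdet := g.det_eq
  have : g = x12 (g.1 0 1) * x21 (N * b) := by
    apply SLtwo.ext4
    · simp
      rw [h0, h1] at hdet
      linear_combination hdet
    · simp
    · simp [h0]
    · simp [h1]
  rw [this]
  exact mul_mem (x12_mem_elemN _ _) (x21_mem_elemN _ _)

lemma RowProp.unit (b : R) (u : Rˣ) (hu : N ∣ (u : R) - 1) : RowProp N b u := by
  obtain ⟨z, hz⟩ := hu
  refine RowProp.row ((1 - b) * ((u⁻¹ : Rˣ) : R)) ?_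
  have : b + (1 - b) * ((u⁻¹ : Rˣ) : R) * u = 1 := by
    rw [mul_assoc, Units.inv_mul]
    ring
  rw [this]
  refine RowProp.col (-z) ?_
  have : (u : R) + N * 1 * -z = 1 := by linear_combination hz
  rw [this]
  exact RowProp.one 1

end RowProp

section ZSGen

variable {S : Set ℕ}

lemma exists_split (S : Set ℕ) (n : ℕ) (hn : n ≠ 0) :
    ∃ v b : ℕ, n = v * b ∧ (∀ p, p.Prime → p ∣ v → p ∈ S) ∧ (∀ p, p.Prime → p ∣ b → p ∉ S) := by
  induction n using induction_on_primes with
  | zero => exact absurd rfl hn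
  | one =>
    exact ⟨1, 1, rfl, fun p hp h => absurd h hp.not_dvd_one, fun p hp h => absurd h hp.not_dvd_one⟩
  | prime_mul p a hp ih =>
    obtain ⟨v, b, h, hv, hb⟩ := ih (by rintro rfl; simp at hn)
    by_cases hpS : p ∈ S
    · refine ⟨p * v, b, by rw [h, mul_assoc], fun r hr hd => ?_, hb⟩
      rcases hr.dvd_mul.1 hd with hd | hd
      · rwa [(Nat.prime_dvd_prime_iff_eq hr hp).1 hd]
      · exact hv r hr hd
    · refine ⟨v, p * b, by rw [h, mul_left_comm], hv, fun r hr hd => ?_⟩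
      rcases hr.dvd_mul.1 hd with hd | hd
      · rwa [(Nat.prime_dvd_prime_iff_eq hr hp).1 hd]
      · exact hb r hr hd

lemma coprime_of_split {v b : ℕ} (hv : ∀ p, p.Prime → p ∣ v → p ∈ S)
    (hb : ∀ p, p.Prime → p ∣ b → p ∉ S) : v.Coprime b :=
  Nat.coprime_of_dvd fun p hp h1 h2 => hb p hp h2 (hv p hp h1)

lemma intCast_dvd_of_ZS (hS : ∀ p ∈ S, p.Prime) {N : ℕ} (hN : ∀ p, p.Prime → p ∣ N → p ∉ S) {x : ℤ}
    (h : (N : ZS S) ∣ x) : (N : ℤ) ∣ x := by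
  obtain ⟨y, hy⟩ := h
  have h1 : (x : ℚ) = N * (y : ℚ) := by exact_mod_cast congrArg Subtype.val hy
  have h2 : x * ((y : ℚ).den : ℤ) = N * (y : ℚ).num := by
    have hy0 : ((y : ℚ).den : ℚ) ≠ 0 := by exact_mod_cast (y : ℚ).den_nz
    have h3 : (x : ℚ) * (y : ℚ).den = N * (y : ℚ).num := by
      rw [h1, mul_assoc, Rat.mul_den_eq_num]
    exact_mod_cast h3
  have h4 : IsCoprime (N : ℤ) ((y : ℚ).den : ℤ) := by
    rw [Nat.isCoprime_iff_coprime]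
    exact (coprime_of_split (mem_of_dvd_den hS y.2) hN).symm
  exact h4.dvd_of_dvd_mul_right ⟨_, h2⟩

lemma isUnit_natCast_ZS_of_split {n : ℕ} (hn : n ≠ 0) (h : ∀ p, p.Prime → p ∣ n → p ∈ S) :
    IsUnit (n : ZS S) := by
  refine IsUnit.of_mul_eq_one ⟨(n : ℚ)⁻¹, inv_natCast_mem_ZS n hn h⟩ ?_
  apply Subtype.ext
  rw [Subring.coe_mul]
  simp [hn]

theorem hasElemGen_ZS (hS : ∀ p ∈ S, p.Prime) (h2 : 2 ∈ S) {N : ℕ}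
    (hN : ∀ p, p.Prime → p ∣ N → p ∉ S) : HasElemGen (N : ZS S) := by
  have hNodd : Odd N := by
    rw [← Nat.not_even_iff_odd, even_iff_two_dvd]
    exact fun h => hN 2 Nat.prime_two h h2
  have key : ∀ b a : ℤ, IsCoprime a b → Odd b → (N : ℤ) ∣ a - 1 →
      RowProp (N : ZS S) (b : ZS S) (a : ZS S) := by
    refine int_descent hNodd (fun b a => RowProp (N : ZS S) (b : ZS S) (a : ZS S)) ?_ ?_ ?_
    · rintro b a a' ⟨t, ht⟩ h
      refine RowProp.col (t : ZS S) ?_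
      rw [show a' = a + N * b * t by linear_combination ht] at h
      push_cast at h
      exact h
    · rintro b b' a ⟨t, ht⟩ h
      refine RowProp.row (t : ZS S) ?_
      rw [show b' = b + t * a by linear_combination ht] at h
      push_cast at h
      exact h
    · intro b k
      have hu2 : IsUnit ((2 : ℕ) : ZS S) := isUnit_natCast_ZS h2 two_ne_zero
      have hu : IsUnit ((((4 : ℕ) ^ Nat.totient N : ℕ) : ZS S) ^ k) := by
        have : (((4 : ℕ) ^ Nat.totient N : ℕ) : ZS S) = ((2 : ℕ) : ZS S) ^ (2 * Nat.totient N) := by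
          rw [pow_mul]
          push_cast
          norm_num
        rw [this]
        exact (hu2.pow _).pow _
      obtain ⟨u, hu⟩ := hu
      have hUN : (N : ℤ) ∣ ((((4 : ℕ) ^ Nat.totient N : ℕ) : ℤ)) ^ k - 1 := by
        apply dvd_pow_sub_one_int
        have := (Nat.ModEq.pow_totient (n := N) (x := 4)
          (Nat.Coprime.pow_left 2 (Nat.coprime_two_left.2 hNodd)))
        have := Nat.modEq_iff_dvd.1 this.symm
        exact_mod_cast this
      have := RowProp.unit (N := (N : ZS S)) (b : ZS S) u (by
        rw [hu]
        obtain ⟨c, hc⟩ := hUN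
        refine ⟨(c : ZS S), ?_⟩
        have := congrArg (Int.cast : ℤ → ZS S) hc
        push_cast at this ⊢
        exact this)
      rw [hu] at this
      push_cast at this ⊢
      exact this
  have key2 : ∀ b a : ℤ, IsCoprime a b → (N : ℤ) ∣ a - 1 →
      RowProp (N : ZS S) (b : ZS S) (a : ZS S) := by
    intro b a hab ha
    by_cases hb : Odd b
    · exact key b a hab hb ha
    · have hbe : Even b := Int.not_odd_iff_even.1 hb
      have hao : Odd a := by
        rw [← Int.not_even_iff_odd]
        intro hae
        obtain ⟨x, y, hxy⟩ := hab
        have : Even (x * a + y * b) := (hae.mul_left x).add (hbe.mul_left y)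
        rw [hxy] at this
        revert this
        decide
      have := key (b + 1 * a) a (by
        rw [one_mul]
        simpa using hab.add_mul_left_right 1) (by
        rw [one_mul]
        exact hbe.add_odd hao) ha
      refine RowProp.row 1 ?_
      push_cast at this
      exact this
  have main : ∀ g : SLtwo (ZS S), ∀ y : ZS S, y ≠ 0 → g.1 1 0 = N * y →
      (N : ZS S) ∣ g.1 1 1 - 1 → RowProp (N : ZS S) y (g.1 1 1) := by
    intro g y hy hgy hgd
    set d := g.1 1 1 with hd
    have hyden := isUnit_natCast_ZS_of_split (S := S) (y : ℚ).den_nz (mem_of_dvd_den hS y.2)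
    obtain ⟨u, hu⟩ := hyden
    refine RowProp.unit_mul u ?_
    set b' : ℤ := (y : ℚ).num * (y : ℚ).den with hb'
    have hyb : (u : ZS S) ^ 2 * y = (b' : ZS S) := by
      rw [hu]
      apply Subtype.ext
      push_cast
      rw [hb']
      push_cast
      rw [← Rat.mul_den_eq_num (y : ℚ)]
      ring
    rw [hyb]
    have hb'0 : b'.natAbs ≠ 0 := by
      rw [Int.natAbs_ne_zero, hb']
      refine mul_ne_zero (Rat.num_ne_zero.2 fun h => hy (Subtype.ext h)) ?_
      exact_mod_cast (y : ℚ).den_nz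
    obtain ⟨v, b₁, hvb, hv, hb₁⟩ := exists_split S _ hb'0
    have hv0 : v ≠ 0 := by rintro rfl; simp at hvb; omega
    set m := (d : ℚ).den with hm
    set n := (d : ℚ).num with hn
    have hmS := mem_of_dvd_den hS d.2
    have hNb₁ : ∀ p, p.Prime → p ∣ N * b₁ → p ∉ S := by
      intro p hp h
      rcases hp.dvd_mul.1 h with h | h
      exacts [hN p hp h, hb₁ p hp h]
    have hmNb : IsCoprime (m : ℤ) ((N * b₁ : ℕ) : ℤ) :=
      Nat.isCoprime_iff_coprime.2 (coprime_of_split hmS hNb₁)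
    have hvNb : IsCoprime (v : ℤ) ((N * b₁ : ℕ) : ℤ) :=
      Nat.isCoprime_iff_coprime.2 (coprime_of_split hv hNb₁)
    obtain ⟨a, ha1, ha2⟩ : ∃ a : ℤ, ((N * b₁ : ℕ) : ℤ) ∣ a * m - n ∧ (v : ℤ) ∣ a - 1 := by
      obtain ⟨r, s, hrs⟩ := hmNb
      obtain ⟨e, f, hef⟩ := hvNb
      refine ⟨n * r * (e * v) + f * ((N * b₁ : ℕ) : ℤ), ⟨-n * r * f * m + f * m - n * s, ?_⟩,
        ⟨n * r * e - e, ?_⟩⟩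
      · linear_combination n * hrs + n * r * m * hef
      · linear_combination hef
    have hdm : (d : ZS S) * (m : ZS S) = (n : ZS S) := by
      apply Subtype.ext
      push_cast
      rw [hm, hn, Rat.mul_den_eq_num]
    have hmu : IsUnit (m : ZS S) := isUnit_natCast_ZS_of_split (S := S) (d : ℚ).den_nz hmS
    have hvu : IsUnit (v : ZS S) := isUnit_natCast_ZS_of_split (S := S) hv0 hv
    -- `a` is congruent to `d` modulo `N b'`
    obtain ⟨t, ht⟩ : (N : ZS S) * (b' : ZS S) ∣ (a : ZS S) - d := by
      have e1 : (N : ZS S) * (b₁ : ZS S) ∣ ((a : ZS S) - d) * m := by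
        obtain ⟨c, hc⟩ := ha1
        refine ⟨(c : ZS S), ?_⟩
        rw [sub_mul, hdm]
        exact_mod_cast congrArg (Int.cast : ℤ → ZS S) hc
      have e2 := (hmu.dvd_mul_right).1 e1
      have e3 : (N : ZS S) * (b' : ZS S) ∣ (N : ZS S) * (b₁ : ZS S) := by
        apply mul_dvd_mul_left
        have e4 : (b' : ZS S) ∣ ((b'.natAbs : ℤ) : ZS S) := by
          exact map_dvd (Int.castRingHom (ZS S)) (Int.dvd_natAbs.2 dvd_rfl)
        refine e4.trans ?_
        rw [hvb]
        push_cast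
        exact (hvu.mul_left_dvd).2 dvd_rfl
      exact e3.trans e2
    refine RowProp.col t ?_
    rw [show d + N * b' * t = (a : ZS S) by linear_combination -ht]
    apply key2
    · -- coprimality
      rw [Int.isCoprime_iff_gcd_eq_one, Int.gcd_eq_natAbs, ← Nat.coprime_iff_gcd_eq_one]
      refine Nat.coprime_of_dvd fun p hp hpa hpb => ?_
      rw [hvb] at hpb
      have hpa' : (p : ℤ) ∣ a := Int.natCast_dvd.2 hpa
      have hpv : ¬ p ∣ v := by
        intro h
        have h1 : (p : ℤ) ∣ a - 1 := (Int.natCast_dvd_natCast.2 h).trans ha2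
        have h2 := dvd_sub hpa' h1
        rw [sub_sub_cancel] at h2
        exact hp.one_lt.ne' (by exact_mod_cast Int.eq_one_of_dvd_one (by positivity) h2)
      have hpb₁ : p ∣ b₁ := (hp.dvd_mul.1 hpb).resolve_left hpv
      have hpS := hb₁ p hp hpb₁
      have : Fact p.Prime := ⟨hp⟩
      have hra : redZS hS p hpS (a : ZS S) = 0 := by
        rw [map_intCast, ZMod.intCast_zmod_eq_zero_iff_dvd]
        exact hpa'
      have hrb : redZS hS p hpS (b' : ZS S) = 0 := by
        rw [map_intCast, ZMod.intCast_zmod_eq_zero_iff_dvd]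
        apply Int.natCast_dvd.2
        rw [hvb]
        exact hpb
      have hrd : redZS hS p hpS d = 0 := by
        rw [show d = (a : ZS S) - N * b' * t by linear_combination -ht, map_sub, map_mul, map_mul,
          hra, hrb]
        ring
      have hry : redZS hS p hpS y = 0 := by
        rw [← hyb, map_mul] at hrb
        exact (mul_eq_zero.1 hrb).resolve_left ((u.isUnit.pow 2).map (redZS hS p hpS)).ne_zero
      have hdet := congrArg (redZS hS p hpS) g.det_eq
      rw [map_sub, map_mul, map_mul, hgy, map_mul, hry, ← hd, hrd, map_one] at hdet
      simp at hdet
    · -- congruence modulo `N`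
      apply intCast_dvd_of_ZS hS hN
      push_cast
      have e1 : (N : ZS S) ∣ (a : ZS S) - d := ⟨b' * t, by rw [ht, mul_assoc]⟩
      have := dvd_add e1 hgd
      rwa [sub_add_sub_cancel] at this
  rintro g ⟨y, hy⟩ hgd
  by_cases hy0 : y = 0
  · have hdet := g.det_eq
    rw [hy, hy0, mul_zero, mul_zero, sub_zero] at hdet
    have hd0 : g.1 1 1 ≠ 0 := by
      intro h
      rw [h, mul_zero] at hdet
      exact zero_ne_one hdet
    have := main (g * x21 ((N : ZS S) * 1)) (g.1 1 1) hd0 (by simp [hy, hy0, mul_comm]) (by simpa using hgd)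
      (g * x21 ((N : ZS S) * 1)) (by simp [hy, hy0, mul_comm]) rfl
    exact (Subgroup.mul_mem_cancel_right _ (x21_mem_elemN 1 _)).1 this
  · exact main g y hy0 hy hgd g hy rfl

end ZSGen


section Perfect

variable {R : Type*} [CommRing R]


lemma hd_comm_x12 {u : Rˣ} (hu : (u : R) = 2) (t : R) :
    hd u * x12 t * (hd u)⁻¹ * (x12 t)⁻¹ = x12 (3 * t) := by
  rw [hd_conj_x12, hu, x12_inv, ← x12_add]
  congr 1
  ring

lemma hd_comm_x21 {u : Rˣ} (hu : (u : R) = 2) (t : R) :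
    (hd u)⁻¹ * x21 t * hd u * (x21 t)⁻¹ = x21 (3 * t) := by
  have := hd_conj_x21 t u⁻¹
  rw [← hd_inv, inv_inv, inv_inv, hu] at this
  rw [this, x21_inv, ← x21_add]
  congr 1
  ring

lemma commutator_eq_top_of_elemGen (h1 : HasElemGen (1 : R)) (h2 : IsUnit (2 : R))
    (h3 : IsUnit (3 : R)) : commutator (SLtwo R) = ⊤ := by
  obtain ⟨u, hu⟩ := h2
  obtain ⟨v, hv⟩ := h3
  rw [eq_top_iff]
  intro g _
  have hg : g ∈ elemN (1 : R) := h1 g (one_dvd _) (one_dvd _)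
  refine (Subgroup.closure_le _).2 ?_ hg
  have e (t : R) : t = 3 * (((v⁻¹ : Rˣ) : R) * t) := by rw [← hv, Units.mul_inv_cancel_left]
  rintro _ (⟨t, rfl⟩ | ⟨t, rfl⟩)
  · rw [e t, ← hd_comm_x12 hu]
    exact Subgroup.commutator_mem_commutator (Subgroup.mem_top _) (Subgroup.mem_top _)
  · simp only [one_mul]
    rw [e t, ← hd_comm_x21 hu]
    have := Subgroup.commutator_mem_commutator (Subgroup.mem_top (hd u)⁻¹)
      (Subgroup.mem_top (x21 (((v⁻¹ : Rˣ) : R) * t)))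
    rw [commutatorElement_def, inv_inv] at this
    exact this

end Perfect

section FiniteField

section Relations

variable {R : Type*} [CommRing R] (u : Rˣ)

lemma hd_mul_ww : hd u * ww = ww * hd u⁻¹ := by
  apply SLtwo.ext4 <;> simp

lemma hd_mul_ww_mul_ww : hd u * ww * ww = hd (-u) := by
  apply SLtwo.ext4 <;> simp

lemma x12_mul_x21_mul_x12 :
    x12 (u : R) * x21 (-((u⁻¹ : Rˣ) : R)) * x12 (u : R) = hd u * ww := by
  apply SLtwo.ext4 <;> simp

end Relations

variable {F E : Type*} [Field F] [Group E]

lemma conj_eq_of_central {Γ : Type*} [Group Γ] {π : E →* Γ}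
    (hc : ∀ n, π n = 1 → ∀ e : E, n * e = e * n) {a b : E} (h : π a = π b) (x : E) :
    a * x * a⁻¹ = b * x * b⁻¹ := by
  have h1 := hc (b⁻¹ * a) (by rw [map_mul, map_inv, h, inv_mul_cancel]) x
  calc a * x * a⁻¹ = b * ((b⁻¹ * a) * x) * a⁻¹ := by group
    _ = b * (x * (b⁻¹ * a)) * a⁻¹ := by rw [h1]
    _ = b * x * b⁻¹ := by group

lemma exists_sq_mul_of_nonsquare {q : ℕ} [Fact q.Prime] {a b : (ZMod q)ˣ} (ha : ¬ IsSquare a)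
    (hb : ¬ IsSquare b) : ∃ x, b = x ^ 2 * a := by
  have key : ∀ c : (ZMod q)ˣ, IsSquare (c : ZMod q) → IsSquare c := by
    rintro c ⟨y, hy⟩
    have hy0 : y ≠ 0 := by rintro rfl; exact c.ne_zero (by simpa using hy)
    exact ⟨Units.mk0 y hy0, Units.ext (by simpa using hy)⟩
  have ha' : quadraticChar (ZMod q) a = -1 :=
    quadraticChar_neg_one_iff_not_isSquare.2 fun h => ha (key _ h)
  have hb' : quadraticChar (ZMod q) b = -1 :=
    quadraticChar_neg_one_iff_not_isSquare.2 fun h => hb (key _ h)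
  have h1 : quadraticChar (ZMod q) ((b * a⁻¹ * a * a : (ZMod q)ˣ) : ZMod q) = 1 := by
    rw [inv_mul_cancel_right, Units.val_mul, map_mul, ha', hb']; norm_num
  obtain ⟨x, hx⟩ := key _ ((quadraticChar_one_iff_isSquare (Units.ne_zero _)).1 h1)
  refine ⟨x * a⁻¹, ?_⟩
  rw [mul_pow, sq x, ← hx]
  simp [sq]

lemma exists_add_eq_one_nonsquare {q : ℕ} [Fact q.Prime] (hq2 : q ≠ 2) :
    ∃ a b : (ZMod q)ˣ, (a : ZMod q) + b = 1 ∧ ¬ IsSquare a ∧ ¬ IsSquare b := by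
  obtain ⟨n, hn⟩ := FiniteField.exists_nonsquare (F := ZMod q) (by rwa [ZMod.ringChar_zmod_n])
  obtain ⟨x, y, hxy⟩ := ZMod.sq_add_sq q n
  have hn0 : n ≠ 0 := by rintro rfl; exact hn ⟨0, by simp⟩
  have hx : x ≠ 0 := by rintro rfl; exact hn ⟨y, by rw [← hxy]; ring⟩
  have hy : y ≠ 0 := by rintro rfl; exact hn ⟨x, by rw [← hxy]; ring⟩
  have key : ∀ z : ZMod q, z ≠ 0 → ∀ u : (ZMod q)ˣ, (u : ZMod q) = z ^ 2 / n →
      ¬ IsSquare u := by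
    rintro z hz u hu ⟨v, rfl⟩
    refine hn ⟨z / v, ?_⟩
    have hv := v.ne_zero
    rw [Units.val_mul, eq_div_iff hn0] at hu
    field_simp
    linear_combination hu
  have hx' : x ^ 2 / n ≠ 0 := div_ne_zero (pow_ne_zero _ hx) hn0
  have hy' : y ^ 2 / n ≠ 0 := div_ne_zero (pow_ne_zero _ hy) hn0
  refine ⟨Units.mk0 _ hx', Units.mk0 _ hy', ?_, key x hx _ rfl, key y hy _ rfl⟩
  rw [Units.val_mk0, Units.val_mk0, ← add_div, hxy, div_self hn0]

/-- A central extension of `SL₂` of a field splits once there are compatible lifts of the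
unipotent, diagonal and Weyl elements. -/
lemma exists_section_of_bruhat (π : E →* SLtwo F) (X Y : F → E) (H : Fˣ →* E) (w : E)
    (hX : ∀ s t, X (s + t) = X s * X t)
    (hπX : ∀ t, π (X t) = x12 t) (hπH : ∀ u, π (H u) = hd u) (hπw : π w = ww)
    (hHX : ∀ u t, H u * X t = X ((u : F) ^ 2 * t) * H u)
    (hw1 : w * w = H (-1)) (hwH : ∀ u, w * H u = H u⁻¹ * w) (hwX : ∀ t, w * X t = Y (-t) * w)
    (hW : ∀ u : Fˣ, X u * Y (-((u⁻¹ : Fˣ) : F)) * X u = H u * w) :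
    ∃ s : SLtwo F →* E, ∀ g, π (s g) = g := by
  have hX0 : X 0 = 1 := by
    have := hX 0 0
    rw [add_zero] at this
    exact mul_eq_left.1 this.symm
  have hXneg (t : F) : (X t)⁻¹ = X (-t) := by
    rw [inv_eq_iff_mul_eq_one, ← hX, add_neg_cancel, hX0]
  have hXH (u : Fˣ) (t : F) : X t * H u = H u * X (((u⁻¹ : Fˣ) : F) ^ 2 * t) := by
    rw [hHX, ← mul_assoc, ← mul_pow, Units.mul_inv, one_pow, one_mul]
  have hYr (u : Fˣ) : Y (-(u : F)) = X (-((u⁻¹ : Fˣ) : F)) * (H u⁻¹ * w) *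
      X (-((u⁻¹ : Fˣ) : F)) := by
    rw [← hW u⁻¹, inv_inv, ← hXneg]
    group
  let B : Set E := {e | (∃ u t, e = H u * X t) ∨ ∃ r u s, e = X r * (H u * w) * X s}
  have hBX : ∀ t, ∀ e ∈ B, X t * e ∈ B := by
    rintro t _ (⟨u, s, rfl⟩ | ⟨r, u, s, rfl⟩)
    · exact Or.inl ⟨u, ((u⁻¹ : Fˣ) : F) ^ 2 * t + s, by rw [← mul_assoc, hXH, hX, mul_assoc]⟩
    · exact Or.inr ⟨t + r, u, s, by rw [hX]; group⟩
  have hBH : ∀ v, ∀ e ∈ B, H v * e ∈ B := by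
    rintro v _ (⟨u, s, rfl⟩ | ⟨r, u, s, rfl⟩)
    · exact Or.inl ⟨v * u, s, by rw [map_mul, mul_assoc]⟩
    · refine Or.inr ⟨(v : F) ^ 2 * r, v * u, s, ?_⟩
      rw [map_mul, ← mul_assoc, ← mul_assoc, hHX]
      group
  have hBw : ∀ e ∈ B, w * e ∈ B := by
    rintro _ (⟨u, s, rfl⟩ | ⟨r, u, s, rfl⟩)
    · exact Or.inr ⟨0, u⁻¹, s, by rw [hX0, one_mul, ← mul_assoc, hwH]⟩
    · by_cases hr : r = 0
      · refine Or.inl ⟨u⁻¹ * -1, s, ?_⟩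
        rw [hr, hX0, one_mul, ← mul_assoc, ← mul_assoc, hwH, mul_assoc (H u⁻¹), hw1, map_mul]
      · refine Or.inr ⟨-((Units.mk0 r hr)⁻¹ : Fˣ), (Units.mk0 r hr)⁻¹ * (u⁻¹ * -1)⁻¹,
          (((u⁻¹ * -1)⁻¹ : Fˣ) : F) ^ 2 * (-((Units.mk0 r hr)⁻¹ : Fˣ)) + s, ?_⟩
        have h1 := hYr (Units.mk0 r hr)
        rw [Units.val_mk0] at h1
        calc w * (X r * (H u * w) * X s) = (w * X r) * (H u * w) * X s := by group
          _ = X (-((Units.mk0 r hr)⁻¹ : Fˣ)) * (H (Units.mk0 r hr)⁻¹ * w) *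
              X (-((Units.mk0 r hr)⁻¹ : Fˣ)) * ((w * H u) * w) * X s := by
            rw [hwX, h1]; group
          _ = X (-((Units.mk0 r hr)⁻¹ : Fˣ)) * (H (Units.mk0 r hr)⁻¹ * w) *
              (X (-((Units.mk0 r hr)⁻¹ : Fˣ)) * H (u⁻¹ * -1)) * X s := by
            rw [hwH, mul_assoc (H u⁻¹), hw1, ← map_mul]; group
          _ = X (-((Units.mk0 r hr)⁻¹ : Fˣ)) * (H (Units.mk0 r hr)⁻¹ * (w * H (u⁻¹ * -1))) *
              (X ((((u⁻¹ * -1)⁻¹ : Fˣ) : F) ^ 2 * (-((Units.mk0 r hr)⁻¹ : Fˣ))) * X s) := by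
            rw [hXH]; group
          _ = _ := by
            rw [hwH, hX, map_mul]; group
  let gens : Set E := Set.range X ∪ Set.range H ∪ {w}
  have hw_inv : w⁻¹ = H (-1) * w := by
    rw [inv_eq_iff_mul_eq_one, ← mul_assoc, hwH, mul_assoc, hw1, ← map_mul]
    simp
  have hgen : ∀ e ∈ Subgroup.closure gens, e ∈ B := by
    intro e he
    refine Subgroup.closure_induction_left (p := fun e _ => e ∈ B) ?_ ?_ ?_ he
    · exact Or.inl ⟨1, 0, by rw [hX0, map_one, one_mul]⟩
    · rintro x ((⟨t, rfl⟩ | ⟨u, rfl⟩) | rfl) y _ hy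
      exacts [hBX _ _ hy, hBH _ _ hy, hBw _ hy]
    · rintro x ((⟨t, rfl⟩ | ⟨u, rfl⟩) | rfl) y _ hy
      · rw [hXneg]
        exact hBX _ _ hy
      · rw [← map_inv]
        exact hBH _ _ hy
      · rw [hw_inv, mul_assoc]
        exact hBH _ _ (hBw _ hy)
  have mX (t) : X t ∈ Subgroup.closure gens := Subgroup.subset_closure (Or.inl (Or.inl ⟨t, rfl⟩))
  have mH (t) : H t ∈ Subgroup.closure gens := Subgroup.subset_closure (Or.inl (Or.inr ⟨t, rfl⟩))
  have mw : w ∈ Subgroup.closure gens := Subgroup.subset_closure (Or.inr rfl)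
  have hinj : Function.Injective (π.comp (Subgroup.closure gens).subtype) := by
    rw [injective_iff_map_eq_one]
    rintro ⟨e, he⟩ h1
    apply Subtype.ext
    change e = 1
    replace h1 : π e = 1 := h1
    rcases hgen e he with ⟨u, t, rfl⟩ | ⟨r, u, s, rfl⟩
    · rw [map_mul, hπH, hπX] at h1
      have h00 : (hd u * x12 t).1 0 0 = (1 : SLtwo F).1 0 0 := by rw [h1]
      have h01 : (hd u * x12 t).1 0 1 = (1 : SLtwo F).1 0 1 := by rw [h1]
      simp at h00 h01
      rw [h00, h01, hX0, map_one, one_mul]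
    · rw [map_mul, map_mul, map_mul, hπX, hπX, hπH, hπw] at h1
      have h10 : (x12 r * (hd u * ww) * x12 s).1 1 0 = (1 : SLtwo F).1 1 0 := by rw [h1]
      simp at h10
  have hsurj : Function.Surjective (π.comp (Subgroup.closure gens).subtype) := by
    intro g
    have hdet := g.det_eq
    by_cases hc0 : g.1 1 0 = 0
    · rw [hc0, mul_zero, sub_zero] at hdet
      have ha : g.1 0 0 ≠ 0 := left_ne_zero_of_mul_eq_one hdet
      refine ⟨⟨H (Units.mk0 _ ha) * X (g.1 0 1 / g.1 0 0), mul_mem (mH _) (mX _)⟩, ?_⟩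
      change π (H (Units.mk0 _ ha) * X (g.1 0 1 / g.1 0 0)) = g
      rw [map_mul, hπH, hπX]
      apply SLtwo.ext4 <;> simp [hc0]
      · field_simp
      · field_simp
        linear_combination -hdet
    · have hc1 : -(g.1 1 0)⁻¹ ≠ 0 := neg_ne_zero.2 (inv_ne_zero hc0)
      refine ⟨⟨X (g.1 0 0 / g.1 1 0) * (H (Units.mk0 _ hc1) * w) * X (g.1 1 1 / g.1 1 0),
        mul_mem (mul_mem (mX _) (mul_mem (mH _) mw)) (mX _)⟩, ?_⟩
      change π (X (g.1 0 0 / g.1 1 0) * (H (Units.mk0 _ hc1) * w) * X (g.1 1 1 / g.1 1 0)) = g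
      rw [map_mul, map_mul, map_mul, hπH, hπX, hπX, hπw]
      apply SLtwo.ext4 <;> simp <;> field_simp
      linear_combination hdet
  let e := MulEquiv.ofBijective _ ⟨hinj, hsurj⟩
  exact ⟨(Subgroup.closure gens).subtype.comp e.symm.toMonoidHom, fun g => e.apply_symm_apply g⟩

lemma exists_section_zmod {q : ℕ} [hq : Fact q.Prime] (hq2 : q ≠ 2) (π : E →* SLtwo (ZMod q))
    (hc : ∀ n, π n = 1 → ∀ e : E, n * e = e * n) (X : ZMod q → E) (H : (ZMod q)ˣ →* E) (w : E)
    (hX : ∀ s t, X (s + t) = X s * X t)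
    (hπX : ∀ t, π (X t) = x12 t) (hπH : ∀ u, π (H u) = hd u) (hπw : π w = ww)
    (hHX : ∀ (u : (ZMod q)ˣ) t, H u * X t = X ((u : ZMod q) ^ 2 * t) * H u) :
    ∃ s : SLtwo (ZMod q) →* E, ∀ g, π (s g) = g := by
  have hX0 : X 0 = 1 := by
    have := hX 0 0
    rw [add_zero] at this
    exact mul_eq_left.1 this.symm
  have hXneg (t) : (X t)⁻¹ = X (-t) := by
    rw [inv_eq_iff_mul_eq_one, ← hX, add_neg_cancel, hX0]
  have hHXc (u : (ZMod q)ˣ) (t) : H u * X t * (H u)⁻¹ = X ((u : ZMod q) ^ 2 * t) := by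
    rw [hHX, mul_inv_cancel_right]
  obtain ⟨Y, hYdef⟩ : ∃ Y : ZMod q → E, ∀ t, Y t = w * X (-t) * w⁻¹ := ⟨_, fun _ => rfl⟩
  have hY (s t) : Y (s + t) = Y s * Y t := by
    rw [hYdef, hYdef, hYdef, neg_add, hX]; group
  have hY0 : Y 0 = 1 := by rw [hYdef, neg_zero, hX0]; group
  have hYneg (t) : (Y t)⁻¹ = Y (-t) := by
    rw [inv_eq_iff_mul_eq_one, ← hY, add_neg_cancel, hY0]
  have hπY (t) : π (Y t) = x21 t := by
    rw [hYdef, map_mul, map_mul, map_inv, hπw, hπX, ww_conj_x12, neg_neg]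
  have hHY (u : (ZMod q)ˣ) (t) :
      H u * Y t * (H u)⁻¹ = Y (((u⁻¹ : (ZMod q)ˣ) : ZMod q) ^ 2 * t) := by
    have h1 : π (H u * w) = π (w * H u⁻¹) := by
      rw [map_mul, map_mul, hπH, hπw, hπH]
      exact hd_mul_ww u
    have h2 := conj_eq_of_central hc h1 (X (-t))
    calc H u * Y t * (H u)⁻¹ = (H u * w) * X (-t) * (H u * w)⁻¹ := by rw [hYdef]; group
      _ = w * (H u⁻¹ * X (-t) * (H u⁻¹)⁻¹) * w⁻¹ := by rw [h2]; group
      _ = _ := by rw [hHXc, hYdef, mul_neg]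
  obtain ⟨W, hWdef⟩ : ∃ W : (ZMod q)ˣ → E,
      ∀ t, W t = X t * Y (-((t⁻¹ : (ZMod q)ˣ) : ZMod q)) * X t := ⟨_, fun _ => rfl⟩
  have hπW (t) : π (W t) = hd t * ww := by
    rw [hWdef, map_mul, map_mul, hπX, hπY, x12_mul_x21_mul_x12]
  have hWX (t : (ZMod q)ˣ) (s) :
      W t * X s * (W t)⁻¹ = Y (-(((t⁻¹ : (ZMod q)ˣ) : ZMod q) ^ 2 * s)) := by
    have h1 : π (W t) = π (H t * w) := by rw [hπW, map_mul, hπH, hπw]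
    rw [conj_eq_of_central hc h1, ← mul_neg, ← hHY, hYdef, neg_neg]
    group
  have hWY (t : (ZMod q)ˣ) (s) : W t * Y s * (W t)⁻¹ = X (-((t : ZMod q) ^ 2 * s)) := by
    have h1 : π (W t * w) = π (H (-t)) := by
      rw [map_mul, hπW, hπw, hπH, hd_mul_ww_mul_ww]
    have h2 := conj_eq_of_central hc h1 (X (-s))
    calc W t * Y s * (W t)⁻¹ = (W t * w) * X (-s) * (W t * w)⁻¹ := by rw [hYdef]; group
      _ = _ := by rw [h2, hHXc]; simp
  have hWalt (t : (ZMod q)ˣ) : W t = Y (-((t⁻¹ : (ZMod q)ˣ) : ZMod q)) * X t *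
      Y (-((t⁻¹ : (ZMod q)ˣ) : ZMod q)) := by
    have h1 : ((t⁻¹ : (ZMod q)ˣ) : ZMod q) ^ 2 * t = ((t⁻¹ : (ZMod q)ˣ) : ZMod q) := by
      rw [sq, mul_assoc, Units.inv_mul, mul_one]
    have h2 : -((t : ZMod q) ^ 2 * -((t⁻¹ : (ZMod q)ˣ) : ZMod q)) = t := by
      rw [sq, mul_neg, mul_assoc, Units.mul_inv, mul_one, neg_neg]
    calc W t = W t * (X t * Y (-((t⁻¹ : (ZMod q)ˣ) : ZMod q)) * X t) * (W t)⁻¹ := by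
          rw [← hWdef]; group
      _ = (W t * X t * (W t)⁻¹) * (W t * Y (-((t⁻¹ : (ZMod q)ˣ) : ZMod q)) * (W t)⁻¹) *
          (W t * X t * (W t)⁻¹) := by group
      _ = _ := by rw [hWX, hWY, h1, h2]
  have hWneg (t : (ZMod q)ˣ) : (W t)⁻¹ = W (-t) := by
    rw [hWdef, hWdef, mul_inv_rev, mul_inv_rev, hXneg, hYneg, inv_neg, Units.val_neg,
      Units.val_neg, mul_assoc]
  have hHW (u t : (ZMod q)ˣ) : H u * W t * (H u)⁻¹ = W (u ^ 2 * t) := by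
    calc H u * W t * (H u)⁻¹ = (H u * X t * (H u)⁻¹) *
          (H u * Y (-((t⁻¹ : (ZMod q)ˣ) : ZMod q)) * (H u)⁻¹) * (H u * X t * (H u)⁻¹) := by
            rw [hWdef]; group
      _ = _ := by
        rw [hHXc, hHY, hWdef, mul_inv, Units.val_mul, Units.val_mul, Units.val_pow_eq_pow_val,
          ← inv_pow, Units.val_pow_eq_pow_val, mul_neg]
  have hXYX (u : (ZMod q)ˣ) (s : ZMod q) : X u * Y s * X (-u) =
      Y ((u⁻¹ : (ZMod q)ˣ) : ZMod q) * X (-((u : ZMod q) ^ 2 * s)) *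
        Y (-((u⁻¹ : (ZMod q)ˣ) : ZMod q)) := by
    have h1 : X u = Y ((u⁻¹ : (ZMod q)ˣ) : ZMod q) * W u * Y ((u⁻¹ : (ZMod q)ˣ) : ZMod q) := by
      rw [hWalt, ← hYneg]; group
    calc X u * Y s * X (-u) = X u * Y s * (X u)⁻¹ := by rw [hXneg]
      _ = Y ((u⁻¹ : (ZMod q)ˣ) : ZMod q) * W u * (Y ((u⁻¹ : (ZMod q)ˣ) : ZMod q) * Y s *
          (Y ((u⁻¹ : (ZMod q)ˣ) : ZMod q))⁻¹) * (W u)⁻¹ *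
          (Y ((u⁻¹ : (ZMod q)ˣ) : ZMod q))⁻¹ := by rw [h1]; group
      _ = Y ((u⁻¹ : (ZMod q)ˣ) : ZMod q) * (W u * Y s * (W u)⁻¹) *
          (Y ((u⁻¹ : (ZMod q)ˣ) : ZMod q))⁻¹ := by
        rw [← hY, add_comm, hY]; group
      _ = _ := by rw [hWY, hYneg]
  have hsteinberg (u v : (ZMod q)ˣ) (huv : (u : ZMod q) + v = 1) :
      W u * (W 1)⁻¹ * W v = W (u * v) := by
    have hu0 : (u : ZMod q) ≠ 0 := u.ne_zero
    have hv0 : (v : ZMod q) ≠ 0 := v.ne_zero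
    have e1 := hXYX u (-((v : ZMod q) / u))
    have e2 := hXYX (-v) (-((u : ZMod q) / v))
    rw [inv_neg, Units.val_neg, Units.val_neg, neg_neg, neg_neg] at e2
    have f1 : -((u : ZMod q) ^ 2 * -((v : ZMod q) / u)) = u * v := by field_simp
    have f2 : -((-(v : ZMod q)) ^ 2 * -((u : ZMod q) / v)) = u * v := by field_simp
    rw [f1] at e1
    rw [f2] at e2
    have g1 : -((u⁻¹ : (ZMod q)ˣ) : ZMod q) + 1 = -((v : ZMod q) / u) := by
      rw [Units.val_inv_eq_inv_val]; field_simp; linear_combination huv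
    have g2 : 1 + -((v⁻¹ : (ZMod q)ˣ) : ZMod q) = -((u : ZMod q) / v) := by
      rw [Units.val_inv_eq_inv_val]; field_simp; linear_combination huv
    have g3 : -((u⁻¹ : (ZMod q)ˣ) : ZMod q) + -((v⁻¹ : (ZMod q)ˣ) : ZMod q) =
        -(((u * v)⁻¹ : (ZMod q)ˣ) : ZMod q) := by
      simp only [Units.val_inv_eq_inv_val, Units.val_mul]
      field_simp; linear_combination -huv
    have g4 : (-1 : ZMod q) = -u + -v := by linear_combination huv
    have hW1 : (W 1)⁻¹ = Y 1 * X (-1) * Y 1 := by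
      rw [hWneg, hWalt]; simp
    calc W u * (W 1)⁻¹ * W v
        = Y (-((u⁻¹ : (ZMod q)ˣ) : ZMod q)) * X u * (Y (-((u⁻¹ : (ZMod q)ˣ) : ZMod q)) * Y 1) *
          X (-1) * (Y 1 * Y (-((v⁻¹ : (ZMod q)ˣ) : ZMod q))) * X v *
          Y (-((v⁻¹ : (ZMod q)ˣ) : ZMod q)) := by rw [hW1, hWalt u, hWalt v]; group
      _ = Y (-((u⁻¹ : (ZMod q)ˣ) : ZMod q)) * (X u * Y (-((v : ZMod q) / u)) * X (-u)) *
          (X (-v) * Y (-((u : ZMod q) / v)) * X v) * Y (-((v⁻¹ : (ZMod q)ˣ) : ZMod q)) := by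
        rw [← hY, ← hY, g1, g2, g4, hX]; group
      _ = X (u * v) * (Y (-((u⁻¹ : (ZMod q)ˣ) : ZMod q)) *
          Y (-((v⁻¹ : (ZMod q)ˣ) : ZMod q))) * X (u * v) := by
        rw [e1, e2, ← hYneg, ← hYneg]; group
      _ = _ := by rw [← hY, g3, hWdef, Units.val_mul]
  obtain ⟨n, hndef⟩ : ∃ n : (ZMod q)ˣ → E, ∀ t, n t = W t * (W 1)⁻¹ * (H t)⁻¹ :=
    ⟨_, fun _ => rfl⟩
  have hnc (t) (e : E) : n t * e = e * n t := by
    refine hc _ ?_ e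
    rw [hndef, map_mul, map_mul, map_inv, map_inv, hπW, hπW, hπH, hd_one]
    group
  have hWn (t) : W t = n t * H t * W 1 := by rw [hndef]; group
  have hn1 : n 1 = 1 := by rw [hndef, map_one]; group
  have hconj (u : (ZMod q)ˣ) (t) : n (u ^ 2 * t) * (H u * W 1 * H u) = n t * W 1 := by
    have h1 := hHW u t
    rw [hWn, hWn (u ^ 2 * t), map_mul, map_pow] at h1
    have h2 : H t * H u = H u * H t := by rw [← map_mul, mul_comm, map_mul]
    rw [mul_inv_eq_iff_eq_mul] at h1
    refine mul_left_cancel (a := H u * H t) ?_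
    calc H u * H t * (n (u ^ 2 * t) * (H u * W 1 * H u))
        = (n (u ^ 2 * t) * (H u * H t)) * (H u * W 1 * H u) := by rw [hnc _ (H u * H t)]; group
      _ = n (u ^ 2 * t) * (H u * (H t * H u)) * W 1 * H u := by group
      _ = H u * (n t * H t * W 1) := by rw [h1, h2, sq (H u)]; group
      _ = _ := by rw [hnc t (H t)]; group
  have hA (u t : (ZMod q)ˣ) : n (u ^ 2 * t) = n (u ^ 2) * n t := by
    have h1 := hconj u t
    have h2 := hconj u 1
    rw [mul_one, hn1, one_mul] at h2
    refine mul_right_cancel (b := H u * W 1 * H u) ?_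
    rw [h1, hnc (u ^ 2), mul_assoc, h2]
  have hB (u v : (ZMod q)ˣ) (huv : (u : ZMod q) + v = 1) : n (u * v) = n u * n v := by
    have h1 := hsteinberg u v huv
    rw [hWn u, hWn v, hWn (u * v), map_mul] at h1
    have h2 : n u * H u * W 1 * (W 1)⁻¹ * (n v * H v * W 1) =
        (n u * n v) * (H u * H v * W 1) := by
      calc _ = n u * (H u * n v) * (H v * W 1) := by group
        _ = _ := by rw [← hnc]; group
    rw [h2, mul_assoc _ (H u * H v), mul_left_inj] at h1
    exact h1.symm
  have hmul (a b : (ZMod q)ˣ) : n (a * b) = n a * n b := by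
    obtain ⟨a₀, b₀, hab, ha, hb⟩ := exists_add_eq_one_nonsquare hq2
    by_cases h1 : IsSquare a
    · obtain ⟨x, rfl⟩ := h1
      rw [← sq, hA]
    by_cases h2 : IsSquare b
    · obtain ⟨x, rfl⟩ := h2
      rw [mul_comm, ← sq, hA, hnc]
    obtain ⟨x, rfl⟩ := exists_sq_mul_of_nonsquare ha h1
    obtain ⟨y, rfl⟩ := exists_sq_mul_of_nonsquare hb h2
    have h3 : x ^ 2 * a₀ * (y ^ 2 * b₀) = x ^ 2 * (y ^ 2 * (a₀ * b₀)) := by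
      rw [mul_assoc, mul_left_comm a₀]
    rw [h3, hA, hA, hA, hA, hB _ _ hab]
    simp only [mul_assoc]
    rw [← mul_assoc (n (y ^ 2)), hnc _ (n a₀), mul_assoc]
  let H' : (ZMod q)ˣ →* E := MonoidHom.mk' (fun t => n t * H t) (fun a b => by
    rw [hmul, map_mul, mul_assoc, mul_assoc, ← mul_assoc (n b), hnc b (H a), mul_assoc (H a)])
  have hH'W (t) : W t = H' t * W 1 := hWn t
  have hww : W 1 * W 1 = H' (-1) := by
    have h1 := hWneg 1
    rw [hH'W (-1)] at h1
    have h2 : W 1 * W 1 = (H' (-1))⁻¹ := by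
      refine eq_inv_of_mul_eq_one_right ?_
      rw [← mul_assoc, ← h1, inv_mul_cancel]
    rw [h2, ← map_inv, inv_neg, inv_one]
  refine exists_section_of_bruhat π X Y H' (W 1) hX hπX ?_ ?_ ?_ hww ?_ ?_ ?_
  · intro u
    have h1 : π (W u) = π (H' u) * π (W 1) := by rw [hH'W, map_mul]
    rw [hπW, hπW, hd_one, one_mul, mul_left_inj] at h1
    exact h1.symm
  · rw [hπW, hd_one, one_mul]
  · intro u t
    change n u * H u * X t = _ * (n u * H u)
    rw [mul_assoc, hHX, ← mul_assoc, ← mul_assoc, hnc]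
  · intro u
    have h1 := hconj u⁻¹ 1
    rw [mul_one, hn1, one_mul] at h1
    have h2 : n u * n (u⁻¹ ^ 2) = n u⁻¹ := by
      rw [← hmul]; congr 1; group
    calc W 1 * H' u = n (u⁻¹ ^ 2) * (H u⁻¹ * W 1 * H u⁻¹) * (n u * H u) := by rw [h1]; rfl
      _ = n (u⁻¹ ^ 2) * (H u⁻¹ * W 1 * H u⁻¹ * n u) * H u := by group
      _ = n (u⁻¹ ^ 2) * n u * (H u⁻¹ * W 1 * (H u⁻¹ * H u)) := by rw [← hnc u]; group
      _ = H' u⁻¹ * W 1 := by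
        rw [hnc _ (n u), h2, ← map_mul, inv_mul_cancel, map_one, mul_one, ← mul_assoc]
        rfl
  · intro t
    have := hWX 1 t
    rw [inv_one, Units.val_one, one_pow, one_mul] at this
    rw [← this, inv_mul_cancel_right]
  · intro u
    rw [← hWdef, hH'W]

end FiniteField

section CongruenceSplitting

variable {A E : Type*} [CommRing A] [Group E]

lemma commutator_eq_of_central {Γ : Type*} [Group Γ] {π : E →* Γ}
    (hc : ∀ n, π n = 1 → ∀ e : E, n * e = e * n) {a a' b b' : E} (ha : π a = π a')
    (hb : π b = π b') : a * b * a⁻¹ * b⁻¹ = a' * b' * a'⁻¹ * b'⁻¹ := by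
  rw [conj_eq_of_central hc ha]
  have h1 := hc (b'⁻¹ * b) (by rw [map_mul, map_inv, hb, inv_mul_cancel])
  calc a' * b * a'⁻¹ * b⁻¹ = a' * (b' * ((b'⁻¹ * b) * a'⁻¹)) * b⁻¹ := by group
    _ = _ := by rw [h1]; group

lemma exists_rel_of_mem_elemN {N : A} {g' : SLtwo A} (hg' : g' ∈ elemN (N ^ 2)) :
    ∃ g ∈ Subgroup.closure ((Set.range fun t => x12 (N * t)) ∪ Set.range fun t => x21 (N * t)),
      g.1 0 0 = g'.1 0 0 ∧ g.1 0 1 = N * g'.1 0 1 ∧ N * g.1 1 0 = g'.1 1 0 ∧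
        g.1 1 1 = g'.1 1 1 := by
  refine Subgroup.closure_induction (p := fun g' _ => ∃ g ∈ Subgroup.closure
    ((Set.range fun t => x12 (N * t)) ∪ Set.range fun t => x21 (N * t)),
      g.1 0 0 = g'.1 0 0 ∧ g.1 0 1 = N * g'.1 0 1 ∧ N * g.1 1 0 = g'.1 1 0 ∧
        g.1 1 1 = g'.1 1 1) ?_ ?_ ?_ ?_ hg'
  · rintro _ (⟨t, rfl⟩ | ⟨t, rfl⟩)
    · exact ⟨x12 (N * t), Subgroup.subset_closure (Or.inl ⟨t, rfl⟩), by simp⟩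
    · refine ⟨x21 (N * t), Subgroup.subset_closure (Or.inr ⟨t, rfl⟩), ?_⟩
      simp
      ring
  · exact ⟨1, one_mem _, by simp⟩
  · rintro x y _ _ ⟨g, hg, g1, g2, g3, g4⟩ ⟨h, hh, h1, h2, h3, h4⟩
    refine ⟨g * h, mul_mem hg hh, ?_, ?_, ?_, ?_⟩
    · rw [SLtwo.mul_00, SLtwo.mul_00, g1, h1, g2, ← h3]; ring
    · rw [SLtwo.mul_01, SLtwo.mul_01, g1, h2, g2, h4]; ring
    · rw [SLtwo.mul_10, SLtwo.mul_10, mul_add, ← mul_assoc, g3, h1, g4, ← h3]; ring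
    · rw [SLtwo.mul_11, SLtwo.mul_11, ← g3, h2, g4, h4]; ring
  · rintro x _ ⟨g, hg, g1, g2, g3, g4⟩
    exact ⟨g⁻¹, inv_mem hg, by simp [g4], by simp [g2], by simp [g3], by simp [g1]⟩

/-- The principal congruence subgroup of level `N` is generated by the obvious elementary matrices
and one further matrix. -/
lemma mem_of_congruence [IsDomain A] {N : A} (hN : N ≠ 0) (hgen : HasElemGen (N ^ 2))
    (hmod : ∀ a : A, ∃ k : ℕ, N ∣ a + k) (H : Subgroup (SLtwo A))
    (h12 : ∀ t, x12 (N * t) ∈ H) (h21 : ∀ t, x21 (N * t) ∈ H)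
    (h0 : x12 1 * x21 N * x12 (-1) ∈ H) {g : SLtwo A} (hg01 : N ∣ g.1 0 1) (hg10 : N ∣ g.1 1 0)
    (hg11 : N ∣ g.1 1 1 - 1) : g ∈ H := by
  have key : ∀ k : ℕ, ∀ g : SLtwo A, N ∣ g.1 0 1 → N ∣ g.1 1 0 →
      N ^ 2 ∣ g.1 1 1 - 1 + k * N → g ∈ H := by
    intro k
    induction k with
    | zero =>
      rintro g ⟨b, hb⟩ ⟨c, hc⟩ hd
      rw [Nat.cast_zero, zero_mul, add_zero] at hd
      have hdet := g.det_eq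
      have hdet' : g.1 0 0 * g.1 1 1 - b * (N * g.1 1 0) = 1 := by
        rw [hb] at hdet; linear_combination hdet
      obtain ⟨g₁, hg₁, e1, e2, e3, e4⟩ := exists_rel_of_mem_elemN
        (hgen (mk4 (g.1 0 0) b (N * g.1 1 0) (g.1 1 1) hdet')
          (by simpa [hc] using ⟨c, by ring⟩) (by simpa using hd))
      have : g = g₁ := by
        refine SLtwo.ext4 ?_ ?_ ?_ ?_
        · rw [e1]; simp
        · rw [e2, hb]; simp
        · refine mul_left_cancel₀ hN ?_
          rw [e3]; simp
        · rw [e4]; simp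
      rw [this]
      refine (Subgroup.closure_le _).2 ?_ hg₁
      rintro _ (⟨t, rfl⟩ | ⟨t, rfl⟩)
      exacts [h12 t, h21 t]
    | succ k ih =>
      rintro g ⟨b, hb⟩ ⟨c, hc⟩ ⟨d, hd⟩
      have h1 := ih ((x12 1 * x21 N * x12 (-1))⁻¹ * g) ?_ ?_ ?_
      · have := mul_mem h0 h1
        rwa [mul_inv_cancel_left] at this
      · simp [hb]
        exact (Dvd.intro _ rfl : N ∣ N * (g.1 1 1 + (1 + -N) * b)).trans (dvd_of_eq (by ring))
      · simp [hc]
        exact (Dvd.intro _ rfl : N ∣ N * (-g.1 0 0 + (N + 1) * c)).trans (dvd_of_eq (by ring))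
      · have hd' : g.1 1 1 = 1 - (k + 1) * N + N ^ 2 * d := by
          push_cast at hd
          linear_combination hd
        simp [hb, hd']
        exact (Dvd.intro _ rfl : N ^ 2 ∣ N ^ 2 * (-b - (k + 1) + (N + 1) * d)).trans
          (dvd_of_eq (by ring))
  obtain ⟨d, hd⟩ := hg11
  obtain ⟨k, e, he⟩ := hmod d
  refine key k g hg01 hg10 ⟨e, ?_⟩
  rw [hd]
  linear_combination N * he

/-- Membership in the principal congruence subgroup of level `N`. -/
def IsCongruent (N : A) (g : SLtwo A) : Prop :=
  N ∣ g.1 0 1 ∧ N ∣ g.1 1 0 ∧ N ∣ g.1 1 1 - 1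

lemma IsCongruent.conj {N : A} {g : SLtwo A} (hg : IsCongruent N g) (k : SLtwo A) :
    IsCongruent N (k * g * k⁻¹) := by
  obtain ⟨⟨b, hb⟩, ⟨c, hc⟩, ⟨d, hd⟩⟩ := hg
  have hdet := g.det_eq
  have hdet' := k.det_eq
  have hd' : g.1 1 1 = 1 + N * d := by linear_combination hd
  have ha : g.1 0 0 = 1 + N * (b * g.1 1 0 - g.1 0 0 * d) := by
    rw [hb, hd'] at hdet
    linear_combination hdet
  generalize b * g.1 1 0 - g.1 0 0 * d = a at ha
  refine ⟨⟨-k.1 0 0 * k.1 0 1 * a - k.1 0 1 ^ 2 * c + k.1 0 0 ^ 2 * b + k.1 0 0 * k.1 0 1 * d, ?_⟩,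
    ⟨k.1 1 0 * k.1 1 1 * a + k.1 1 1 ^ 2 * c - k.1 1 0 ^ 2 * b - k.1 1 0 * k.1 1 1 * d, ?_⟩,
    ⟨-k.1 1 0 * k.1 0 1 * a - k.1 1 1 * k.1 0 1 * c + k.1 1 0 * k.1 0 0 * b +
      k.1 1 1 * k.1 0 0 * d, ?_⟩⟩
  · simp [ha, hb, hc, hd']; ring
  · simp [ha, hb, hc, hd']; ring
  · simp [ha, hb, hc, hd']; linear_combination hdet'

section

variable [IsDomain A] {N : A} {π : E →* SLtwo A} {σ : SLtwo A → E}

/-- A partial section over `Γ₀(N)` of a central extension of `SL₂` is equivariant on the principal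
congruence subgroup. -/
lemma conj_section_of_congruence (hN : N ≠ 0) (hgen1 : HasElemGen (1 : A))
    (hgen : HasElemGen (N ^ 2)) (hmod : ∀ a : A, ∃ k : ℕ, N ∣ a + k) (h2 : IsUnit (2 : A))
    (h3 : IsUnit (3 : A)) (hπ : Function.Surjective π)
    (hc : ∀ n, π n = 1 → ∀ e : E, n * e = e * n)
    (hσ : ∀ g h : SLtwo A, N ∣ g.1 1 0 → N ∣ h.1 1 0 → σ (g * h) = σ g * σ h)
    (hπσ : ∀ g : SLtwo A, N ∣ g.1 1 0 → π (σ g) = g) (e : E) {g : SLtwo A}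
    (hg01 : N ∣ g.1 0 1) (hg10 : N ∣ g.1 1 0) (hg11 : N ∣ g.1 1 1 - 1) :
    e * σ g * e⁻¹ = σ (π e * g * (π e)⁻¹) := by
  have hσ1 : σ 1 = 1 := by
    have := hσ 1 1 (by simp) (by simp)
    rw [mul_one] at this
    exact mul_eq_left.1 this.symm
  have hσinv (g : SLtwo A) (hg : N ∣ g.1 1 0) : σ g⁻¹ = (σ g)⁻¹ := by
    rw [eq_inv_iff_mul_eq_one, ← hσ _ _ (by simpa using hg) hg, inv_mul_cancel, hσ1]
  have hσconj (g h : SLtwo A) (hg : N ∣ g.1 1 0) (hh : N ∣ h.1 1 0) :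
      σ g * σ h * (σ g)⁻¹ = σ (g * h * g⁻¹) := by
    have hg' : N ∣ (g⁻¹).1 1 0 := by simpa using hg
    have hgh : N ∣ (g * h).1 1 0 := by
      rw [SLtwo.mul_10]; exact dvd_add (hg.mul_right _) (hh.mul_left _)
    rw [hσ _ _ hgh hg', hσ _ _ hg hh, hσinv _ hg]
  obtain ⟨w, hw⟩ := hπ ww
  have h12 (t : A) : N ∣ (x12 t).1 1 0 := by simp
  have h21 (t : A) : N ∣ (x21 (N * t)).1 1 0 := by simp
  have hhd (u : Aˣ) : N ∣ (hd u).1 1 0 := by simp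
  obtain ⟨Y, hYdef⟩ : ∃ Y : A → E, ∀ t, Y t = w * σ (x12 (-t)) * w⁻¹ := ⟨_, fun _ => rfl⟩
  have hπY (t : A) : π (Y t) = x21 t := by
    rw [hYdef, map_mul, map_mul, map_inv, hw, hπσ _ (h12 _), ww_conj_x12, neg_neg]
  have hY (s t) : Y (s + t) = Y s * Y t := by
    rw [hYdef, hYdef, hYdef, neg_add, x12_add, hσ _ _ (h12 _) (h12 _)]; group
  have hY0 : Y 0 = 1 := by rw [hYdef, neg_zero, x12_zero, hσ1]; group
  have hYneg (t) : (Y t)⁻¹ = Y (-t) := by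
    rw [inv_eq_iff_mul_eq_one, ← hY, add_neg_cancel, hY0]
  have hYσ (t : A) : σ (x21 (N * t)) = Y (N * t) := by
    obtain ⟨u, hu⟩ := h2
    obtain ⟨v, hv⟩ := h3
    have e1 : N * t = 3 * (N * (((v⁻¹ : Aˣ) : A) * t)) := by
      rw [← hv, mul_left_comm, Units.mul_inv_cancel_left]
    have e2 := commutator_eq_of_central hc (a := σ (hd u⁻¹)) (a' := σ (hd u⁻¹))
      (b := σ (x21 (N * (((v⁻¹ : Aˣ) : A) * t)))) (b' := Y (N * (((v⁻¹ : Aˣ) : A) * t))) rfl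
      (by rw [hπσ _ (h21 _), hπY])
    have e3 : σ (hd u⁻¹) * Y (N * (((v⁻¹ : Aˣ) : A) * t)) * (σ (hd u⁻¹))⁻¹ =
        Y (4 * (N * (((v⁻¹ : Aˣ) : A) * t))) := by
      have f1 : π (σ (hd u⁻¹) * w) = π (w * σ (hd u)) := by
        rw [map_mul, map_mul, hw, hπσ _ (hhd _), hπσ _ (hhd _), hd_mul_ww, inv_inv]
      have f2 := conj_eq_of_central hc f1 (σ (x12 (-(N * (((v⁻¹ : Aˣ) : A) * t)))))
      have f3 : ∀ z, σ (hd u⁻¹) * (w * z * w⁻¹) * (σ (hd u⁻¹))⁻¹ =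
          (σ (hd u⁻¹) * w) * z * (σ (hd u⁻¹) * w)⁻¹ := fun z => by group
      have f4 : ∀ z, w * σ (hd u) * z * (w * σ (hd u))⁻¹ =
          w * (σ (hd u) * z * (σ (hd u))⁻¹) * w⁻¹ := fun z => by group
      rw [hYdef, f3, f2, f4, hσconj _ _ (hhd _) (h12 _), hd_conj_x12, hu, hYdef]
      congr 4
      ring
    have e4 : (hd u⁻¹ : SLtwo A) * x21 (N * (((v⁻¹ : Aˣ) : A) * t)) * (hd u⁻¹)⁻¹ =
        x21 (N * (4 * (((v⁻¹ : Aˣ) : A) * t))) := by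
      rw [hd_conj_x21, inv_inv, hu]
      congr 1
      ring
    rw [e3, hσconj _ _ (hhd _) (h21 _), e4, ← hσinv _ (h21 _), x21_inv, hYneg, ← hY,
      ← mul_neg, ← hσ _ _ (h21 _) (h21 _), ← x21_add] at e2
    rw [e1]
    convert e2 using 2 <;> [congr 1; skip] <;> ring
  have hwσ (t : A) : w * Y t * w⁻¹ = σ (x12 (-t)) := by
    have f1 : π (w * w) = π (σ (hd (-1))) := by
      rw [map_mul, hw, hπσ _ (hhd _), ← hd_mul_ww_mul_ww, hd_one, one_mul]
    have f2 := conj_eq_of_central hc f1 (σ (x12 (-t)))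
    rw [hσconj _ _ (hhd _) (h12 _), hd_conj_x12] at f2
    calc w * Y t * w⁻¹ = (w * w) * σ (x12 (-t)) * (w * w)⁻¹ := by rw [hYdef]; group
      _ = _ := by rw [f2]; simp
  -- the set of elements on which conjugation by `w` is compatible with the section
  let good : Subgroup (SLtwo A) :=
    { carrier := {g | N ∣ g.1 0 1 ∧ N ∣ g.1 1 0 ∧ w * σ g * w⁻¹ = σ (ww * g * ww⁻¹)}
      one_mem' := by simp [hσ1]
      mul_mem' := by
        rintro g h ⟨g1, g2, g3⟩ ⟨k1, k2, k3⟩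
        have e0 : ∀ g : SLtwo A, N ∣ g.1 0 1 → N ∣ (ww * g * ww⁻¹).1 1 0 := by
          intro g hg; simpa using hg
        refine ⟨?_, ?_, ?_⟩
        · rw [SLtwo.mul_01]; exact dvd_add (k1.mul_left _) (g1.mul_right _)
        · rw [SLtwo.mul_10]; exact dvd_add (g2.mul_right _) (k2.mul_left _)
        · rw [hσ _ _ g2 k2]
          calc w * (σ g * σ h) * w⁻¹ = (w * σ g * w⁻¹) * (w * σ h * w⁻¹) := by group
            _ = σ ((ww * g * ww⁻¹) * (ww * h * ww⁻¹)) := by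
              rw [g3, k3, hσ _ _ (e0 _ g1) (e0 _ k1)]
            _ = _ := by congr 1; group
      inv_mem' := by
        rintro g ⟨g1, g2, g3⟩
        refine ⟨by simpa using g1, by simpa using g2, ?_⟩
        have e0 : ww * g⁻¹ * ww⁻¹ = (ww * g * ww⁻¹)⁻¹ := by group
        rw [e0, hσinv _ g2, hσinv _ (by simpa using g1), ← g3]
        group }
  have hgood (g : SLtwo A) (hg01 : N ∣ g.1 0 1) (hg10 : N ∣ g.1 1 0) (hg11 : N ∣ g.1 1 1 - 1) :
      g ∈ good := by
    refine mem_of_congruence hN hgen hmod good ?_ ?_ ?_ hg01 hg10 hg11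
    · intro t
      refine ⟨by simp, by simp, ?_⟩
      rw [ww_conj_x12, ← mul_neg, hYσ, hYdef, mul_neg, neg_neg]
    · intro t
      refine ⟨by simp, by simp, ?_⟩
      rw [ww_conj_x21, hYσ, hwσ]
    · refine ⟨by simp, by simp, ?_⟩
      have f1 : π (w * σ (x12 1)) = π (σ (x12 (-1)) * (σ (hd (-1)) * Y 1)) := by
        rw [map_mul, map_mul, map_mul, hπσ _ (h12 _), hπσ _ (h12 _), hπσ _ (hhd _), hπY, hw]
        apply SLtwo.ext4 <;> simp
      have hYc : Y 1 * Y N * (Y 1)⁻¹ = Y N := by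
        rw [← hY, hYneg, ← hY]; congr 1; ring
      have hYN : Y N = σ (x21 (N * 1)) := by rw [hYσ, mul_one]
      have f2 : ww * (x12 1 * x21 N * x12 (-1)) * ww⁻¹ =
          x12 (-1) * x21 (N * 1) * (x12 (-1))⁻¹ := by
        apply SLtwo.ext4 <;> simp <;> ring
      have f3 : x12 1 * x21 N * x12 (-1) = x12 1 * x21 (N * 1) * (x12 1)⁻¹ := by
        rw [x12_inv, mul_one]
      have f4 : (hd (-1) : SLtwo A) * x21 (N * 1) * (hd (-1))⁻¹ = x21 (N * 1) := by
        rw [hd_conj_x21]; simp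
      rw [f2, f3, ← hσconj _ _ (h12 _) (h21 _), ← hσconj _ _ (h12 _) (h21 _), ← hYN]
      have f5 : ∀ z, w * (σ (x12 1) * z * (σ (x12 1))⁻¹) * w⁻¹ =
        (w * σ (x12 1)) * z * (w * σ (x12 1))⁻¹ := fun z => by group
      rw [f5, conj_eq_of_central hc f1]
      calc σ (x12 (-1)) * (σ (hd (-1)) * Y 1) * Y N * (σ (x12 (-1)) * (σ (hd (-1)) * Y 1))⁻¹
          = σ (x12 (-1)) * (σ (hd (-1)) * (Y 1 * Y N * (Y 1)⁻¹) * (σ (hd (-1)))⁻¹) *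
            (σ (x12 (-1)))⁻¹ := by group
        _ = _ := by rw [hYc, hYN, hσconj _ _ (hhd _) (h21 _), f4]
  let Q : Subgroup (SLtwo A) :=
    { carrier := {k | ∀ g, IsCongruent N g → ∀ e, π e = k → e * σ g * e⁻¹ = σ (k * g * k⁻¹)}
      one_mem' := by
        intro g hg e he
        rw [conj_eq_of_central hc (b := 1) (by rw [he, map_one])]
        simp
      mul_mem' := by
        intro k k' hk hk' g hg e he
        obtain ⟨f, rfl⟩ := hπ k
        obtain ⟨f', rfl⟩ := hπ k'
        rw [conj_eq_of_central hc (b := f * f') (by rw [he, map_mul])]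
        calc f * f' * σ g * (f * f')⁻¹ = f * (f' * σ g * f'⁻¹) * f⁻¹ := by group
          _ = σ (π f * (π f' * g * (π f')⁻¹) * (π f)⁻¹) := by
            rw [hk' g hg f' rfl, hk _ (hg.conj _) f rfl]
          _ = _ := by congr 1; group
      inv_mem' := by
        intro k hk g hg e he
        have h1 := hk _ (hg.conj k⁻¹) e⁻¹ (by rw [map_inv, he, inv_inv])
        have h2 : k * (k⁻¹ * g * k⁻¹⁻¹) * k⁻¹ = g := by group
        rw [h2] at h1
        rw [← h1]
        group }
  have hQ12 (t : A) : x12 t ∈ Q := by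
    intro g hg e he
    rw [conj_eq_of_central hc (b := σ (x12 t)) (by rw [he, hπσ _ (h12 _)]),
      hσconj _ _ (h12 _) hg.2.1]
  have hQw : ww ∈ Q := by
    intro g hg e he
    rw [conj_eq_of_central hc (b := w) (by rw [he, hw])]
    exact (hgood g hg.1 hg.2.1 hg.2.2).2.2
  refine (?_ : π e ∈ Q) g ⟨hg01, hg10, hg11⟩ e rfl
  refine (Subgroup.closure_le _).2 ?_ (hgen1 (π e) (one_dvd _) (one_dvd _))
  rintro _ (⟨t, rfl⟩ | ⟨t, rfl⟩)
  · exact hQ12 t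
  · have := mul_mem (mul_mem hQw (hQ12 (-t))) (inv_mem hQw)
    rw [ww_conj_x12, neg_neg] at this
    simp only [one_mul]
    exact this

end

lemma exists_lift_hd {F : Type*} [Field F] (red : A →+* F) (hred : Function.Surjective red)
    (u : Fˣ) : ∃ g : SLtwo A, slMap red g = hd u := by
  obtain ⟨a, ha⟩ := hred u
  obtain ⟨d, hd'⟩ := hred ((u⁻¹ : Fˣ) : F)
  refine ⟨x21 (-d) * mk4 a (a * d - 1) 1 d (by ring), ?_⟩
  rw [map_mul, slMap_x21]
  apply SLtwo.ext4 <;> simp [ha, hd']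

/-- A central extension of `SL₂(A)` which splits over `Γ₀(q)` splits. -/
theorem exists_section_of_section_gamma [IsDomain A] {q : ℕ} [hq : Fact q.Prime] (hq2 : q ≠ 2)
    (red : A →+* ZMod q) (hred : Function.Surjective red)
    (hker : ∀ x, red x = 0 ↔ (q : A) ∣ x) (hN : (q : A) ≠ 0) (hgen1 : HasElemGen (1 : A))
    (hgen : HasElemGen ((q : A) ^ 2)) (h2 : IsUnit (2 : A))
    (h3 : IsUnit (3 : A)) {π : E →* SLtwo A} (hπ : Function.Surjective π)
    (hc : ∀ n, π n = 1 → ∀ e : E, n * e = e * n) {σ : SLtwo A → E}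
    (hσ : ∀ g h : SLtwo A, (q : A) ∣ g.1 1 0 → (q : A) ∣ h.1 1 0 → σ (g * h) = σ g * σ h)
    (hπσ : ∀ g : SLtwo A, (q : A) ∣ g.1 1 0 → π (σ g) = g) :
    ∃ s : SLtwo A →* E, ∀ g, π (s g) = g := by
  have hmod (a : A) : ∃ k : ℕ, (q : A) ∣ a + k := by
    refine ⟨(-red a).val, ?_⟩
    rw [← hker, map_add, map_natCast, ZMod.natCast_zmod_val, add_neg_cancel]
  have hconj (e : E) (g : SLtwo A) (hg : IsCongruent (q : A) g) :
      e * σ g * e⁻¹ = σ (π e * g * (π e)⁻¹) :=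
    conj_section_of_congruence hN hgen1 hgen hmod h2 h3 hπ hc hσ hπσ e hg.1 hg.2.1 hg.2.2
  have hσ1 : σ 1 = 1 := by
    have := hσ 1 1 (by simp) (by simp)
    rw [mul_one] at this
    exact mul_eq_left.1 this.symm
  have hσinv (g : SLtwo A) (hg : (q : A) ∣ g.1 1 0) : σ g⁻¹ = (σ g)⁻¹ := by
    rw [eq_inv_iff_mul_eq_one, ← hσ _ _ (by simpa using hg) hg, inv_mul_cancel, hσ1]
  have hcong (g : SLtwo A) : IsCongruent (q : A) g ↔ slMap red g = 1 := by
    constructor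
    · rintro ⟨h1, h2, h3⟩
      rw [← hker] at h1 h2 h3
      rw [map_sub, map_one, sub_eq_zero] at h3
      have hdet := (slMap red g).det_eq
      simp [h1, h2, h3] at hdet
      apply SLtwo.ext4 <;> simp [h1, h2, h3, hdet]
    · intro h
      have e (i j : Fin 2) : red (g.1 i j) = (1 : SLtwo (ZMod q)).1 i j := by
        rw [← slMap_apply, h]
      refine ⟨?_, ?_, ?_⟩ <;> rw [← hker] <;> simp [e]
  let K : Subgroup E :=
    { carrier := {e | ∃ g, IsCongruent (q : A) g ∧ σ g = e}
      one_mem' := ⟨1, (hcong 1).2 (map_one _), hσ1⟩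
      mul_mem' := by
        rintro _ _ ⟨g, hg, rfl⟩ ⟨h, hh, rfl⟩
        refine ⟨g * h, (hcong _).2 ?_, hσ _ _ hg.2.1 hh.2.1⟩
        rw [map_mul, (hcong g).1 hg, (hcong h).1 hh, one_mul]
      inv_mem' := by
        rintro _ ⟨g, hg, rfl⟩
        refine ⟨g⁻¹, (hcong _).2 ?_, hσinv _ hg.2.1⟩
        rw [map_inv, (hcong g).1 hg, inv_one] }
  have hKmem (e : E) : e ∈ K ↔ ∃ g, IsCongruent (q : A) g ∧ σ g = e := Iff.rfl
  have hK : K.Normal := ⟨by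
    rintro _ ⟨g, hg, rfl⟩ e
    exact ⟨_, hg.conj (π e), (hconj e g hg).symm⟩⟩
  have hdep (g h : SLtwo A) (hg : (q : A) ∣ g.1 1 0) (hh : (q : A) ∣ h.1 1 0)
      (hgh : slMap red g = slMap red h) : (σ g : E ⧸ K) = σ h := by
    rw [QuotientGroup.eq]
    refine ⟨g⁻¹ * h, (hcong _).2 ?_, ?_⟩
    · rw [map_mul, map_inv, hgh, inv_mul_cancel]
    · rw [hσ _ _ (by simpa using hg) hh, hσinv _ hg]
  let πb : E ⧸ K →* SLtwo (ZMod q) := QuotientGroup.lift K ((slMap red).comp π) (by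
    rintro _ ⟨g, hg, rfl⟩
    rw [MonoidHom.mem_ker, MonoidHom.comp_apply, hπσ _ hg.2.1, (hcong g).1 hg])
  have hπb (e : E) : πb e = slMap red (π e) := rfl
  have hcb : ∀ n, πb n = 1 → ∀ e : E ⧸ K, n * e = e * n := by
    intro n hn e
    induction n using QuotientGroup.induction_on with
    | H n =>
    induction e using QuotientGroup.induction_on with
    | H e =>
    rw [hπb] at hn
    have hg := (hcong _).2 hn
    have h1 : (n : E ⧸ K) = ((n * (σ (π n))⁻¹ : E) : E ⧸ K) := by
      rw [QuotientGroup.eq]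
      refine ⟨_, ((hcong (π n)⁻¹).2 ?_), ?_⟩
      · rw [map_inv, hn, inv_one]
      · rw [hσinv _ hg.2.1]; group
    rw [h1, ← QuotientGroup.mk_mul, ← QuotientGroup.mk_mul, hc]
    rw [map_mul, map_inv, hπσ _ hg.2.1, mul_inv_cancel]
  choose γ hγ using exists_lift_hd red hred
  choose lif hlif using hred
  have hγq (u) : (q : A) ∣ (γ u).1 1 0 := by
    rw [← hker, ← slMap_apply, hγ]; simp
  have hx (t : A) : (q : A) ∣ (x12 t).1 1 0 := by simp
  have hmulq {g h : SLtwo A} (hg : (q : A) ∣ g.1 1 0) (hh : (q : A) ∣ h.1 1 0) :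
      (q : A) ∣ (g * h).1 1 0 := by
    rw [SLtwo.mul_10]; exact dvd_add (hg.mul_right _) (hh.mul_left _)
  obtain ⟨w, hw⟩ := hπ ww
  obtain ⟨sb, hsb⟩ := exists_section_zmod hq2 πb hcb (fun t => (σ (x12 (lif t)) : E ⧸ K))
    (MonoidHom.mk' (fun u => (σ (γ u) : E ⧸ K)) (fun u v => by
      rw [← QuotientGroup.mk_mul, ← hσ _ _ (hγq _) (hγq _)]
      refine hdep _ _ (hγq _) (hmulq (hγq _) (hγq _)) ?_
      rw [map_mul, hγ, hγ, hγ, hd_mul])) (w : E ⧸ K)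
    (fun s t => by
      rw [← QuotientGroup.mk_mul, ← hσ _ _ (hx _) (hx _)]
      refine hdep _ _ (hx _) (hmulq (hx _) (hx _)) ?_
      rw [map_mul, slMap_x12, slMap_x12, slMap_x12, hlif, hlif, hlif, x12_add])
    (fun t => by rw [hπb, hπσ _ (hx _), slMap_x12, hlif])
    (fun u => by
      change πb (σ (γ u) : E ⧸ K) = _
      rw [hπb, hπσ _ (hγq _), hγ])
    (by rw [hπb, hw, slMap_ww])
    (fun u t => by
      change (σ (γ u) : E ⧸ K) * (σ (x12 (lif t)) : E ⧸ K) = _ * (σ (γ u) : E ⧸ K)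
      rw [← QuotientGroup.mk_mul, ← QuotientGroup.mk_mul, ← hσ _ _ (hγq _) (hx _),
        ← hσ _ _ (hx _) (hγq _)]
      refine hdep _ _ (hmulq (hγq _) (hx _)) (hmulq (hx _) (hγq _)) ?_
      rw [map_mul, map_mul, slMap_x12, slMap_x12, hγ, hlif, hlif, ← hd_conj_x12]
      group)
  let L : Subgroup E :=
    { carrier := {e | (e : E ⧸ K) = sb (slMap red (π e))}
      one_mem' := by simp
      mul_mem' := by
        intro a b ha hb
        change ((a * b : E) : E ⧸ K) = _
        rw [QuotientGroup.mk_mul, map_mul, map_mul, map_mul]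
        exact congrArg₂ _ ha hb
      inv_mem' := by
        intro a ha
        change ((a⁻¹ : E) : E ⧸ K) = _
        rw [QuotientGroup.mk_inv, map_inv, map_inv, map_inv]
        exact congrArg _ ha }
  have hLmem (e : E) : e ∈ L ↔ (e : E ⧸ K) = sb (slMap red (π e)) := Iff.rfl
  have hbij : Function.Bijective (π.comp L.subtype) := by
    constructor
    · rw [injective_iff_map_eq_one]
      rintro ⟨e, he⟩ h1
      replace h1 : π e = 1 := h1
      apply Subtype.ext
      change e = 1
      rw [hLmem, h1, map_one, map_one, QuotientGroup.eq_one_iff, hKmem] at he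
      obtain ⟨g, hg, rfl⟩ := he
      rw [hπσ _ hg.2.1] at h1
      rw [h1, hσ1]
    · intro g
      obtain ⟨e, he⟩ := QuotientGroup.mk_surjective (sb (slMap red g))
      have h1 : slMap red (π e) = slMap red g := by rw [← hπb, he, hsb]
      have h2 : IsCongruent (q : A) (g * (π e)⁻¹) := by
        rw [hcong, map_mul, map_inv, h1, mul_inv_cancel]
      have h3 : π (σ (g * (π e)⁻¹) * e) = g := by
        rw [map_mul, hπσ _ h2.2.1, inv_mul_cancel_right]
      refine ⟨⟨σ (g * (π e)⁻¹) * e, ?_⟩, h3⟩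
      rw [hLmem, h3, ← he, QuotientGroup.mk_mul, mul_eq_right, QuotientGroup.eq_one_iff]
      exact ⟨_, h2, rfl⟩
  let f := MulEquiv.ofBijective _ hbij
  exact ⟨L.subtype.comp f.symm.toMonoidHom, fun g => f.apply_symm_apply g⟩

end CongruenceSplitting

section CentralExtensions

/-- A central extension of `Γ` by `M`, together with a set-theoretic section. -/
structure CentralExt (M Γ E : Type*) [AddCommGroup M] [Group Γ] [Group E] where
  ι : Multiplicative M →* E
  π : E →* Γ
  σ : Γ → E
  ι_injective : Function.Injective ι
  π_eq_one_iff : ∀ e, π e = 1 ↔ ∃ m, ι m = e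
  ι_comm : ∀ m e, ι m * e = e * ι m
  π_σ : ∀ g, π (σ g) = g

namespace CentralExt

variable {M Γ E Λ : Type*} [AddCommGroup M] [Group Γ] [Group E] [Group Λ] (X : CentralExt M Γ E)

lemma π_ι (m : Multiplicative M) : X.π (X.ι m) = 1 := (X.π_eq_one_iff _).2 ⟨m, rfl⟩

lemma exists_coord (e : E) : ∃ m : M, X.ι (Multiplicative.ofAdd m) * X.σ (X.π e) = e := by
  obtain ⟨m, hm⟩ := (X.π_eq_one_iff (e * (X.σ (X.π e))⁻¹)).1 (by
    rw [map_mul, map_inv, X.π_σ, mul_inv_cancel])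
  exact ⟨m.toAdd, by rw [ofAdd_toAdd, hm, inv_mul_cancel_right]⟩

/-- The coordinate in `M` of an element of the extension, relative to the section. -/
def coord (e : E) : M := (X.exists_coord e).choose

lemma ι_coord (e : E) : X.ι (Multiplicative.ofAdd (X.coord e)) * X.σ (X.π e) = e :=
  (X.exists_coord e).choose_spec

lemma coord_eq {e : E} {m : M} {g : Γ} (h : X.ι (Multiplicative.ofAdd m) * X.σ g = e) :
    X.coord e = m := by
  have h1 := X.ι_coord e
  have h2 : X.π e = g := by rw [← h, map_mul, X.π_ι, one_mul, X.π_σ]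
  rw [h2] at h1
  have h1 := h1.trans h.symm
  exact Multiplicative.ofAdd.injective (X.ι_injective (mul_right_cancel h1))

lemma coord_ι_mul (m : M) (e : E) :
    X.coord (X.ι (Multiplicative.ofAdd m) * e) = m + X.coord e := by
  refine X.coord_eq (g := X.π e) ?_
  rw [ofAdd_add, map_mul, mul_assoc, X.ι_coord]

/-- The 2-cocycle of a central extension. -/
def cocycle (g h : Γ) : M := X.coord (X.σ g * X.σ h)

lemma ι_cocycle (g h : Γ) :
    X.ι (Multiplicative.ofAdd (X.cocycle g h)) * X.σ (g * h) = X.σ g * X.σ h := by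
  have := X.ι_coord (X.σ g * X.σ h)
  rwa [map_mul, X.π_σ, X.π_σ] at this

lemma coord_mul (e e' : E) :
    X.coord (e * e') = X.coord e + X.coord e' + X.cocycle (X.π e) (X.π e') := by
  refine X.coord_eq (g := X.π e * X.π e') ?_
  rw [ofAdd_add, ofAdd_add, map_mul, map_mul, mul_assoc, X.ι_cocycle]
  conv_rhs => rw [← X.ι_coord e, ← X.ι_coord e']
  rw [mul_assoc, mul_assoc, ← mul_assoc (X.σ (X.π e)), ← X.ι_comm _ (X.σ (X.π e)), mul_assoc]

lemma coord_σ (g : Γ) : X.coord (X.σ g) = 0 := X.coord_eq (g := g) (by simp)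

lemma isTwoCocycle_cocycle : IsTwoCocycle X.cocycle := by
  intro g h k
  have h1 := X.coord_mul (X.σ g * X.σ h) (X.σ k)
  have h2 := X.coord_mul (X.σ g) (X.σ h * X.σ k)
  rw [mul_assoc, h2] at h1
  simp only [coord_σ, map_mul, X.π_σ, zero_add, add_zero] at h1
  change X.cocycle h k + _ = X.cocycle g h + _ at h1
  rw [sub_eq_zero, ← sub_eq_iff_eq_add', ← sub_eq_zero] at *
  rw [← sub_eq_zero.2 (sub_eq_zero.1 h1)]
  abel

/-- The homology pairing of a central extension. -/
def eval : H2 Γ →ₗ[ℤ] M := evalH2 X.cocycle X.isTwoCocycle_cocycle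

lemma cocycle_eq_of_lift (s : Λ →* E) (g h : Λ) : X.cocycle (X.π (s g)) (X.π (s h)) =
    -X.coord (s h) - -X.coord (s (g * h)) + -X.coord (s g) := by
  rw [map_mul, coord_mul]
  abel

lemma eval_mapH2_eq_zero (j : Λ →* Γ) (s : Λ →* E) (hs : ∀ g, X.π (s g) = j g) (x : H2 Λ) :
    X.eval (mapH2 j x) = 0 := by
  rw [eval, evalH2_mapH2]
  refine evalH2_coboundary _ (fun g => -X.coord (s g)) (fun g h => ?_) x
  rw [← hs, ← hs, X.cocycle_eq_of_lift]

lemma exists_lift (hΛ : commutator Λ = ⊤) (j : Λ →* Γ) (h0 : ∀ x, X.eval (mapH2 j x) = 0) :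
    ∃ s : Λ →* E, ∀ g, X.π (s g) = j g := by
  obtain ⟨φ, hφ⟩ := exists_primitive hΛ (X.isTwoCocycle_cocycle.comp j) (fun x => by
    rw [← evalH2_mapH2 X.isTwoCocycle_cocycle]
    exact h0 x)
  refine ⟨MonoidHom.mk' (fun g => X.ι (Multiplicative.ofAdd (-φ g)) * X.σ (j g)) ?_, fun g => ?_⟩
  · intro g h
    have h1 : -φ (g * h) = -φ g + (-φ h) + X.cocycle (j g) (j h) := by
      rw [hφ]
      abel
    rw [h1, ofAdd_add, ofAdd_add, map_mul, map_mul, map_mul, mul_assoc, X.ι_cocycle, mul_assoc,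
      mul_assoc, ← mul_assoc (X.σ (j g)), ← X.ι_comm _ (X.σ (j g)), mul_assoc]
  · change X.π (_ * _) = _
    rw [map_mul, X.π_ι, one_mul, X.π_σ]

end CentralExt

section OfCocycle

variable {M Γ : Type*} [AddCommGroup M] [Group Γ]

/-- The underlying type of the central extension attached to a 2-cocycle. -/
def CocycleExt (_f : Γ → Γ → M) : Type _ := M × Γ

variable {f : Γ → Γ → M}

lemma IsTwoCocycle.one_left (hf : IsTwoCocycle f) (g : Γ) : f 1 g = f 1 1 := by
  have := hf 1 1 g
  rw [one_mul, one_mul, sub_self, zero_add, sub_eq_zero] at this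
  exact this

lemma IsTwoCocycle.one_right (hf : IsTwoCocycle f) (g : Γ) : f g 1 = f 1 1 := by
  have := hf g 1 1
  rw [mul_one, mul_one, sub_add_cancel, sub_eq_zero] at this
  exact this.symm

/-- The group structure on the extension attached to a 2-cocycle. -/
@[reducible] def IsTwoCocycle.group (hf : IsTwoCocycle f) : Group (CocycleExt f) :=
  letI : Mul (CocycleExt f) := ⟨fun x y => (x.1 + y.1 + f x.2 y.2, x.2 * y.2)⟩
  letI : One (CocycleExt f) := ⟨(-f 1 1, 1)⟩
  letI : Inv (CocycleExt f) := ⟨fun x => (-x.1 - f x.2⁻¹ x.2 - f 1 1, x.2⁻¹)⟩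
  Group.ofLeftAxioms
    (fun x y z => Prod.ext (by
      change x.1 + y.1 + f x.2 y.2 + z.1 + f (x.2 * y.2) z.2 =
        x.1 + (y.1 + z.1 + f y.2 z.2) + f x.2 (y.2 * z.2)
      have := hf x.2 y.2 z.2
      rw [← sub_eq_zero, ← neg_eq_zero, ← this]
      abel) (mul_assoc _ _ _))
    (fun x => Prod.ext (by
      change -f 1 1 + x.1 + f 1 x.2 = x.1
      rw [hf.one_left x.2]
      abel) (one_mul _))
    (fun x => Prod.ext (by
      change -x.1 - f x.2⁻¹ x.2 - f 1 1 + x.1 + f x.2⁻¹ x.2 = -f 1 1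
      abel) (inv_mul_cancel _))

/-- Every 2-cocycle is the cocycle of a central extension. -/
lemma exists_centralExt (hf : IsTwoCocycle f) :
    ∃ (_ : Group (CocycleExt f)) (X : CentralExt M Γ (CocycleExt f)), X.cocycle = f := by
  letI := hf.group
  have hmul (x y : CocycleExt f) : x * y = (x.1 + y.1 + f x.2 y.2, x.2 * y.2) := rfl
  have hone : (1 : CocycleExt f) = (-f 1 1, 1) := rfl
  let X : CentralExt M Γ (CocycleExt f) :=
    { ι := MonoidHom.mk' (fun m => ((m.toAdd - f 1 1, 1) : M × Γ)) (fun m n => by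
        refine Prod.ext ?_ (one_mul 1).symm
        change m.toAdd + n.toAdd - f 1 1 = m.toAdd - f 1 1 + (n.toAdd - f 1 1) + f 1 1
        abel)
      π := MonoidHom.mk' (fun e => e.2) (fun _ _ => rfl)
      σ := fun g => (0, g)
      ι_injective := fun m n h => by
        have h1 := congrArg Prod.fst h
        exact sub_left_injective (b := f 1 1) h1
      π_eq_one_iff := fun e => by
        constructor
        · intro h
          refine ⟨Multiplicative.ofAdd (e.1 + f 1 1), Prod.ext ?_ h.symm⟩
          exact add_sub_cancel_right _ _
        · rintro ⟨m, rfl⟩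
          rfl
      ι_comm := fun m e => by
        refine Prod.ext ?_ ?_
        · change m.toAdd - f 1 1 + e.1 + f 1 e.2 = e.1 + (m.toAdd - f 1 1) + f e.2 1
          rw [hf.one_left e.2, hf.one_right e.2]
          abel
        · exact (one_mul _).trans (mul_one _).symm
      π_σ := fun g => rfl }
  refine ⟨inferInstance, X, ?_⟩
  funext g h
  refine X.coord_eq (g := g * h) (Prod.ext ?_ (one_mul _))
  change f g h - f 1 1 + 0 + f 1 (g * h) = 0 + 0 + f g h
  rw [hf.one_left (g * h)]
  abel

end OfCocycle

end CentralExtensions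

section NormalForms

variable {Λ E : Type*} [Group Λ] [Group E]

/-- Reduced words in two copies of `Λ` amalgamated along `Λ₀`, up to a central subgroup `Z`. The
Boolean records the copy in which the first letter lies. -/
inductive RedWord (Λ₀ : Subgroup Λ) (s : Bool → Λ →* E) (Z : Subgroup E) : Bool → E → Prop
  | single (b : Bool) (g : Λ) : g ∉ Λ₀ → RedWord Λ₀ s Z b (s b g)
  | cons (b : Bool) (g : Λ) (e : E) : g ∉ Λ₀ → RedWord Λ₀ s Z (!b) e →
      RedWord Λ₀ s Z b (s b g * e)
  | zmul (b : Bool) (z : E) (e : E) : z ∈ Z → RedWord Λ₀ s Z b e → RedWord Λ₀ s Z b (z * e)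

variable {Λ₀ : Subgroup Λ} {s : Bool → Λ →* E} {Z : Subgroup E}

/-- Elements of the amalgamated subgroup up to `Z`, or reduced words. -/
def HasNormalForm (Λ₀ : Subgroup Λ) (s : Bool → Λ →* E) (Z : Subgroup E) (e : E) : Prop :=
  (∃ z ∈ Z, ∃ γ ∈ Λ₀, e = z * s true γ) ∨ ∃ b, RedWord Λ₀ s Z b e

section

variable (hZ : ∀ z ∈ Z, ∀ e, z * e = e * z)
  (hex : ∀ b, ∀ γ ∈ Λ₀, ∃ γ' ∈ Λ₀, ∃ z ∈ Z, s b γ = z * s (!b) γ')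

include hZ in
lemma HasNormalForm.zmul {e z : E} (hz : z ∈ Z) (h : HasNormalForm Λ₀ s Z e) :
    HasNormalForm Λ₀ s Z (z * e) := by
  rcases h with ⟨z', hz', γ, hγ, rfl⟩ | ⟨b, hb⟩
  · exact Or.inl ⟨z * z', mul_mem hz hz', γ, hγ, (mul_assoc _ _ _).symm⟩
  · exact Or.inr ⟨b, .zmul b z e hz hb⟩

include hZ hex in
lemma RedWord.absorb {b : Bool} {e : E} (h : RedWord Λ₀ s Z b e) :
    ∀ (c : Bool) (γ : Λ), γ ∈ Λ₀ → RedWord Λ₀ s Z b (s c γ * e) := by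
  have hmem {g γ : Λ} (hγ : γ ∈ Λ₀) (hg : g ∉ Λ₀) : γ * g ∉ Λ₀ := fun h =>
    hg ((Subgroup.mul_mem_cancel_left _ hγ).1 h)
  induction h with
  | single b g hg =>
    intro c γ hγ
    by_cases hcb : c = b
    · subst hcb
      rw [← map_mul]
      exact .single _ _ (hmem hγ hg)
    · obtain rfl : b = !c := by cases b <;> cases c <;> simp_all
      obtain ⟨γ', hγ', z, hz, h⟩ := hex c γ hγ
      rw [h, mul_assoc, ← map_mul]
      exact .zmul _ _ _ hz (.single _ _ (hmem hγ' hg))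
  | cons b g e hg he _ =>
    intro c γ hγ
    by_cases hcb : c = b
    · subst hcb
      rw [← mul_assoc, ← map_mul]
      exact .cons _ _ _ (hmem hγ hg) he
    · obtain rfl : b = !c := by cases b <;> cases c <;> simp_all
      obtain ⟨γ', hγ', z, hz, h⟩ := hex c γ hγ
      rw [h, mul_assoc, ← mul_assoc, ← mul_assoc, mul_assoc z, ← map_mul, mul_assoc]
      exact .zmul _ _ _ hz (.cons _ _ _ (hmem hγ' hg) he)
  | zmul b z e hz _ ih =>
    intro c γ hγ
    rw [← mul_assoc, ← hZ z hz, mul_assoc]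
    exact .zmul _ _ _ hz (ih c γ hγ)

include hex in
lemma HasNormalForm.letter (b : Bool) (g : Λ) : HasNormalForm Λ₀ s Z (s b g) := by
  by_cases hg : g ∈ Λ₀
  · cases b with
    | true => exact Or.inl ⟨1, one_mem _, g, hg, (one_mul _).symm⟩
    | false =>
      obtain ⟨γ', hγ', z, hz, h⟩ := hex false g hg
      exact Or.inl ⟨z, hz, γ', hγ', h⟩
  · exact Or.inr ⟨b, .single b g hg⟩

include hZ hex in
lemma RedWord.letter_mul {c : Bool} {e : E} (h : RedWord Λ₀ s Z c e) :
    ∀ (b : Bool) (g : Λ), HasNormalForm Λ₀ s Z (s b g * e) := by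
  induction h with
  | single c g' hg' =>
    intro b g
    by_cases hbc : b = c
    · subst hbc
      rw [← map_mul]
      exact .letter hex _ _
    · obtain rfl : c = !b := by cases b <;> cases c <;> simp_all
      by_cases hg : g ∈ Λ₀
      · exact Or.inr ⟨_, (RedWord.single _ _ hg').absorb hZ hex b g hg⟩
      · exact Or.inr ⟨b, .cons b g _ hg (.single _ _ hg')⟩
  | cons c g' e hg' he _ =>
    intro b g
    by_cases hbc : b = c
    · subst hbc
      rw [← mul_assoc, ← map_mul]
      by_cases hg : g * g' ∈ Λ₀
      · exact Or.inr ⟨_, he.absorb hZ hex _ _ hg⟩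
      · exact Or.inr ⟨_, .cons _ _ _ hg he⟩
    · obtain rfl : c = !b := by cases b <;> cases c <;> simp_all
      by_cases hg : g ∈ Λ₀
      · exact Or.inr ⟨_, (RedWord.cons _ _ _ hg' he).absorb hZ hex b g hg⟩
      · exact Or.inr ⟨b, .cons b g _ hg (.cons _ _ _ hg' he)⟩
  | zmul c z e hz _ ih =>
    intro b g
    rw [← mul_assoc, ← hZ z hz, mul_assoc]
    exact (ih b g).zmul hZ hz

include hZ hex in
/-- Every element of the group generated by the two copies has a normal form. -/
lemma hasNormalForm_of_mem_closure {e : E}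
    (he : e ∈ Subgroup.closure (Set.range (s true) ∪ Set.range (s false))) :
    HasNormalForm Λ₀ s Z e := by
  have hmul (b : Bool) (g : Λ) (e : E) (h : HasNormalForm Λ₀ s Z e) :
      HasNormalForm Λ₀ s Z (s b g * e) := by
    rcases h with ⟨z, hz, γ, hγ, rfl⟩ | ⟨c, hc⟩
    · rw [← mul_assoc, ← hZ z hz, mul_assoc]
      refine HasNormalForm.zmul hZ hz ?_
      cases b with
      | true =>
        rw [← map_mul]
        exact .letter hex _ _
      | false =>
        obtain ⟨γ', hγ', z', hz', h⟩ := hex true γ hγ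
        rw [h, ← mul_assoc, ← hZ z' hz', mul_assoc]
        refine HasNormalForm.zmul hZ hz' ?_
        change HasNormalForm Λ₀ s Z (s false g * s false γ')
        rw [← map_mul]
        exact .letter hex _ _
    · exact hc.letter_mul hZ hex b g
  induction he using Subgroup.closure_induction_left with
  | one => exact Or.inl ⟨1, one_mem _, 1, one_mem _, by simp⟩
  | mul_left x hx y _ ih =>
    rcases hx with ⟨g, rfl⟩ | ⟨g, rfl⟩ <;> exact hmul _ _ _ ih
  | inv_mul_cancel x hx y _ ih =>
    rcases hx with ⟨g, rfl⟩ | ⟨g, rfl⟩ <;> rw [← map_inv] <;> exact hmul _ _ _ ih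

end

end NormalForms

section RowNorms

variable {T : Set ℕ} (q : ℕ) [hq : Fact q.Prime]

/-- The larger of the `q`-adic norms of two elements. -/
def rowNorm (x y : ZS T) : ℚ := max (padicNorm q x) (padicNorm q y)

variable {q}

lemma rowNorm_comb_le {c d x₁ y₁ x₂ y₂ : ZS T} {m : ℚ} (h1 : padicNorm q c * rowNorm q x₁ y₁ ≤ m)
    (h2 : padicNorm q d * rowNorm q x₂ y₂ ≤ m) :
    rowNorm q (c * x₁ + d * x₂) (c * y₁ + d * y₂) ≤ m := by
  have key (x y : ZS T) (hx : padicNorm q x ≤ rowNorm q x₁ y₁)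
      (hy : padicNorm q y ≤ rowNorm q x₂ y₂) : padicNorm q ((c * x + d * y : ZS T) : ℚ) ≤ m := by
    push_cast
    refine padicNorm.nonarchimedean.trans (max_le ?_ ?_)
    · rw [padicNorm.mul]
      exact (mul_le_mul_of_nonneg_left hx (padicNorm.nonneg _)).trans h1
    · rw [padicNorm.mul]
      exact (mul_le_mul_of_nonneg_left hy (padicNorm.nonneg _)).trans h2
  exact max_le (key _ _ (le_max_left _ _) (le_max_left _ _))
    (key _ _ (le_max_right _ _) (le_max_right _ _))

lemma le_rowNorm_comb {c d x₁ y₁ x₂ y₂ : ZS T}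
    (h : padicNorm q d * rowNorm q x₂ y₂ < padicNorm q c * rowNorm q x₁ y₁) :
    padicNorm q c * rowNorm q x₁ y₁ ≤ rowNorm q (c * x₁ + d * x₂) (c * y₁ + d * y₂) := by
  have key (x y : ZS T) (hx : padicNorm q x = rowNorm q x₁ y₁)
      (hy : padicNorm q y ≤ rowNorm q x₂ y₂) :
      padicNorm q c * rowNorm q x₁ y₁ = padicNorm q ((c * x + d * y : ZS T) : ℚ) := by
    have h1 : padicNorm q (d * y) < padicNorm q (c * x) := by
      rw [padicNorm.mul, padicNorm.mul, hx]
      exact (mul_le_mul_of_nonneg_left hy (padicNorm.nonneg _)).trans_lt h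
    push_cast
    rw [padicNorm.add_eq_max_of_ne h1.ne', max_eq_left h1.le, padicNorm.mul, hx]
  rcases le_total (padicNorm q x₁) (padicNorm q y₁) with h1 | h1
  · rw [key y₁ y₂ (max_eq_right h1).symm (le_max_right _ _)]
    exact le_max_right _ _
  · rw [key x₁ x₂ (max_eq_left h1).symm (le_max_left _ _)]
    exact le_max_left _ _

lemma rowNorm_nonneg (x y : ZS T) : 0 ≤ rowNorm q x y :=
  (padicNorm.nonneg _).trans (le_max_left _ _)

end RowNorms

/-- Conjugation by the antidiagonal matrix with entries `x`, `-1` (up to scalars). -/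
def atkin {R : Type*} [CommRing R] (x y : R) (h : x * y = 1) : SLtwo R →* SLtwo R :=
  MonoidHom.mk' (fun g => mk4 (g.1 1 1) (-(y * g.1 1 0)) (-(x * g.1 0 1)) (g.1 0 0) (by
    have := g.det_eq
    linear_combination this - h * g.1 0 1 * g.1 1 0)) (by
  intro g k
  apply SLtwo.ext4 <;> simp
  · linear_combination -g.1 1 0 * k.1 0 1 * h
  · ring
  · ring
  · linear_combination -g.1 0 1 * k.1 1 0 * h)

section Atkin

variable {R : Type*} [CommRing R] (x y : R) (h : x * y = 1) (g : SLtwo R)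

@[simp] lemma atkin_00 : (atkin x y h g).1 0 0 = g.1 1 1 := rfl
@[simp] lemma atkin_01 : (atkin x y h g).1 0 1 = -(y * g.1 1 0) := rfl
@[simp] lemma atkin_10 : (atkin x y h g).1 1 0 = -(x * g.1 0 1) := rfl
@[simp] lemma atkin_11 : (atkin x y h g).1 1 1 = g.1 0 0 := rfl

lemma atkin_atkin : atkin x y h (atkin x y h g) = g := by
  apply SLtwo.ext4 <;> simp
  · linear_combination g.1 0 1 * h
  · linear_combination g.1 1 0 * h

end Atkin

section PingPong

variable {S T : Set ℕ}

lemma padicNorm_ZS_le_one (hS : ∀ p ∈ S, p.Prime) {q : ℕ} [hq : Fact q.Prime] (hqS : q ∉ S)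
    (x : ZS S) : padicNorm q x ≤ 1 := by
  have h1 : padicNorm q ((x : ℚ).den : ℚ) = 1 := by
    rw [padicNorm.nat_eq_one_iff]
    exact fun h => hqS (mem_of_dvd_den hS x.2 q hq.out h)
  rw [← Rat.num_div_den (x : ℚ), padicNorm.div, h1, div_one]
  exact padicNorm.of_int _

lemma padicNorm_ZS_eq_one (hS : ∀ p ∈ S, p.Prime) {q : ℕ} [hq : Fact q.Prime] (hqS : q ∉ S)
    {x : ZS S} (hx : ¬ (q : ZS S) ∣ x) : padicNorm q x = 1 := by
  have h1 : padicNorm q ((x : ℚ).den : ℚ) = 1 := by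
    rw [padicNorm.nat_eq_one_iff]
    exact fun h => hqS (mem_of_dvd_den hS x.2 q hq.out h)
  rw [← Rat.num_div_den (x : ℚ), padicNorm.div, h1, div_one, padicNorm.int_eq_one_iff]
  intro h
  apply hx
  rw [← redZS_eq_zero_iff hS q hqS]
  change ((x : ℚ) : ZMod q) = 0
  rw [Rat.cast_def, (ZMod.intCast_zmod_eq_zero_iff_dvd _ _).2 h, zero_div]

/-- The inverse of `q` in `ℤ_T`. -/
def qinv {q : ℕ} (hqT : q ∈ T) : ZS T := ⟨(q : ℚ)⁻¹, inv_mem_ZS hqT⟩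

lemma q_mul_qinv {q : ℕ} [hq : Fact q.Prime] (hqT : q ∈ T) : (q : ZS T) * qinv hqT = 1 := by
  apply Subtype.ext
  change (q : ℚ) * (q : ℚ)⁻¹ = 1
  exact mul_inv_cancel₀ (Nat.cast_ne_zero.2 hq.out.ne_zero)

/-- The inclusion `ℤ_S → ℤ_T`. -/
abbrev inclZS (hST : S ⊆ T) : ZS S →+* ZS T := Subring.inclusion (ZS_mono hST)

/-- The group `Γ₀(q)` in `SL₂(ℤ_S)`. -/
def gammaZero (S : Set ℕ) (q : ℕ) : Subgroup (SLtwo (ZS S)) where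
  carrier := {g | (q : ZS S) ∣ g.1 1 0}
  one_mem' := by simp
  mul_mem' := by
    intro a b ha hb
    change (q : ZS S) ∣ _
    rw [SLtwo.mul_10]
    exact dvd_add (Dvd.dvd.mul_right ha _) (Dvd.dvd.mul_left hb _)
  inv_mem' := by
    intro a ha
    change (q : ZS S) ∣ _
    rw [SLtwo.inv_10]
    exact (dvd_neg).2 ha

lemma mem_gammaZero {q : ℕ} {g : SLtwo (ZS S)} :
    g ∈ gammaZero S q ↔ (q : ZS S) ∣ g.1 1 0 := Iff.rfl

variable {q : ℕ} [hq : Fact q.Prime] (hST : S ⊆ T) (hqT : q ∈ T)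

/-- The two embeddings of `SL₂(ℤ_S)` into `SL₂(ℤ_T)` for `q ∈ T`, exchanged by the matrix of
determinant `q`. -/
def embZS : Bool → SLtwo (ZS S) →* SLtwo (ZS T)
  | true => slMap (inclZS hST)
  | false => (atkin (q : ZS T) (qinv hqT) (q_mul_qinv hqT)).comp (slMap (inclZS hST))

lemma embZS_true : embZS hST hqT true = slMap (inclZS hST) := rfl
lemma embZS_false (g : SLtwo (ZS S)) : embZS hST hqT false g =
    atkin (q : ZS T) (qinv hqT) (q_mul_qinv hqT) (slMap (inclZS hST) g) := rfl


lemma coe_inclZS (x : ZS S) : ((inclZS hST x : ZS T) : ℚ) = (x : ℚ) :=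
  Subring.coe_inclusion (ZS_mono hST) x

lemma inclZS_injective : Function.Injective (inclZS hST) := Subring.inclusion_injective _

lemma embZS_injective (b : Bool) : Function.Injective (embZS hST hqT b) := by
  have h := slMap_injective _ (inclZS_injective hST)
  cases b with
  | true => exact h
  | false =>
    intro g k hgk
    rw [embZS_false, embZS_false] at hgk
    have := congrArg (atkin (q : ZS T) (qinv hqT) (q_mul_qinv hqT)) hgk
    rw [atkin_atkin, atkin_atkin] at this
    exact h this

lemma exists_embZS_eq {g : SLtwo (ZS S)} (hg : g ∈ gammaZero S q) :
    ∃ γ ∈ gammaZero S q, γ.1 1 1 = g.1 0 0 ∧ ∀ b, embZS hST hqT b g = embZS hST hqT (!b) γ := by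
  obtain ⟨c, hc⟩ := hg
  have hq1 := q_mul_qinv hqT
  let γ : SLtwo (ZS S) := mk4 (g.1 1 1) (-c) (-(q * g.1 0 1)) (g.1 0 0) (by
    have := g.det_eq
    rw [hc] at this
    linear_combination this)
  have key : atkin (q : ZS T) (qinv hqT) (q_mul_qinv hqT) (slMap (inclZS hST) g) =
      slMap (inclZS hST) γ := by
    apply SLtwo.ext4 <;> simp [γ, hc]
    linear_combination inclZS hST c * hq1
  refine ⟨γ, ?_, mk4_11 _ _ _ _ _, fun b => ?_⟩
  · rw [mem_gammaZero, mk4_10]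
    exact (dvd_neg).2 (dvd_mul_right _ _)
  · cases b with
    | true =>
      rw [Bool.not_true, embZS_false, ← key, atkin_atkin, embZS_true]
    | false => rw [embZS_false, key, Bool.not_false, embZS_true]

/-- The ping-pong invariant of reduced words. -/
def RowInv (q : ℕ) : Bool → SLtwo (ZS T) → Prop
  | true, g => rowNorm q (g.1 0 0) (g.1 0 1) ≤ rowNorm q (g.1 1 0) (g.1 1 1) ∧
      1 ≤ rowNorm q (g.1 1 0) (g.1 1 1) ∧ g ≠ 1
  | false, g => rowNorm q (g.1 1 0) (g.1 1 1) < rowNorm q (g.1 0 0) (g.1 0 1) ∧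
      1 < rowNorm q (g.1 0 0) (g.1 0 1)

lemma rowNorm_zero_one : rowNorm q (0 : ZS T) 1 = 1 := by simp [rowNorm]
lemma rowNorm_one_zero : rowNorm q (1 : ZS T) 0 = 1 := by simp [rowNorm]

lemma RowInv.ne_one {b : Bool} {g : SLtwo (ZS T)} (h : RowInv q b g) : g ≠ 1 := by
  cases b with
  | true => exact h.2.2
  | false =>
    rintro rfl
    have := h.2
    simp [rowNorm_one_zero] at this

include hq in
lemma one_lt_q : (1 : ℚ) < q := by exact_mod_cast hq.out.one_lt

lemma padicNorm_neg_qinv_mul (x : ZS T) :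
    padicNorm q ((-(qinv hqT * x) : ZS T) : ℚ) = q * padicNorm q (x : ℚ) := by
  have h1 : ((qinv hqT : ZS T) : ℚ) = (q : ℚ)⁻¹ := rfl
  rw [Subring.coe_neg, Subring.coe_mul, padicNorm.neg, padicNorm.mul, h1, ← one_div,
    padicNorm.div, padicNorm.one, padicNorm.padicNorm_p_of_prime, one_div, inv_inv]

lemma padicNorm_neg_q_mul_le {x : ZS T} (hx : padicNorm q (x : ℚ) ≤ 1) :
    padicNorm q ((-((q : ZS T) * x) : ZS T) : ℚ) ≤ 1 := by
  rw [Subring.coe_neg, Subring.coe_mul, padicNorm.neg, padicNorm.mul, Subring.coe_natCast,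
    padicNorm.padicNorm_p_of_prime]
  exact mul_le_one₀ (inv_le_one_of_one_le₀ one_lt_q.le) (padicNorm.nonneg _) hx

lemma RowInv.cons (hS : ∀ p ∈ S, p.Prime) (hqS : q ∉ S) {b : Bool} {g : SLtwo (ZS S)}
    (hg : g ∉ gammaZero S q) {x : SLtwo (ZS T)} (hx : RowInv q (!b) x) :
    RowInv q b (embZS hST hqT b g * x) := by
  have hv (i j) : padicNorm q (g.1 i j : ℚ) ≤ 1 := padicNorm_ZS_le_one hS hqS _
  have hc : padicNorm q (g.1 1 0 : ℚ) = 1 := padicNorm_ZS_eq_one hS hqS hg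
  have hv' (i j) : padicNorm q ((inclZS hST (g.1 i j) : ZS T) : ℚ) ≤ 1 := by
    rw [coe_inclZS]
    exact hv i j
  have hc' : padicNorm q ((inclZS hST (g.1 1 0) : ZS T) : ℚ) = 1 := by
    rw [coe_inclZS]
    exact hc
  have hq1 := one_lt_q (q := q)
  have hn1 := rowNorm_nonneg (q := q) (x.1 0 0) (x.1 0 1)
  have hn2 := rowNorm_nonneg (q := q) (x.1 1 0) (x.1 1 1)
  have hle {a : ℚ} (ha : a ≤ 1) {m : ℚ} (hm : 0 ≤ m) : a * m ≤ m := mul_le_of_le_one_left hm ha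
  cases b with
  | true =>
    obtain ⟨h1, h2⟩ := hx
    have h3 : rowNorm q (x.1 0 0) (x.1 0 1) ≤
        rowNorm q ((embZS hST hqT true g * x).1 1 0) ((embZS hST hqT true g * x).1 1 1) := by
      rw [SLtwo.mul_10, SLtwo.mul_11, embZS_true, slMap_apply, slMap_apply]
      have := le_rowNorm_comb (q := q) (c := inclZS hST (g.1 1 0)) (d := inclZS hST (g.1 1 1))
        (x₁ := x.1 0 0) (y₁ := x.1 0 1) (x₂ := x.1 1 0) (y₂ := x.1 1 1) (by
          rw [hc', one_mul]
          exact (hle (hv' _ _) hn2).trans_lt h1)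
      rwa [hc', one_mul] at this
    have h4 := h2.trans_le h3
    refine ⟨?_, h4.le, fun h => ?_⟩
    · refine le_trans ?_ h3
      rw [SLtwo.mul_00, SLtwo.mul_01, embZS_true, slMap_apply, slMap_apply]
      exact rowNorm_comb_le (hle (hv' _ _) hn1) ((hle (hv' _ _) hn2).trans h1.le)
    · rw [h] at h4
      simp [rowNorm_zero_one] at h4
  | false =>
    obtain ⟨h1, h2, -⟩ := hx
    have hcq : padicNorm q ((-(qinv hqT * inclZS hST (g.1 1 0)) : ZS T) : ℚ) = q := by
      rw [padicNorm_neg_qinv_mul, hc', mul_one]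
    have hbq : padicNorm q ((-((q : ZS T) * inclZS hST (g.1 0 1)) : ZS T) : ℚ) ≤ 1 :=
      padicNorm_neg_q_mul_le (hv' _ _)
    have h3 : (q : ℚ) * rowNorm q (x.1 1 0) (x.1 1 1) ≤
        rowNorm q ((embZS hST hqT false g * x).1 0 0) ((embZS hST hqT false g * x).1 0 1) := by
      rw [SLtwo.mul_00, SLtwo.mul_01, embZS_false, atkin_00, atkin_01, slMap_apply, slMap_apply,
        add_comm, add_comm (_ * x.1 0 1)]
      have := le_rowNorm_comb (q := q) (c := -(qinv hqT * inclZS hST (g.1 1 0)))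
        (d := inclZS hST (g.1 1 1))
        (x₁ := x.1 1 0) (y₁ := x.1 1 1) (x₂ := x.1 0 0) (y₂ := x.1 0 1) (by
          rw [hcq]
          refine (hle (hv' _ _) hn1).trans_lt ?_
          nlinarith)
      rwa [hcq] at this
    refine ⟨?_, ?_⟩
    · have h4 : rowNorm q ((embZS hST hqT false g * x).1 1 0)
          ((embZS hST hqT false g * x).1 1 1) ≤ rowNorm q (x.1 1 0) (x.1 1 1) := by
        rw [SLtwo.mul_10, SLtwo.mul_11, embZS_false, atkin_10, atkin_11, slMap_apply, slMap_apply]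
        exact rowNorm_comb_le ((hle hbq hn1).trans h1) (hle (hv' _ _) hn2)
      refine h4.trans_lt (lt_of_lt_of_le ?_ h3)
      nlinarith
    · refine lt_of_lt_of_le ?_ h3
      nlinarith

lemma rowInv_embZS (hS : ∀ p ∈ S, p.Prime) (hqS : q ∉ S) (b : Bool) {g : SLtwo (ZS S)}
    (hg : g ∉ gammaZero S q) : RowInv q b (embZS hST hqT b g) := by
  have hv' (i j) : padicNorm q ((inclZS hST (g.1 i j) : ZS T) : ℚ) ≤ 1 := by
    rw [coe_inclZS]
    exact padicNorm_ZS_le_one hS hqS (g.1 i j)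
  have hc' : padicNorm q ((inclZS hST (g.1 1 0) : ZS T) : ℚ) = 1 := by
    rw [coe_inclZS]
    exact padicNorm_ZS_eq_one hS hqS hg
  have hq1 := one_lt_q (q := q)
  cases b with
  | true =>
    have h1 : 1 ≤ rowNorm q ((embZS hST hqT true g).1 1 0) ((embZS hST hqT true g).1 1 1) := by
      rw [embZS_true, slMap_apply]
      exact hc'.ge.trans (le_max_left _ _)
    refine ⟨le_trans ?_ h1, h1, fun h => hg ?_⟩
    · rw [embZS_true, slMap_apply, slMap_apply]
      exact max_le (hv' _ _) (hv' _ _)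
    · rw [embZS_injective hST hqT true (h.trans (map_one _).symm)]
      exact one_mem _
  | false =>
    have h1 : (q : ℚ) ≤ rowNorm q ((embZS hST hqT false g).1 0 0)
        ((embZS hST hqT false g).1 0 1) := by
      refine le_trans ?_ (le_max_right _ _)
      rw [embZS_false, atkin_01, slMap_apply, padicNorm_neg_qinv_mul, hc', mul_one]
    refine ⟨lt_of_le_of_lt ?_ (hq1.trans_le h1), hq1.trans_le h1⟩
    rw [embZS_false, atkin_10, atkin_11, slMap_apply, slMap_apply]
    exact max_le (padicNorm_neg_q_mul_le (hv' _ _)) (hv' _ _)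

variable {E : Type*} [Group E]

/-- The group generated by lifts of the two copies of `SL₂(ℤ_S)` meets the kernel only in the
obvious part. -/
theorem mem_of_mem_closure_of_map_eq_one (hS : ∀ p ∈ S, p.Prime) (hqS : q ∉ S)
    {s : Bool → SLtwo (ZS S) →* E} {Z : Subgroup E} {π : E →* SLtwo (ZS T)}
    (hπs : ∀ b g, π (s b g) = embZS hST hqT b g)
    (hZ : ∀ z ∈ Z, ∀ e, z * e = e * z) (hZπ : ∀ z ∈ Z, π z = 1)
    (hex : ∀ b, ∀ γ ∈ gammaZero S q, ∃ γ' ∈ gammaZero S q, ∃ z ∈ Z, s b γ = z * s (!b) γ')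
    {e : E} (he : e ∈ Subgroup.closure (Set.range (s true) ∪ Set.range (s false)))
    (h1 : π e = 1) : e ∈ Z := by
  rcases hasNormalForm_of_mem_closure hZ hex he with ⟨z, hz, γ, -, rfl⟩ | ⟨b, hb⟩
  · rw [map_mul, hZπ z hz, one_mul, hπs] at h1
    rw [embZS_injective hST hqT true (h1.trans (map_one _).symm), map_one, mul_one]
    exact hz
  · have key : RowInv q b (π e) := by
      clear he h1
      induction hb with
      | single b g hg =>
        rw [hπs]
        exact rowInv_embZS hST hqT hS hqS b hg
      | cons b g e hg _ ih =>
        rw [map_mul, hπs]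
        exact ih.cons hST hqT hS hqS hg
      | zmul b z e hz _ ih => rwa [map_mul, hZπ z hz, one_mul]
    exact absurd h1 key.ne_one

end PingPong

section Gluing

variable {S T : Set ℕ} {q : ℕ} [hq : Fact q.Prime]

lemma exists_pow_mul_mem (hT : T = insert q S) {x : ℚ} (hx : x ∈ ZS T) :
    ∃ k : ℕ, (q : ℚ) ^ k * x ∈ ZS S := by
  have hqm (k : ℕ) : (q : ℚ) ^ k ∈ ZS S := pow_mem (natCast_mem _ _) _
  refine Subring.closure_induction (p := fun x _ => ∃ k : ℕ, (q : ℚ) ^ k * x ∈ ZS S)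
    ?_ ?_ ?_ ?_ ?_ ?_ hx
  · rintro _ ⟨p, hp, rfl⟩
    rw [hT] at hp
    rcases hp with rfl | hp
    · refine ⟨1, ?_⟩
      rw [pow_one, mul_inv_cancel₀ (Nat.cast_ne_zero.2 hq.out.ne_zero)]
      exact one_mem _
    · exact ⟨0, by simpa using inv_mem_ZS hp⟩
  · exact ⟨0, by simp⟩
  · exact ⟨0, by simp⟩
  · rintro x y _ _ ⟨k, hk⟩ ⟨l, hl⟩
    refine ⟨k + l, ?_⟩
    have := add_mem (mul_mem (hqm l) hk) (mul_mem (hqm k) hl)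
    convert this using 1
    ring
  · rintro x _ ⟨k, hk⟩
    exact ⟨k, by simpa using neg_mem hk⟩
  · rintro x y _ _ ⟨k, hk⟩ ⟨l, hl⟩
    refine ⟨k + l, ?_⟩
    have := mul_mem hk hl
    convert this using 1
    ring

lemma hd_pow {R : Type*} [CommRing R] (u : Rˣ) (k : ℕ) : hd (u ^ k) = hd u ^ k := by
  induction k with
  | zero => rw [pow_zero, pow_zero, hd_one]
  | succ n ih => rw [pow_succ, pow_succ, hd_mul, ih]

variable (hST : S ⊆ T) (hqT : q ∈ T)

/-- The two copies of `SL₂(ℤ_S)` generate `SL₂(ℤ[1/q]_S)`. -/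
lemma closure_range_embZS (hTp : ∀ p ∈ T, p.Prime) (h2 : 2 ∈ T) (hT : T = insert q S) :
    Subgroup.closure (Set.range (embZS hST hqT true) ∪ Set.range (embZS hST hqT false)) = ⊤ := by
  set H := Subgroup.closure (Set.range (embZS hST hqT true) ∪ Set.range (embZS hST hqT false))
    with hH
  have ht (g) : slMap (inclZS hST) g ∈ H := Subgroup.subset_closure (Or.inl ⟨g, rfl⟩)
  have hf (g) : embZS hST hqT false g ∈ H := Subgroup.subset_closure (Or.inr ⟨g, rfl⟩)
  let u : (ZS T)ˣ := ⟨qinv hqT, q, by rw [mul_comm, q_mul_qinv], q_mul_qinv hqT⟩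
  have hw : (ww : SLtwo (ZS T)) ∈ H := by
    rw [← slMap_ww (inclZS hST)]
    exact ht _
  have hu : hd u ∈ H := by
    have h1 : hd u = embZS hST hqT false ww * ww⁻¹ := by
      apply SLtwo.ext4 <;> simp [embZS_false, u]
    rw [h1]
    exact mul_mem (hf _) (inv_mem hw)
  have h12 (t : ZS T) : x12 t ∈ H := by
    obtain ⟨k, hk⟩ := exists_pow_mul_mem hT t.2
    have hk2 : (q : ℚ) ^ (2 * k) * t ∈ ZS S := by
      have := mul_mem (pow_mem (natCast_mem (ZS S) q) k) hk
      convert this using 1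
      ring
    have h1 : inclZS hST ⟨_, hk2⟩ = (q : ZS T) ^ (2 * k) * t := by
      apply Subtype.ext
      rfl
    have h2 := hd_conj_x12 ((q : ZS T) ^ (2 * k) * t) (u ^ k)
    have h3 : ((u ^ k : (ZS T)ˣ) : ZS T) ^ 2 * ((q : ZS T) ^ (2 * k) * t) = t := by
      have h4 : (qinv hqT * (q : ZS T)) ^ (2 * k) = 1 := by
        rw [mul_comm, q_mul_qinv, one_pow]
      have h5 : ((u ^ k : (ZS T)ˣ) : ZS T) = qinv hqT ^ k := rfl
      rw [h5, ← pow_mul, mul_comm k 2, ← mul_assoc, ← mul_pow, h4, one_mul]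
    rw [h3, ← h1, ← slMap_x12] at h2
    have h6 : hd (u ^ k) ∈ H := by
      rw [hd_pow]
      exact pow_mem hu _
    rw [← h2]
    exact mul_mem (mul_mem h6 (ht _)) (inv_mem h6)
  rw [eq_top_iff]
  intro g _
  have hgen : HasElemGen ((1 : ℕ) : ZS T) :=
    hasElemGen_ZS hTp h2 (fun p hp h => absurd (Nat.dvd_one.1 h) hp.ne_one)
  have hg : g ∈ elemN ((1 : ℕ) : ZS T) := hgen g (by simp) (by simp)
  refine (Subgroup.closure_le _).2 ?_ hg
  rintro _ (⟨t, rfl⟩ | ⟨t, rfl⟩)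
  · exact h12 t
  · have := ww_conj_x12 (-t)
    rw [neg_neg] at this
    simp only [Nat.cast_one, one_mul]
    rw [← this]
    exact mul_mem (mul_mem hw (h12 _)) (inv_mem hw)

lemma commutator_ZS (hS : ∀ p ∈ S, p.Prime) (h2 : 2 ∈ S) (h3 : 3 ∈ S) :
    commutator (SLtwo (ZS S)) = ⊤ := by
  have hgen : HasElemGen ((1 : ℕ) : ZS S) :=
    hasElemGen_ZS hS h2 (fun p hp h => absurd (Nat.dvd_one.1 h) hp.ne_one)
  rw [Nat.cast_one] at hgen
  exact commutator_eq_top_of_elemGen hgen (by exact_mod_cast isUnit_natCast_ZS h2 two_ne_zero)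
    (by exact_mod_cast isUnit_natCast_ZS h3 three_ne_zero)

/-- The lower right entry modulo `q`, as a character of `Γ₀(q)`. -/
def chiZS (hS : ∀ p ∈ S, p.Prime) (hqS : q ∉ S) : gammaZero S q →* (ZMod q)ˣ :=
  MonoidHom.toHomUnits
    { toFun := fun g => redZS hS q hqS (g.1.1 1 1)
      map_one' := by
        rw [OneMemClass.coe_one, SLtwo.one_11, map_one]
      map_mul' := fun g h => by
        rw [Subgroup.coe_mul, SLtwo.mul_11, map_add, map_mul, map_mul,
          (redZS_eq_zero_iff hS q hqS _).2 g.2, zero_mul, zero_add] }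

lemma coe_chiZS (hS : ∀ p ∈ S, p.Prime) (hqS : q ∉ S) (g : gammaZero S q) :
    (chiZS hS hqS g : ZMod q) = redZS hS q hqS (g.1.1 1 1) := rfl

lemma chiZS_eq_one_iff (hS : ∀ p ∈ S, p.Prime) (hqS : q ∉ S) (g : gammaZero S q) :
    chiZS hS hqS g = 1 ↔ (q : ZS S) ∣ g.1.1 1 1 - 1 := by
  rw [← redZS_eq_zero_iff hS q hqS, map_sub, map_one, sub_eq_zero, Units.ext_iff, coe_chiZS,
    Units.val_one]

lemma chiZS_surjective (hS : ∀ p ∈ S, p.Prime) (hqS : q ∉ S) :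
    Function.Surjective (chiZS hS hqS) := by
  intro u
  have hco : IsCoprime ((u : ZMod q).val : ℤ) (q : ℤ) := by
    rw [Nat.isCoprime_iff_coprime]
    exact ZMod.val_coe_unit_coprime u
  obtain ⟨a, b, hab⟩ := hco
  refine ⟨⟨mk4 (a : ZS S) (-b : ZS S) (q : ZS S) ((u : ZMod q).val : ZS S) ?_, ?_⟩, ?_⟩
  · have := congrArg (fun z : ℤ => (z : ZS S)) hab
    push_cast at this
    linear_combination this
  · rw [mem_gammaZero, mk4_10]
  · apply Units.ext
    rw [coe_chiZS, mk4_11, map_natCast, ZMod.natCast_zmod_val]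

lemma isUnit_two_ZS (h2 : 2 ∈ S) : IsUnit (2 : ZS S) := by
  exact_mod_cast isUnit_natCast_ZS h2 two_ne_zero

lemma isUnit_three_ZS (h3 : 3 ∈ S) : IsUnit (3 : ZS S) := by
  exact_mod_cast isUnit_natCast_ZS h3 three_ne_zero

/-- Homomorphisms on `Γ₀(q)` with commuting values factor through the lower right entry. -/
lemma eq_one_of_chiZS_eq_one (hS : ∀ p ∈ S, p.Prime) (hqS : q ∉ S) (h2 : 2 ∈ S) (h3 : 3 ∈ S)
    {C : Type*} [Group C] (κ : gammaZero S q →* C) (hκ : ∀ g h, κ g * κ h = κ h * κ g)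
    {g : gammaZero S q} (hg : chiZS hS hqS g = 1) : κ g = 1 := by
  have hgen : HasElemGen (q : ZS S) := hasElemGen_ZS hS h2 (fun p hp h => by
    rwa [(Nat.prime_dvd_prime_iff_eq hp hq.out).1 h])
  obtain ⟨u, hu⟩ := isUnit_two_ZS h2
  obtain ⟨v, hv⟩ := isUnit_three_ZS h3
  have e (t : ZS S) : t = 3 * (((v⁻¹ : (ZS S)ˣ) : ZS S) * t) := by
    rw [← hv, Units.mul_inv_cancel_left]
  have hcomm (a b : gammaZero S q) : κ (a * b * a⁻¹ * b⁻¹) = 1 := by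
    rw [map_mul, map_mul, map_mul, hκ a b, mul_assoc (κ b), ← map_mul κ a, mul_inv_cancel, map_one,
      mul_one, ← map_mul, mul_inv_cancel, map_one]
  have hdm (u : (ZS S)ˣ) : hd u ∈ gammaZero S q := by
    rw [mem_gammaZero, hd_10]
    exact dvd_zero _
  have key : elemN (q : ZS S) ≤ κ.ker.map (gammaZero S q).subtype := by
    refine (Subgroup.closure_le _).2 ?_
    rintro _ (⟨t, rfl⟩ | ⟨t, rfl⟩)
    · let a : gammaZero S q := ⟨hd u, hdm u⟩
      let b : gammaZero S q := ⟨x12 (((v⁻¹ : (ZS S)ˣ) : ZS S) * t), by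
        rw [mem_gammaZero, x12_10]
        exact dvd_zero _⟩
      refine ⟨a * b * a⁻¹ * b⁻¹, hcomm a b, ?_⟩
      rw [e t]
      exact hd_comm_x12 hu _
    · let a : gammaZero S q := ⟨hd u, hdm u⟩
      let b : gammaZero S q := ⟨x21 (q * (((v⁻¹ : (ZS S)ˣ) : ZS S) * t)), by
        rw [mem_gammaZero, x21_10]
        exact dvd_mul_right _ _⟩
      refine ⟨a⁻¹ * b * a⁻¹⁻¹ * b⁻¹, hcomm a⁻¹ b, ?_⟩
      change _ = x21 ((q : ZS S) * t)
      rw [e ((q : ZS S) * t), inv_inv, mul_left_comm _ (q : ZS S) t]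
      exact hd_comm_x21 hu _
  obtain ⟨g', hg', h⟩ := key (hgen g.1 g.2 ((chiZS_eq_one_iff hS hqS g).1 hg))
  rwa [← Subtype.ext h]

end Gluing

section UpperBound

variable {S T : Set ℕ} {q : ℕ} [hq : Fact q.Prime] (hST : S ⊆ T) (hqT : q ∈ T)

/-- The automorphism of `Γ₀(q)` relating the two embeddings of `SL₂(ℤ_S)` in `SL₂(ℤ_T)`. -/
def thetaZS : gammaZero S q →* gammaZero S q :=
  MonoidHom.mk' (fun g => ⟨(exists_embZS_eq hST hqT g.2).choose,
    (exists_embZS_eq hST hqT g.2).choose_spec.1⟩) (fun g h => by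
      apply Subtype.ext
      apply embZS_injective hST hqT false
      have hmul : (embZS hST hqT false) ((exists_embZS_eq hST hqT g.2).choose *
          (exists_embZS_eq hST hqT h.2).choose) = _ := map_mul _ _ _
      exact (((exists_embZS_eq hST hqT (g * h).2).choose_spec.2.2 true).symm.trans
        (map_mul _ _ _)).trans ((congrArg₂ _ ((exists_embZS_eq hST hqT g.2).choose_spec.2.2 true)
          ((exists_embZS_eq hST hqT h.2).choose_spec.2.2 true)).trans hmul.symm))

lemma embZS_thetaZS (b : Bool) (g : gammaZero S q) :
    embZS hST hqT b (thetaZS hST hqT g).1 = embZS hST hqT (!b) g.1 := by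
  have h := (exists_embZS_eq hST hqT g.2).choose_spec.2.2 (!b)
  rw [Bool.not_not] at h
  exact h.symm

lemma thetaZS_11 (g : gammaZero S q) : (thetaZS hST hqT g).1.1 1 1 = g.1.1 0 0 :=
  (exists_embZS_eq hST hqT g.2).choose_spec.2.1

lemma thetaZS_thetaZS (g : gammaZero S q) : thetaZS hST hqT (thetaZS hST hqT g) = g := by
  apply Subtype.ext
  apply embZS_injective hST hqT true
  rw [embZS_thetaZS, embZS_thetaZS, Bool.not_not]

lemma thetaZS_injective : Function.Injective (thetaZS hST hqT) :=
  (show Function.LeftInverse (thetaZS hST hqT) (thetaZS hST hqT) from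
    thetaZS_thetaZS hST hqT).injective

variable {M E : Type*} [AddCommGroup M] [Group E]

lemma CentralExt.mul_comm_of_π_eq_one {Γ : Type*} [Group Γ] (X : CentralExt M Γ E) {n : E}
    (hn : X.π n = 1) (e : E) : n * e = e * n := by
  obtain ⟨m, rfl⟩ := (X.π_eq_one_iff n).1 hn
  exact X.ι_comm m e

/-- If a central extension of `SL₂(ℤ_T)` splits over one copy of `SL₂(ℤ_S)` it splits over
the other one. -/
theorem exists_lift_embZS_false (hS : ∀ p ∈ S, p.Prime) (hqS : q ∉ S) (h2 : 2 ∈ S) (h3 : 3 ∈ S)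
    (X : CentralExt M (SLtwo (ZS T)) E) (s₁ : SLtwo (ZS S) →* E)
    (hs₁ : ∀ g, X.π (s₁ g) = embZS hST hqT true g) :
    ∃ s₂ : SLtwo (ZS S) →* E, ∀ g, X.π (s₂ g) = embZS hST hqT false g := by
  classical
  let P : Subgroup (E × SLtwo (ZS S)) :=
    (X.π.comp (MonoidHom.fst E (SLtwo (ZS S)))).eqLocus
      ((embZS hST hqT false).comp (MonoidHom.snd E (SLtwo (ZS S))))
  have hP (x : P) : X.π x.1.1 = embZS hST hqT false x.1.2 := x.2
  let π : P →* SLtwo (ZS S) := (MonoidHom.snd E (SLtwo (ZS S))).comp P.subtype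
  have hmem (g : gammaZero S q) : (s₁ (thetaZS hST hqT g).1, g.1) ∈ P := by
    change X.π (s₁ _) = embZS hST hqT false g.1
    rw [hs₁, embZS_thetaZS, Bool.not_true]
  let σ : SLtwo (ZS S) → P := fun g => if h : g ∈ gammaZero S q then
    ⟨(s₁ (thetaZS hST hqT ⟨g, h⟩).1, g), hmem ⟨g, h⟩⟩ else 1
  have hσ' (g : SLtwo (ZS S)) (h : g ∈ gammaZero S q) :
      σ g = ⟨(s₁ (thetaZS hST hqT ⟨g, h⟩).1, g), hmem ⟨g, h⟩⟩ := dif_pos h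
  have hgen1 : HasElemGen (1 : ZS S) := by
    have := hasElemGen_ZS (N := 1) hS h2 (fun p hp h => absurd (Nat.dvd_one.1 h) hp.ne_one)
    rwa [Nat.cast_one] at this
  have hgen : HasElemGen ((q : ZS S) ^ 2) := by
    have := hasElemGen_ZS (N := q ^ 2) hS h2 (fun p hp h => by
      rwa [(Nat.prime_dvd_prime_iff_eq hp hq.out).1 (hp.dvd_of_dvd_pow h)])
    rwa [Nat.cast_pow] at this
  obtain ⟨s, hs⟩ := exists_section_of_section_gamma (E := P) (π := π) (σ := σ)
    (fun h => hqS (by rwa [h])) (redZS hS q hqS)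
    (redZS_surjective hS q hqS) (redZS_eq_zero_iff hS q hqS)
    (Nat.cast_ne_zero.2 hq.out.ne_zero) hgen1 hgen (isUnit_two_ZS h2) (isUnit_three_ZS h3)
    (fun g => ⟨⟨(X.σ (embZS hST hqT false g), g), X.π_σ _⟩, rfl⟩)
    (fun n hn e => by
      have h1 : n.1.2 = 1 := hn
      have h2 : X.π n.1.1 = 1 := by rw [hP, h1, map_one]
      apply Subtype.ext
      refine Prod.ext (X.mul_comm_of_π_eq_one h2 e.1.1) ?_
      change n.1.2 * e.1.2 = e.1.2 * n.1.2
      rw [h1, one_mul, mul_one])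
    (fun g h hg hh => by
      rw [hσ' g hg, hσ' h hh, hσ' (g * h) ((gammaZero S q).mul_mem hg hh)]
      apply Subtype.ext
      refine Prod.ext ?_ rfl
      change s₁ _ = s₁ _ * s₁ _
      rw [← map_mul, ← Subgroup.coe_mul, ← map_mul]
      rfl)
    (fun g hg => by rw [hσ' g hg]; rfl)
  refine ⟨((MonoidHom.fst E (SLtwo (ZS S))).comp P.subtype).comp s, fun g => ?_⟩
  have := hP (s g)
  rw [show (s g).1.2 = g from hs g] at this
  exact this

/-- A central extension of `SL₂(ℤ_T)` which is split over `SL₂(ℤ_S)`, with surjective homology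
pairing, has kernel a quotient of `(ℤ/q)ˣ`. -/
theorem CentralExt.exists_surjective_of_lift (hS : ∀ p ∈ S, p.Prime) (hT : T = insert q S)
    (hqS : q ∉ S) (h2 : 2 ∈ S) (h3 : 3 ∈ S)
    (X : CentralExt M (SLtwo (ZS T)) E) (hX : Function.Surjective X.eval)
    (s : Bool → SLtwo (ZS S) →* E) (hs : ∀ b g, X.π (s b g) = embZS hST hqT b g) :
    ∃ F : (ZMod q)ˣ → M, Function.Surjective F := by
  have hκπ (g : gammaZero S q) : X.π (s true g.1 * (s false (thetaZS hST hqT g).1)⁻¹) = 1 := by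
    rw [map_mul, map_inv, hs, hs, embZS_thetaZS, Bool.not_false, mul_inv_cancel]
  let κ : gammaZero S q →* E := MonoidHom.mk'
    (fun g => s true g.1 * (s false (thetaZS hST hqT g).1)⁻¹) (fun g h => by
      have h1 := X.mul_comm_of_π_eq_one (hκπ h) (s false (thetaZS hST hqT g).1)⁻¹
      simp only [map_mul, Subgroup.coe_mul, mul_inv_rev] at h1 ⊢
      simp only [mul_assoc] at h1 ⊢
      rw [h1])
  have hκ (g : gammaZero S q) : s true g.1 = κ g * s false (thetaZS hST hqT g).1 :=
    (inv_mul_cancel_right _ _).symm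
  have hκZ (g : gammaZero S q) (e : E) : κ g * e = e * κ g := X.mul_comm_of_π_eq_one (hκπ g) e
  set Z : Subgroup E := κ.range with hZdef
  set H := Subgroup.closure (Set.range (s true) ∪ Set.range (s false)) with hH
  have hHZ (e : E) (he : e ∈ H) (h1 : X.π e = 1) : e ∈ Z := by
    refine mem_of_mem_closure_of_map_eq_one hST hqT hS hqS hs ?_ ?_ ?_ he h1
    · rintro _ ⟨g, rfl⟩ e
      exact hκZ g e
    · rintro _ ⟨g, rfl⟩
      exact hκπ g
    · intro b γ hγ
      refine ⟨_, (thetaZS hST hqT ⟨γ, hγ⟩).2, ?_⟩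
      cases b with
      | true => exact ⟨κ ⟨γ, hγ⟩, ⟨_, rfl⟩, hκ ⟨γ, hγ⟩⟩
      | false =>
        refine ⟨(κ (thetaZS hST hqT ⟨γ, hγ⟩))⁻¹, inv_mem ⟨_, rfl⟩, ?_⟩
        rw [Bool.not_false, hκ, thetaZS_thetaZS, inv_mul_cancel_left]
  have hTp : ∀ p ∈ T, p.Prime := by
    rw [hT]
    rintro p (rfl | hp)
    exacts [hq.out, hS p hp]
  have hsurj (g : SLtwo (ZS T)) : ∃ e ∈ H, X.π e = g := by
    have h1 : H.map X.π = ⊤ := by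
      rw [hH, MonoidHom.map_closure, Set.image_union, ← Set.range_comp, ← Set.range_comp,
        ← closure_range_embZS hST hqT hTp (hST h2) hT]
      congr 3
      · exact funext fun g => hs true g
      · exact funext fun g => hs false g
    have h2 : g ∈ H.map X.π := h1 ▸ Subgroup.mem_top g
    exact h2
  choose e he hπe using hsurj
  let M₀ : AddSubgroup M :=
    { carrier := {m | X.ι (Multiplicative.ofAdd m) ∈ Z}
      zero_mem' := by
        change X.ι _ ∈ Z
        rw [ofAdd_zero, map_one]
        exact one_mem _
      add_mem' := by
        intro a b ha hb
        change X.ι _ ∈ Z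
        rw [ofAdd_add, map_mul]
        exact mul_mem ha hb
      neg_mem' := by
        intro a ha
        change X.ι _ ∈ Z
        rw [ofAdd_neg, map_inv]
        exact inv_mem ha }
  have hcob (g h : SLtwo (ZS T)) : X.cocycle g h - (-X.coord (e h) + X.coord (e (g * h))
      - X.coord (e g)) ∈ M₀ := by
    change X.ι _ ∈ Z
    apply hHZ
    · have h1 : X.ι (Multiplicative.ofAdd (X.cocycle g h - (-X.coord (e h) + X.coord (e (g * h))
          - X.coord (e g)))) * e (g * h) = e g * e h := by
        have h3 := X.coord_mul (e g) (e h)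
        rw [hπe, hπe] at h3
        have h4 := X.ι_coord (e (g * h))
        rw [hπe] at h4
        have h5 := X.ι_coord (e g * e h)
        rw [map_mul, hπe, hπe, h3] at h5
        rw [← h5]
        conv_lhs => rw [← h4]
        rw [← mul_assoc, ← map_mul, ← ofAdd_add]
        congr 3
        rw [h4]
        abel
      rw [← eq_mul_inv_iff_mul_eq] at h1
      rw [h1]
      exact mul_mem (mul_mem (he g) (he h)) (inv_mem (he _))
    · exact X.π_ι _
  have hM₀ (m : M) : m ∈ M₀ := by
    obtain ⟨x, rfl⟩ := hX m
    have hp := X.isTwoCocycle_cocycle.map (QuotientAddGroup.mk' M₀)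
    have h1 := evalH2_map X.isTwoCocycle_cocycle (QuotientAddGroup.mk' M₀) x
    rw [evalH2_coboundary hp (fun g => QuotientAddGroup.mk' M₀ (-X.coord (e g))) (fun g h => by
      rw [← sub_eq_zero, ← map_sub, ← map_add, ← map_sub]
      change QuotientAddGroup.mk' M₀ _ = 0
      rw [QuotientAddGroup.mk'_apply, QuotientAddGroup.eq_zero_iff]
      convert hcob g h using 1
      abel)] at h1
    have h2 := h1.symm
    rw [QuotientAddGroup.mk'_apply, QuotientAddGroup.eq_zero_iff] at h2
    exact h2
  have hκ1 (g h : gammaZero S q) (hgh : chiZS hS hqS g = chiZS hS hqS h) : κ g = κ h := by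
    rw [← mul_inv_eq_one, ← map_inv, ← map_mul]
    apply eq_one_of_chiZS_eq_one hS hqS h2 h3 κ (fun g h => hκZ g _)
    rw [map_mul, map_inv, hgh, mul_inv_cancel]
  choose r hr using chiZS_surjective (q := q) hS hqS
  refine ⟨fun u => X.coord (κ (r u)) - X.coord 1, fun m => ?_⟩
  obtain ⟨g, hg⟩ : X.ι (Multiplicative.ofAdd m) ∈ Z := hM₀ m
  refine ⟨chiZS hS hqS g, ?_⟩
  change X.coord (κ (r (chiZS hS hqS g))) - X.coord 1 = m
  rw [hκ1 _ g (hr _), hg, ← mul_one (X.ι (Multiplicative.ofAdd m)), X.coord_ι_mul]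
  simp

/-- The cokernel of `H₂(SL₂(ℤ_S)) → H₂(SL₂(ℤ_{S ∪ {q}}))` is a quotient of `(ℤ/q)ˣ`. -/
theorem exists_surjective_cokernel (hS : ∀ p ∈ S, p.Prime) (hT : T = insert q S)
    (hqS : q ∉ S) (h2 : 2 ∈ S) (h3 : 3 ∈ S) :
    ∃ F : (ZMod q)ˣ → H2 (SLtwo (ZS T)) ⧸ LinearMap.range (mapH2 (slMap (inclZS hST))),
      Function.Surjective F := by
  have hqT : q ∈ T := hT ▸ Set.mem_insert q S
  have hTp : ∀ p ∈ T, p.Prime := by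
    rw [hT]
    rintro p (rfl | hp)
    exacts [hq.out, hS p hp]
  obtain ⟨f, hf, hfx⟩ := exists_universal_cocycle (commutator_ZS hTp (hST h2) (hST h3))
  let p := (LinearMap.range (mapH2 (slMap (inclZS hST)))).mkQ.toAddMonoidHom
  obtain ⟨_, X, hX⟩ := exists_centralExt (hf.map p)
  have hev (x) : X.eval x = p x := by
    rw [CentralExt.eval]
    conv_rhs => rw [← hfx x, ← evalH2_map hf p]
    congr 1
    simp only [hX]
  obtain ⟨s₁, hs₁⟩ := X.exists_lift (commutator_ZS hS h2 h3) (embZS hST hqT true) (fun x => by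
    rw [hev]
    exact (Submodule.Quotient.mk_eq_zero _).2 ⟨x, rfl⟩)
  obtain ⟨s₂, hs₂⟩ := exists_lift_embZS_false hST hqT hS hqS h2 h3 X s₁ hs₁
  refine X.exists_surjective_of_lift hST hqT hS hT hqS h2 h3 (fun m => ?_)
    (fun b => if b then s₁ else s₂) ?_
  · obtain ⟨x, rfl⟩ := Submodule.mkQ_surjective _ m
    exact ⟨x, hev x⟩
  · rintro (_ | _) g
    · exact hs₂ g
    · exact hs₁ g

end UpperBound

section TameExtension

variable {S T : Set ℕ} {q : ℕ} [hq : Fact q.Prime]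

/-- The two maps whose pushout is the central extension attached to the prime `q`. -/
def tameGlue (hS : ∀ p ∈ S, p.Prime) (hqS : q ∉ S) (hST : S ⊆ T) (hqT : q ∈ T) :
    Bool → gammaZero S q × (ZMod q)ˣ →* SLtwo (ZS S) × (ZMod q)ˣ
  | true => ((gammaZero S q).subtype.comp (MonoidHom.fst _ _)).prod (MonoidHom.snd _ _)
  | false => (((gammaZero S q).subtype.comp (thetaZS hST hqT)).comp (MonoidHom.fst _ _)).prod
      (MonoidHom.snd _ _ * (chiZS hS hqS).comp (MonoidHom.fst _ _))

variable (hS : ∀ p ∈ S, p.Prime) (hqS : q ∉ S) (hST : S ⊆ T) (hqT : q ∈ T)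

lemma tameGlue_true (x : gammaZero S q × (ZMod q)ˣ) :
    tameGlue hS hqS hST hqT true x = (x.1.1, x.2) := rfl

lemma tameGlue_false (x : gammaZero S q × (ZMod q)ˣ) :
    tameGlue hS hqS hST hqT false x = ((thetaZS hST hqT x.1).1, x.2 * chiZS hS hqS x.1) := rfl

lemma tameGlue_one (b : Bool) (c : (ZMod q)ˣ) : tameGlue hS hqS hST hqT b (1, c) = (1, c) := by
  cases b with
  | true => rfl
  | false => rw [tameGlue_false, map_one, map_one, mul_one, OneMemClass.coe_one]

lemma tameGlue_injective (b : Bool) : Function.Injective (tameGlue hS hqS hST hqT b) := by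
  rintro ⟨g, c⟩ ⟨h, d⟩ hgh
  cases b with
  | true =>
    rw [tameGlue_true, tameGlue_true, Prod.mk.injEq] at hgh
    exact Prod.ext (Subtype.ext hgh.1) hgh.2
  | false =>
    rw [tameGlue_false, tameGlue_false, Prod.mk.injEq] at hgh
    obtain rfl := thetaZS_injective hST hqT (Subtype.ext hgh.1)
    exact Prod.ext rfl (mul_right_cancel hgh.2)

open Monoid in
/-- The central extension of `SL₂(ℤ_{S ∪ {q}})` by `(ℤ/q)ˣ` obtained by gluing two trivial
extensions of `SL₂(ℤ_S)` along `Γ₀(q)` with a twist. -/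
theorem exists_tame_extension (hT : T = insert q S) (h2 : 2 ∈ T) :
    ∃ (E : Type) (_ : Group E) (X : CentralExt (Additive (ZMod q)ˣ) (SLtwo (ZS T)) E)
      (s : Bool → SLtwo (ZS S) →* E), (∀ b g, X.π (s b g) = embZS hST hqT b g) ∧
      ∀ γ : gammaZero S q, s true γ.1 =
        X.ι (Multiplicative.ofAdd (Additive.ofMul (chiZS hS hqS γ))) *
          s false (thetaZS hST hqT γ).1 := by
  have hTp : ∀ p ∈ T, p.Prime := by
    rw [hT]
    rintro p (rfl | hp)
    exacts [hq.out, hS p hp]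
  let φ := tameGlue hS hqS hST hqT
  let E := PushoutI φ
  let of (b : Bool) : SLtwo (ZS S) × (ZMod q)ˣ →* E :=
    PushoutI.of (G := fun _ : Bool => SLtwo (ZS S) × (ZMod q)ˣ) (φ := φ) b
  let k : gammaZero S q × (ZMod q)ˣ →* SLtwo (ZS T) :=
    ((embZS hST hqT true).comp (gammaZero S q).subtype).comp (MonoidHom.fst _ _)
  let π : E →* SLtwo (ZS T) := PushoutI.lift
    (fun b => (embZS hST hqT b).comp (MonoidHom.fst (SLtwo (ZS S)) (ZMod q)ˣ)) k (by
      rintro (_ | _)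
      · ext1 x
        exact embZS_thetaZS hST hqT false x.1
      · rfl)
  have hπ (b x) : π (of b x) = embZS hST hqT b x.1 :=
    PushoutI.lift_of (G := fun _ : Bool => SLtwo (ZS S) × (ZMod q)ˣ) _ _ _ x
  have hφ (b x) : of b (φ b x) = PushoutI.base φ x := PushoutI.of_apply_eq_base φ b x
  let z : (ZMod q)ˣ →* E := (PushoutI.base φ).comp (MonoidHom.inr _ _)
  have hz (b c) : z c = of b (1, c) := by
    rw [← tameGlue_one hS hqS hST hqT b c]
    exact (hφ b (1, c)).symm
  have hzinj : Function.Injective z := fun c d h =>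
    congrArg Prod.snd (PushoutI.base_injective (tameGlue_injective hS hqS hST hqT) h)
  have hind {p : E → Prop} (h1 : ∀ b x, p (of b x)) (h2 : ∀ x y, p x → p y → p (x * y)) (x : E) :
      p x := PushoutI.induction_on x h1 (fun h => by
        rw [← hφ true]
        exact h1 _ _) h2
  have hzc (c e) : z c * e = e * z c := by
    refine hind (p := fun e => z c * e = e * z c) (fun b x => ?_) (fun x y hx hy => ?_) e
    · rw [hz b, ← map_mul, ← map_mul]
      congr 1
      refine Prod.ext ?_ (mul_comm _ _)
      change 1 * x.1 = x.1 * 1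
      rw [one_mul, mul_one]
    · rw [← mul_assoc, hx, mul_assoc, hy, mul_assoc]
  have hzπ (c) : π (z c) = 1 := by
    rw [hz true, hπ, map_one]
  let s (b : Bool) : SLtwo (ZS S) →* E := (of b).comp (MonoidHom.inl _ (ZMod q)ˣ)
  have hs (b g) : π (s b g) = embZS hST hqT b g := hπ b (g, 1)
  have hof (b x) : of b x = z x.2 * s b x.1 := by
    rw [hz b]
    change _ = _ * of b (x.1, 1)
    rw [← map_mul, Prod.mk_mul_mk, one_mul, mul_one]
  have hsχ (γ : gammaZero S q) : s true γ.1 = z (chiZS hS hqS γ) * s false (thetaZS hST hqT γ).1 := by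
    have h1 := (hφ true (γ, 1)).trans (hφ false (γ, 1)).symm
    rw [hof false] at h1
    refine h1.trans ?_
    change z (1 * chiZS hS hqS γ) * _ = _
    rw [one_mul]
    rfl
  set H := Subgroup.closure (Set.range (s true) ∪ Set.range (s false)) with hH
  have hsH (b g) : s b g ∈ H := by
    apply Subgroup.subset_closure
    cases b with
    | true => exact Or.inl ⟨g, rfl⟩
    | false => exact Or.inr ⟨g, rfl⟩
  have hdec (e : E) : ∃ c, ∃ e' ∈ H, e = z c * e' := by
    refine hind (p := fun e => ∃ c, ∃ e' ∈ H, e = z c * e')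
      (fun b x => ⟨x.2, _, hsH b x.1, hof b x⟩) ?_ e
    rintro _ _ ⟨c, x, hx, rfl⟩ ⟨d, y, hy, rfl⟩
    refine ⟨c * d, x * y, mul_mem hx hy, ?_⟩
    rw [map_mul, mul_assoc, mul_assoc, ← mul_assoc x, ← hzc d x, mul_assoc]
  have hker (e : E) (he : π e = 1) : ∃ c, z c = e := by
    obtain ⟨c, e', he', rfl⟩ := hdec e
    rw [map_mul, hzπ, one_mul] at he
    obtain ⟨d, rfl⟩ : e' ∈ z.range := by
      refine mem_of_mem_closure_of_map_eq_one hST hqT hS hqS hs ?_ ?_ ?_ he' he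
      · rintro _ ⟨c, rfl⟩
        exact hzc c
      · rintro _ ⟨c, rfl⟩
        exact hzπ c
      · intro b γ hγ
        refine ⟨_, (thetaZS hST hqT ⟨γ, hγ⟩).2, ?_⟩
        cases b with
        | true => exact ⟨_, ⟨_, rfl⟩, hsχ ⟨γ, hγ⟩⟩
        | false =>
          refine ⟨(z (chiZS hS hqS (thetaZS hST hqT ⟨γ, hγ⟩)))⁻¹, inv_mem ⟨_, rfl⟩, ?_⟩
          rw [Bool.not_false, hsχ, thetaZS_thetaZS, inv_mul_cancel_left]
    exact ⟨c * d, map_mul _ _ _⟩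
  have hsurj (g : SLtwo (ZS T)) : ∃ e, π e = g := by
    have h1 : H.map π = ⊤ := by
      rw [hH, MonoidHom.map_closure, Set.image_union, ← Set.range_comp, ← Set.range_comp,
        ← closure_range_embZS hST hqT hTp h2 hT]
      exact congrArg Subgroup.closure (congrArg₂ _ (congrArg Set.range (funext (hs true)))
        (congrArg Set.range (funext (hs false))))
    obtain ⟨e, -, he⟩ : g ∈ H.map π := h1 ▸ Subgroup.mem_top g
    exact ⟨e, he⟩
  choose σ hσ using hsurj
  let X : CentralExt (Additive (ZMod q)ˣ) (SLtwo (ZS T)) E :=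
    { ι := MonoidHom.mk' (fun m => z m.toAdd.toMul) (fun m n => map_mul z _ _)
      π := π
      σ := σ
      ι_injective := hzinj
      π_eq_one_iff := fun e => ⟨fun h => hker e h, by
        rintro ⟨c, rfl⟩
        exact hzπ _⟩
      ι_comm := fun m e => hzc _ e
      π_σ := hσ }
  exact ⟨E, inferInstance, X, s, hs, hsχ⟩

end TameExtension

section TameSymbol

variable {S T U : Set ℕ} {q : ℕ} [hq : Fact q.Prime]

lemma slMap_inclZS_inclZS (h₁ : S ⊆ T) (h₂ : T ⊆ U) (g : SLtwo (ZS S)) :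
    slMap (inclZS h₂) (slMap (inclZS h₁) g) = slMap (inclZS (h₁.trans h₂)) g := by
  have h (x : ZS S) : inclZS h₂ (inclZS h₁ x) = inclZS (h₁.trans h₂) x := by
    apply Subtype.ext
    rw [coe_inclZS, coe_inclZS, coe_inclZS]
  apply SLtwo.ext4 <;> exact h _

lemma mapH2_inclZS_inclZS (h₁ : S ⊆ T) (h₂ : T ⊆ U) (x : H2 (SLtwo (ZS S))) :
    mapH2 (slMap (inclZS h₂)) (mapH2 (slMap (inclZS h₁)) x) =
      mapH2 (slMap (inclZS (h₁.trans h₂))) x := by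
  rw [mapH2_comp]
  have h : (slMap (inclZS h₂)).comp (slMap (inclZS h₁)) = slMap (inclZS (h₁.trans h₂)) :=
    MonoidHom.ext (slMap_inclZS_inclZS h₁ h₂)
  rw [h]

lemma slMap_embZS {S₀ T₀ : Set ℕ} (h₀ : S₀ ⊆ T₀) (hq₀ : q ∈ T₀) (hST : S ⊆ T) (hqT : q ∈ T)
    (hS : S₀ ⊆ S) (hT : T₀ ⊆ T) (b : Bool) (g : SLtwo (ZS S₀)) :
    slMap (inclZS hT) (embZS h₀ hq₀ b g) = embZS hST hqT b (slMap (inclZS hS) g) := by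
  cases b with
  | true =>
    rw [embZS_true, embZS_true, slMap_inclZS_inclZS, slMap_inclZS_inclZS]
  | false =>
    have hqi : inclZS hT (qinv hq₀) = qinv hqT := Subtype.ext (coe_inclZS hT _)
    have h (i j) : inclZS hT ((slMap (inclZS h₀) g).1 i j) =
        (slMap (inclZS hST) (slMap (inclZS hS) g)).1 i j := by
      rw [slMap_inclZS_inclZS hS hST, ← slMap_inclZS_inclZS h₀ hT]
      rfl
    rw [embZS_false, embZS_false]
    apply SLtwo.ext4
    · rw [slMap_apply, atkin_00, atkin_00, h]
    · rw [slMap_apply, atkin_01, atkin_01, map_neg, map_mul, h, hqi]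
    · rw [slMap_apply, atkin_10, atkin_10, map_neg, map_mul, h, map_natCast]
    · rw [slMap_apply, atkin_11, atkin_11, h]

/-- The tame symbol at `q` on `H₂(SL₂(ℤ_T))`. It vanishes on classes coming from subrings in which
`q` is not invertible. -/
theorem exists_tame_symbol (hT : ∀ p ∈ T, p.Prime) (hqT : q ∈ T) (h2 : 2 ∈ T) :
    ∃ Θ : H2 (SLtwo (ZS T)) →ₗ[ℤ] Additive (ZMod q)ˣ,
      (∀ (S : Set ℕ) (hST : S ⊆ T), q ∉ S → ∀ x, Θ (mapH2 (slMap (inclZS hST)) x) = 0) ∧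
      ∀ (S : Set ℕ) (hST : insert q S ⊆ T), q ∉ S → 2 ∈ S → 3 ∈ S →
        ∀ m, ∃ x, Θ (mapH2 (slMap (inclZS hST)) x) = m := by
  set S₁ := T \ {q} with hS₁
  have hqS₁ : q ∉ S₁ := fun h => h.2 rfl
  have hS₁T : S₁ ⊆ T := Set.sdiff_subset
  have hT₁ : T = insert q S₁ := by
    rw [hS₁, Set.insert_sdiff_singleton, Set.insert_eq_of_mem hqT]
  have hS₁p : ∀ p ∈ S₁, p.Prime := fun p hp => hT p (hS₁T hp)
  obtain ⟨E, _, X, s, hs, hsχ⟩ := exists_tame_extension hS₁p hqS₁ hS₁T hqT hT₁ h2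
  refine ⟨X.eval, fun S hST hqS x => ?_, fun S hST hqS h2S h3S m => ?_⟩
  · have hSS₁ : S ⊆ S₁ := fun p hp => ⟨hST hp, fun h => hqS (h ▸ hp)⟩
    refine X.eval_mapH2_eq_zero _ ((s true).comp (slMap (inclZS hSS₁))) (fun g => ?_) x
    rw [MonoidHom.comp_apply, hs, embZS_true, slMap_inclZS_inclZS]
  · have hSi : S ⊆ insert q S := Set.subset_insert q S
    have hSS₁ : S ⊆ S₁ := fun p hp => ⟨hST (hSi hp), fun h => hqS (h ▸ hp)⟩
    have hSp : ∀ p ∈ S, p.Prime := fun p hp => hS₁p p (hSS₁ hp)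
    have hqi : q ∈ insert q S := Set.mem_insert q S
    set j := slMap (inclZS hST) with hj
    set i := slMap (inclZS hSS₁) with hi
    have hji (b g) : j (embZS hSi hqi b g) = X.π (s b (i g)) := by
      rw [hs, hj, hi]
      exact slMap_embZS hSi hqi hS₁T hqT hSS₁ hST b g
    let M₀ := LinearMap.range (X.eval.comp (mapH2 j))
    let p := M₀.mkQ.toAddMonoidHom
    have hf := (X.isTwoCocycle_cocycle.comp j).map p
    have hperf : commutator (SLtwo (ZS (insert q S))) = ⊤ :=
      commutator_ZS (fun p hp => hT p (hST hp)) (hSi h2S) (hSi h3S)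
    obtain ⟨φ, hφ⟩ := exists_primitive hperf hf (fun x => by
      rw [evalH2_map (X.isTwoCocycle_cocycle.comp j), ← evalH2_mapH2 X.isTwoCocycle_cocycle]
      exact (Submodule.Quotient.mk_eq_zero _).2 ⟨x, rfl⟩)
    have hadd (b : Bool) (g : SLtwo (ZS S)) :
        φ (embZS hSi hqi b g) + p (X.coord (s b (i g))) = 0 := by
      refine eq_zero_of_perfect (commutator_ZS hSp h2S h3S)
        (fun g => φ (embZS hSi hqi b g) + p (X.coord (s b (i g)))) (fun g h => ?_) g
      have h1 := hφ (embZS hSi hqi b g) (embZS hSi hqi b h)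
      have h2 := X.coord_mul (s b (i g)) (s b (i h))
      rw [hji, hji] at h1
      rw [map_mul i, map_mul (s b), h2, map_add, map_add, h1, map_mul]
      abel
    have hχ (γ : gammaZero S q) : Additive.ofMul (chiZS hSp hqS γ) ∈ M₀ := by
      have hγ : i γ.1 ∈ gammaZero S₁ q := by
        rw [mem_gammaZero, hi, slMap_apply, ← map_natCast (inclZS hSS₁)]
        exact map_dvd _ γ.2
      have hχ₁ : chiZS hS₁p hqS₁ ⟨i γ.1, hγ⟩ = chiZS hSp hqS γ := by
        apply Units.ext
        rw [coe_chiZS, coe_chiZS]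
        change ((((inclZS hSS₁ (γ.1.1 1 1) : ZS S₁) : ℚ)) : ZMod q) = _
        rw [coe_inclZS]
        rfl
      have hθ : (thetaZS hS₁T hqT ⟨i γ.1, hγ⟩).1 = i (thetaZS hSi hqi γ).1 := by
        apply embZS_injective hS₁T hqT false
        rw [embZS_thetaZS, Bool.not_false, ← hs, ← hs, ← hji, ← hji, embZS_thetaZS, Bool.not_false]
      have h1 := hadd true γ.1
      have h2 := hadd false (thetaZS hSi hqi γ).1
      rw [embZS_thetaZS, Bool.not_false, ← h1, ← hθ, hsχ ⟨i γ.1, hγ⟩, X.coord_ι_mul, map_add,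
        hχ₁] at h2
      have h3 : p (Additive.ofMul (chiZS hSp hqS γ)) = 0 := by
        rw [add_comm (p (Additive.ofMul _)), ← add_assoc] at h2
        exact (left_eq_add.1 h2)
      exact (Submodule.Quotient.mk_eq_zero _).1 h3
    obtain ⟨γ, hγ⟩ := chiZS_surjective hSp hqS m.toMul
    have := hχ γ
    rw [hγ] at this
    obtain ⟨x, hx⟩ := this
    exact ⟨x, hx⟩

/-- The kernel of the tame symbol at `q` on classes coming from `SL₂(ℤ_{S ∪ {q}})`. -/
theorem exists_preimage_of_tame_symbol_eq_zero (hS : ∀ p ∈ S, p.Prime) (hqS : q ∉ S) (h2 : 2 ∈ S)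
    (h3 : 3 ∈ S)
    {Θ : H2 (SLtwo (ZS (insert q S))) →ₗ[ℤ] Additive (ZMod q)ˣ}
    (hΘ : ∀ x, Θ (mapH2 (slMap (inclZS (Set.subset_insert q S))) x) = 0)
    (hsurj : Function.Surjective Θ) {x : H2 (SLtwo (ZS (insert q S)))} (hx : Θ x = 0) :
    ∃ y, mapH2 (slMap (inclZS (Set.subset_insert q S))) y = x := by
  set R := LinearMap.range (mapH2 (slMap (inclZS (Set.subset_insert q S)))) with hR
  obtain ⟨F, hF⟩ := exists_surjective_cokernel (Set.subset_insert q S) hS rfl hqS h2 h3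
  let Φ : (H2 (SLtwo (ZS (insert q S))) ⧸ R) →ₗ[ℤ] Additive (ZMod q)ˣ := R.liftQ Θ (by
    rintro _ ⟨y, rfl⟩
    exact hΘ y)
  have hΦ : Function.Surjective Φ := fun m => by
    obtain ⟨y, rfl⟩ := hsurj m
    exact ⟨R.mkQ y, rfl⟩
  have hcomp : Function.Surjective fun u : Additive (ZMod q)ˣ => Φ (F u.toMul) :=
    hΦ.comp (hF.comp Additive.toMul.surjective)
  have hinj := Finite.injective_iff_surjective.2 hcomp
  have hΦi : Function.Injective Φ := by
    intro a b hab
    obtain ⟨u, rfl⟩ := hF a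
    obtain ⟨v, rfl⟩ := hF b
    have := hinj (a₁ := Additive.ofMul u) (a₂ := Additive.ofMul v) hab
    exact congrArg F this
  have h0 : R.mkQ x = 0 := hΦi (by
    rw [map_zero]
    exact hx)
  exact (Submodule.Quotient.mk_eq_zero _).1 h0

end TameSymbol

section Assembly

variable {S T : Set ℕ}

lemma exists_slMap_inclZS_eq (hST : S ⊆ T) (g : SLtwo (ZS T))
    (hg : ∀ i j, ((g.1 i j : ZS T) : ℚ) ∈ ZS S) : ∃ g', slMap (inclZS hST) g' = g := by
  have hx (i j) : ∃ x : ZS S, inclZS hST x = g.1 i j :=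
    ⟨⟨_, hg i j⟩, Subtype.ext (coe_inclZS hST ⟨_, hg i j⟩)⟩
  choose x hx using hx
  refine ⟨mk4 (x 0 0) (x 0 1) (x 1 0) (x 1 1) ?_, ?_⟩
  · apply inclZS_injective hST
    simp only [map_sub, map_mul, map_one, hx]
    exact g.det_eq
  · apply SLtwo.ext4 <;> exact hx _ _

lemma exists_mapH2_eq_class {Γ Γ' : Type*} [Group Γ] [Group Γ'] (j : Γ →* Γ')
    (hj : Function.Injective j) (z : LinearMap.ker (barD2 Γ'))
    (hz : ∀ p ∈ z.1.support, (∃ g, j g = p.1) ∧ ∃ g, j g = p.2) :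
    ∃ y, mapH2 j y = classH2 z := by
  have hpinj : Function.Injective (Prod.map j j) := hj.prodMap hj
  let w : (Γ × Γ) →₀ ℤ := Finsupp.comapDomain (Prod.map j j) z.1 hpinj.injOn
  have hw : mapC2 j w = z.1 := by
    refine Finsupp.mapDomain_comapDomain (Prod.map j j) hpinj z.1 fun p hp => ?_
    obtain ⟨⟨g, hg⟩, h, hh⟩ := hz p hp
    exact ⟨(g, h), Prod.ext hg hh⟩
  have hw0 : w ∈ LinearMap.ker (barD2 Γ) := by
    rw [LinearMap.mem_ker]
    apply Finsupp.mapDomain_injective hj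
    have h1 := LinearMap.congr_fun (barD2_comm j) w
    simp only [LinearMap.comp_apply] at h1
    rw [hw, LinearMap.mem_ker.1 z.2] at h1
    exact h1.symm.trans (map_zero (mapC1 j)).symm
  refine ⟨classH2 ⟨w, hw0⟩, ?_⟩
  rw [mapH2_class]
  exact congrArg classH2 (Subtype.ext hw)

/-- Every class in `H₂(SL₂(ℤ_T))` comes from a ring obtained from `ℤ_S` by inverting finitely many
primes. -/
theorem exists_finite_support (hT : ∀ p ∈ T, p.Prime) (hST : S ⊆ T) (x : H2 (SLtwo (ZS T))) :
    ∃ (J : Finset ℕ) (hJ : S ∪ ↑J ⊆ T) (y : H2 (SLtwo (ZS (S ∪ ↑J)))),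
      mapH2 (slMap (inclZS hJ)) y = x := by
  classical
  obtain ⟨z, rfl⟩ := classH2_surjective x
  let P : SLtwo (ZS T) → Finset ℕ := fun g =>
    Finset.univ.biUnion fun i => Finset.univ.biUnion fun j => ((g.1 i j : ZS T) : ℚ).den.primeFactors
  let J : Finset ℕ := z.1.support.biUnion fun p => P p.1 ∪ P p.2
  have hPT (g) : ∀ p ∈ P g, p ∈ T := by
    intro p hp
    obtain ⟨i, -, hi⟩ := Finset.mem_biUnion.1 hp
    obtain ⟨j, -, hj⟩ := Finset.mem_biUnion.1 hi
    exact mem_of_dvd_den hT (g.1 i j).2 p (Nat.prime_of_mem_primeFactors hj)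
      (Nat.dvd_of_mem_primeFactors hj)
  have hJ : S ∪ ↑J ⊆ T := by
    refine Set.union_subset hST fun p hp => ?_
    obtain ⟨g, -, hg⟩ := Finset.mem_biUnion.1 (Finset.mem_coe.1 hp)
    rcases Finset.mem_union.1 hg with h | h <;> exact hPT _ p h
  have hlift (g : SLtwo (ZS T)) (hg : P g ⊆ J) : ∃ g', slMap (inclZS hJ) g' = g := by
    have hmem (i j) : ((g.1 i j : ZS T) : ℚ) ∈ ZS (S ∪ ↑J) := by
      refine mem_ZS_of_den fun p hp hd => Or.inr ?_
      exact hg (Finset.mem_biUnion.2 ⟨i, Finset.mem_univ _, Finset.mem_biUnion.2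
        ⟨j, Finset.mem_univ _, Nat.mem_primeFactors.2 ⟨hp, hd, Rat.den_nz _⟩⟩⟩)
    exact exists_slMap_inclZS_eq hJ g hmem
  set j := slMap (inclZS hJ) with hj
  have hinj : Function.Injective j := slMap_injective _ (inclZS_injective hJ)
  obtain ⟨y, hy⟩ := exists_mapH2_eq_class j hinj z (fun p hp => by
    have hpJ : P p.1 ∪ P p.2 ⊆ J := by
      intro r hr
      exact Finset.mem_biUnion.2 ⟨p, hp, hr⟩
    exact ⟨hlift p.1 (Finset.union_subset_left hpJ), hlift p.2 (Finset.union_subset_right hpJ)⟩)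
  exact ⟨J, hJ, y, hy⟩

/-- A class all of whose tame symbols at the primes outside `S` vanish comes from `ℤ_S`. -/
theorem exists_preimage_of_tame_symbols_eq_zero (hT : ∀ p ∈ T, p.Prime) (hST : S ⊆ T)
    (h2 : 2 ∈ S) (h3 : 3 ∈ S) (Θ : ∀ q : ↑(T \ S), H2 (SLtwo (ZS T)) →ₗ[ℤ] Additive (ZMod q)ˣ)
    (hΘ : ∀ (q : ↑(T \ S)) (U : Set ℕ) (hUT : U ⊆ T), (q : ℕ) ∉ U → ∀ x,
      Θ q (mapH2 (slMap (inclZS hUT)) x) = 0)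
    (hΘ' : ∀ (q : ↑(T \ S)) (U : Set ℕ) (hUT : insert (q : ℕ) U ⊆ T), (q : ℕ) ∉ U → 2 ∈ U → 3 ∈ U →
        ∀ m, ∃ x, Θ q (mapH2 (slMap (inclZS hUT)) x) = m)
    (J : Finset ℕ) : ∀ (V : Set ℕ) (_ : V = S ∪ ↑J) (hVT : V ⊆ T) (y : H2 (SLtwo (ZS V))),
      (∀ q, Θ q (mapH2 (slMap (inclZS hVT)) y) = 0) →
      ∃ x, mapH2 (slMap (inclZS hST)) x = mapH2 (slMap (inclZS hVT)) y := by
  classical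
  induction J using Finset.induction_on with
  | empty =>
    intro V hV hVT y _
    rw [Finset.coe_empty, Set.union_empty] at hV
    subst hV
    exact ⟨y, rfl⟩
  | insert q J hqJ ih =>
    intro V hV hVT y hy
    by_cases hqS : q ∈ S
    · refine ih V ?_ hVT y hy
      rw [hV, Finset.coe_insert, Set.union_insert, Set.insert_eq_of_mem (show q ∈ S ∪ ↑J from Or.inl hqS)]
    · rw [Finset.coe_insert, Set.union_insert] at hV
      subst hV
      have hqT : q ∈ T := hVT (Set.mem_insert _ _)
      have : Fact q.Prime := ⟨hT q hqT⟩
      have hqU : q ∉ S ∪ ↑J := by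
        rintro (h | h)
        exacts [hqS h, hqJ h]
      have hUT : S ∪ ↑J ⊆ T := (Set.subset_insert _ _).trans hVT
      let Q : ↑(T \ S) := ⟨q, hqT, hqS⟩
      obtain ⟨y', rfl⟩ := exists_preimage_of_tame_symbol_eq_zero
        (fun p hp => hT p (hUT hp)) hqU (Or.inl h2) (Or.inl h3)
        (Θ := (Θ Q).comp (mapH2 (slMap (inclZS hVT)))) (fun x => by
          rw [LinearMap.comp_apply, mapH2_inclZS_inclZS]
          exact hΘ Q _ hUT hqU x)
        (fun m => hΘ' Q _ hVT hqU (Or.inl h2) (Or.inl h3) m) (x := y) (hy Q)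
      rw [mapH2_inclZS_inclZS] at hy ⊢
      exact ih _ rfl hUT y' hy

/-- The cokernel of `H₂(SL₂(ℤ_S)) → H₂(SL₂(ℤ_T))` is the direct sum of the multiplicative groups of
the residue fields at the primes in `T \ S`. -/
theorem nonempty_cokernel_addEquiv (hT : ∀ p ∈ T, p.Prime) (hST : S ⊆ T)
    (h2 : 2 ∈ S) (h3 : 3 ∈ S) :
    Nonempty ((H2 (SLtwo (ZS T)) ⧸ LinearMap.range (mapH2 (slMap (inclZS hST)))) ≃+
      DirectSum ↑(T \ S) (fun q => Additive (ZMod (q : ℕ))ˣ)) := by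
  classical
  have (q : ↑(T \ S)) : Fact (q : ℕ).Prime := ⟨hT q q.2.1⟩
  choose Θ hΘ hΘ' using fun q : ↑(T \ S) => exists_tame_symbol (q := q) hT q.2.1 (hST h2)
  let F : (H2 (SLtwo (ZS T)) ⧸ LinearMap.range (mapH2 (slMap (inclZS hST)))) →ₗ[ℤ]
      ∀ q : ↑(T \ S), Additive (ZMod (q : ℕ))ˣ :=
    Submodule.liftQ _ (LinearMap.pi Θ) (by
      rintro _ ⟨y, rfl⟩
      exact funext fun q => hΘ q S hST q.2.2 y)
  have hF (x q) : F (Submodule.Quotient.mk x) q = Θ q x := rfl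
  have hFinj : Function.Injective F := by
    rw [injective_iff_map_eq_zero]
    intro a ha
    obtain ⟨x, rfl⟩ := Submodule.Quotient.mk_surjective _ a
    obtain ⟨J, hJ, y, rfl⟩ := exists_finite_support hT hST x
    obtain ⟨w, hw⟩ := exists_preimage_of_tame_symbols_eq_zero hT hST h2 h3 Θ hΘ hΘ' J _ rfl hJ y
      (fun q => congrFun ha q)
    exact (Submodule.Quotient.mk_eq_zero _).2 ⟨w, hw⟩
  let β : ↑(T \ S) → Type := fun q => Additive (ZMod (q : ℕ))ˣ
  let C : AddMonoidHom (DirectSum ↑(T \ S) (fun q => Additive (ZMod (q : ℕ))ˣ))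
      (∀ q : ↑(T \ S), Additive (ZMod (q : ℕ))ˣ) := DirectSum.coeFnAddMonoidHom _
  have hCinj : Function.Injective C := DFunLike.coe_injective
  have hrange : F.toAddMonoidHom.range =
      AddMonoidHom.range (G := DirectSum ↑(T \ S) (fun q => Additive (ZMod (q : ℕ))ˣ)) C := by
    apply le_antisymm
    · rintro _ ⟨a, rfl⟩
      obtain ⟨x, rfl⟩ := Submodule.Quotient.mk_surjective _ a
      obtain ⟨J, hJ, y, rfl⟩ := exists_finite_support hT hST x
      have hfin : Set.Finite {q : ↑(T \ S) | (q : ℕ) ∈ J} :=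
        J.finite_toSet.preimage Subtype.val_injective.injOn
      let f : ∀ q : (hfin.toFinset : Set ↑(T \ S)), β q.1 :=
        fun q => Θ q.1 (mapH2 (slMap (inclZS hJ)) y)
      refine ⟨DirectSum.mk β hfin.toFinset f, ?_⟩
      funext q
      change DirectSum.mk β hfin.toFinset f q = Θ q (mapH2 (slMap (inclZS hJ)) y)
      by_cases hq : (q : ℕ) ∈ J
      · exact DirectSum.mk_apply_of_mem (β := β) (f := f) (hfin.mem_toFinset.2 hq)
      · refine (DirectSum.mk_apply_of_notMem (β := β) (f := f) (mt hfin.mem_toFinset.1 hq)).trans ?_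
        refine (hΘ q _ hJ ?_ y).symm
        rintro (h | h)
        exacts [q.2.2 h, hq h]
    · rintro _ ⟨d, rfl⟩
      induction d using DirectSum.induction_on with
      | zero => rw [map_zero]; exact zero_mem _
      | add a b ha hb => rw [map_add]; exact add_mem ha hb
      | of q m =>
        have hUT : insert (q : ℕ) S ⊆ T := Set.insert_subset q.2.1 hST
        obtain ⟨x, hx⟩ := hΘ' q S hUT q.2.2 h2 h3 m
        refine ⟨Submodule.Quotient.mk (mapH2 (slMap (inclZS hUT)) x), ?_⟩
        funext q'
        change Θ q' _ = DirectSum.of β q m q'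
        by_cases hq : q = q'
        · subst hq
          rw [DirectSum.of_eq_same, hx]
        · rw [DirectSum.of_eq_of_ne _ _ _ (Ne.symm hq)]
          refine hΘ q' _ hUT ?_ x
          rintro (h | h)
          exacts [hq (Subtype.ext h.symm), q'.2.2 h]
  exact ⟨((AddMonoidHom.ofInjective (f := F.toAddMonoidHom) hFinj).trans
    (AddEquiv.addSubgroupCongr hrange)).trans (AddMonoidHom.ofInjective hCinj).symm⟩

end Assembly

/-- if `ℤ_S` has a unit `λ` with `λ² − 1` a unit and `T ⊇ S` is a set of primes,
then the cokernel of `H₂(SL₂(ℤ_S), ℤ) → H₂(SL₂(ℤ_T), ℤ)` is isomorphic to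
`⊕_{q ∈ T∖S} (ℤ/qℤ)^×`. -/
theorem stmt13 (S T : Set ℕ) (hS : S.Nonempty) (hTprime : ∀ p ∈ T, Nat.Prime p)
    (hST : S ⊆ T)
    (hlam : ∃ lam : (ZS S)ˣ, IsUnit ((lam : ZS S) ^ 2 - 1)) :
    Nonempty
      ((H2 (Matrix.SpecialLinearGroup (Fin 2) (ZS T)) ⧸
        LinearMap.range (mapH2 (Matrix.SpecialLinearGroup.map (n := Fin 2)
          (Subring.inclusion (Subring.closure_mono (Set.image_mono hST)))))) ≃+
        (DirectSum ↑(T \ S) (fun q => Additive (ZMod (q : ℕ))ˣ))) := by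
  have hSp : ∀ p ∈ S, p.Prime := fun p hp => hTprime p (hST hp)
  obtain ⟨h2, h3⟩ := two_three_mem hSp hlam
  exact nonempty_cokernel_addEquiv hTprime hST h2 h3
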